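/- Let n ≥ 3, K > 0, M > 0, m₀ > 0 and Λ > 0. There exists a constant C > 0, depending only on n, K, M, m₀ and Λ, with the following property: let f : B₅ × ℝ × ℝⁿ → ℝ be a function with f ≥ m₀, which is continuously differentiable with |f| + |Df| ≤ Λ and with Df Lipschitz continuous with Lipschitz constant ≤ Λ (i.e. ‖f‖_{C^{1,1}} ≤ Λ); let u : ℝⁿ → ℝ be C⁴ on B₅ with λ(D²u(x)) ∈ Γ̃₃ for every x ∈ B₅, solving σ₃(D²u(x)) + σ₂(D²u(x)) = f(x, u(x), Du(x)) on B₅, K-semi-convex on B₅ (every eigenvalue of D²u ≥ -K), and with |u| + |Du| ≤ M on B₅. Then the operator norm of D²u(0) is at most C. -/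

import Mathlib

open scoped BigOperators
noncomputable section

/-- The `k`-th elementary symmetric function of `lam ∈ ℝⁿ`. -/
def esymm (n k : ℕ) (lam : Fin n → ℝ) : ℝ :=
  ∑ s ∈ Finset.univ.powersetCard k, ∏ i ∈ s, lam i

/-- `σ_k` of a matrix: the `k`-th elementary symmetric function of its eigenvalues,
read off from the characteristic polynomial. -/
def sigmaMat {n : ℕ} (k : ℕ) (A : Matrix (Fin n) (Fin n) ℝ) : ℝ :=
  (-1 : ℝ) ^ k * (Matrix.charpoly A).coeff (n - k)

/-- The Hessian matrix `D²u(x)`. -/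
def hess {n : ℕ} (u : EuclideanSpace ℝ (Fin n) → ℝ) (x : EuclideanSpace ℝ (Fin n)) :
    Matrix (Fin n) (Fin n) ℝ :=
  fun i j =>
    fderiv ℝ (fun y => fderiv ℝ u y (EuclideanSpace.single j 1)) x (EuclideanSpace.single i 1)

/-- Operator norm of a matrix acting on Euclidean space. -/
def opNorm {n : ℕ} (A : Matrix (Fin n) (Fin n) ℝ) : ℝ :=
  ‖Matrix.toEuclideanCLM (𝕜 := ℝ) A‖

/-! ### Scalar inequalities for one eigenvalue `a` against the remaining ones -/

/-- Data of one eigenvalue `a` and the first power sums `e, q, c` of the remaining ones (the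
additional eigenvalue `1` included), on the cone of the sum Hessian operator. -/
structure Split (m₀ a e q c : ℝ) : Prop where
  sum_pos : 1 < a + e
  sig_gt : a + e - 1 < a * e + (e ^ 2 - q) / 2
  one_le : 1 ≤ q
  cube : ∃ t, 0 ≤ t ∧ q = 1 + t ^ 2 ∧ c ≤ 1 + t ^ 3
  f_ge : m₀ ≤ a * ((e ^ 2 - q) / 2) + (e ^ 3 - 3 * e * q + 2 * c) / 6

namespace Split

variable {m₀ a e q c : ℝ}

theorem exists_root (h : Split m₀ a e q c) : ∃ r, 1 ≤ r ∧ q = r ^ 2 ∧ c ≤ r ^ 3 ∧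
    (2 ≤ r → c ≤ r ^ 3 - r / 2) := by
  obtain ⟨t, ht, hq, hc⟩ := h.cube
  have hq1 : 0 ≤ q := by linarith [h.one_le]
  have hr : Real.sqrt q ^ 2 = q := Real.sq_sqrt hq1
  set r := Real.sqrt q with hrdef
  have hr0 : 0 ≤ r := Real.sqrt_nonneg q
  have hr1 : 1 ≤ r := by nlinarith [h.one_le]
  have htr : t ≤ r := by nlinarith
  have hrt : r ^ 2 = 1 + t ^ 2 := by linarith
  have h1 : r ≤ 1 + t := by nlinarith
  refine ⟨r, hr1, hr.symm, ?_, ?_⟩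
  · have : (1 : ℝ) + t ^ 3 ≤ r ^ 3 := by
      have : r ^ 3 = r * (1 + t ^ 2) := by rw [← hrt]; ring
      nlinarith [mul_nonneg (sub_nonneg.2 htr) (sq_nonneg t)]
    linarith
  · intro h2
    have ht3 : t ^ 2 ≥ 3 := by nlinarith
    have e1 : r ^ 3 = r * (1 + t ^ 2) := by rw [← hrt]; ring
    have : (r - t) * (r + t) = 1 := by nlinarith
    have h3 : 1 / 2 ≤ (r - t) * r := by nlinarith
    -- `(r - t) t² ≥ t² / (2 r)` and `r / 2 + t² / (2 r) ≥ 1`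
    have h4 : (r - t) * t ^ 2 * r ≥ t ^ 2 / 2 := by nlinarith [sq_nonneg t]
    have h5 : r * (1 + t ^ 3) ≤ r * (r ^ 3 - r / 2) := by
      rw [e1]; nlinarith
    have := le_of_mul_le_mul_left h5 (by linarith)
    linarith

theorem e_pos (h : Split m₀ a e q c) : 0 < e := by
  by_contra hc
  push Not at hc
  nlinarith [h.sum_pos, h.sig_gt, h.one_le, mul_nonneg (by linarith : 0 ≤ -e)
    (by linarith [h.sum_pos] : 0 ≤ a + e), sq_nonneg e]

theorem F_pos (h : Split m₀ a e q c) (hm : 0 < m₀) : 0 < (e ^ 2 - q) / 2 := by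
  obtain ⟨r, hr, rfl, hc, -⟩ := h.exists_root
  have he := h.e_pos
  by_contra hF
  push Not at hF
  set F := (e ^ 2 - r ^ 2) / 2 with hFd
  have hs : 0 < a * e + F := by linarith [h.sum_pos, h.sig_gt]
  have h1 : a * e * F ≤ -F ^ 2 := by nlinarith
  have h2 : 0 < e * (a * F + (e ^ 3 - 3 * e * r ^ 2 + 2 * c) / 6) :=
    mul_pos he (lt_of_lt_of_le hm h.f_ge)
  have h3 : e * c ≤ e * r ^ 3 := mul_le_mul_of_nonneg_left hc he.le
  have h4 : e * (e ^ 3 - 3 * e * r ^ 2 + 2 * r ^ 3) / 6 - F ^ 2 =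
      -(e - r) ^ 2 * ((e + r) ^ 2 / 12 + r ^ 2 / 6) := by rw [hFd]; ring
  have h5 : 0 ≤ (e - r) ^ 2 * ((e + r) ^ 2 / 12 + r ^ 2 / 6) := by positivity
  nlinarith

theorem one_lt_e (h : Split m₀ a e q c) (hm : 0 < m₀) : 1 < e := by
  have := h.F_pos hm
  nlinarith [h.one_le, h.e_pos]

theorem F_sigma_ge (h : Split m₀ a e q c) (hm : 0 < m₀) :
    ∃ r, 1 ≤ r ∧ q = r ^ 2 ∧ min (m₀ / 3) (1 / 9) * (e * (1 + r)) ≤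
      (e ^ 2 - q) / 2 * (a * e + (e ^ 2 - q) / 2) := by
  have hF := h.F_pos hm
  have he := h.e_pos
  obtain ⟨r, hr, rfl, hc, hc2⟩ := h.exists_root
  refine ⟨r, hr, rfl, ?_⟩
  set F := (e ^ 2 - r ^ 2) / 2 with hFd
  have h4 : e * (e ^ 3 - 3 * e * r ^ 2 + 2 * r ^ 3) / 6 - F ^ 2 =
      -(e - r) ^ 2 * ((e + r) ^ 2 / 12 + r ^ 2 / 6) := by rw [hFd]; ring
  have h5 : 0 ≤ (e - r) ^ 2 * ((e + r) ^ 2 / 12 + r ^ 2 / 6) := by positivity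
  have hf := mul_le_mul_of_nonneg_left h.f_ge he.le
  rcases le_total 2 r with h2 | h2
  · have h6 : e * c ≤ e * (r ^ 3 - r / 2) := mul_le_mul_of_nonneg_left (hc2 h2) he.le
    have h7 : min (m₀ / 3) (1 / 9) * (e * (1 + r)) ≤ 1 / 9 * (e * (1 + r)) :=
      mul_le_mul_of_nonneg_right (min_le_right _ _) (by positivity)
    nlinarith [mul_pos he hm, mul_nonneg he.le (by linarith : 0 ≤ r - 2)]
  · have h6 : e * c ≤ e * r ^ 3 := mul_le_mul_of_nonneg_left hc he.le
    have h7 : min (m₀ / 3) (1 / 9) * (e * (1 + r)) ≤ m₀ / 3 * (e * (1 + r)) :=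
      mul_le_mul_of_nonneg_right (min_le_left _ _) (by positivity)
    nlinarith [mul_pos he hm, mul_nonneg (mul_pos he hm).le (by linarith : 0 ≤ 2 - r)]

/-- `F (1 + a²)` dominates `σ`. -/
theorem F_mul_ge (hm : 0 < m₀) : ∃ c₀ > 0, ∀ a e q c, Split m₀ a e q c →
    c₀ * (a * e + (e ^ 2 - q) / 2) ≤ (e ^ 2 - q) / 2 * (1 + a ^ 2) := by
  set k := min (m₀ / 3) (1 / 9) with hk
  have hk0 : 0 < k := by positivity
  have hk1 : k ≤ 1 / 9 := min_le_right _ _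
  refine ⟨k / 8, by positivity, fun a e q c h => ?_⟩
  obtain ⟨r, hr, rfl, hF3⟩ := h.F_sigma_ge hm
  have hF := h.F_pos hm
  have he := h.one_lt_e hm
  set F := (e ^ 2 - r ^ 2) / 2 with hFd
  have hs : 0 < a * e + F := by linarith [h.sum_pos, h.sig_gt]
  rcases le_total (a * e) F with h1 | h1
  · nlinarith [mul_nonneg hF.le (sq_nonneg a)]
  · have ha : 0 < a := by
      by_contra hc; push Not at hc; nlinarith
    have h2 : k * (1 + r) ≤ 2 * (a * F) := by
      have : e * (k * (1 + r)) ≤ e * (2 * (a * F)) := by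
        have : F * (a * e + F) ≤ F * (2 * (a * e)) := by
          apply mul_le_mul_of_nonneg_left _ hF.le; linarith
        linarith
      exact le_of_mul_le_mul_left this (by linarith)
    have h3 : e ≤ 1 + r + F := by nlinarith
    have h4 : k * e ≤ 2 * (a * F) + k * F := by nlinarith
    have h5 : a * (k * e) ≤ a * (2 * (a * F) + k * F) := mul_le_mul_of_nonneg_left h4 ha.le
    have h6 : 0 ≤ F * (1 - a) ^ 2 := by positivity
    have h7 : k * (a * F) ≤ a * F := by
      have := mul_pos ha hF
      nlinarith
    nlinarith

/-- `e² ≤ C F σ`. -/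
theorem e_sq_le (hm : 0 < m₀) : ∃ C > 0, ∀ a e q c, Split m₀ a e q c → 2 ≤ a + e →
    e ^ 2 ≤ C * ((e ^ 2 - q) / 2 * (a * e + (e ^ 2 - q) / 2)) := by
  set k := min (m₀ / 3) (1 / 9) with hk
  have hk0 : 0 < k := by positivity
  have hk1 : k ≤ 1 / 9 := min_le_right _ _
  refine ⟨3 / k, by positivity, fun a e q c h hs => ?_⟩
  obtain ⟨r, hr, rfl, hF3⟩ := h.F_sigma_ge hm
  have hF := h.F_pos hm
  have he := h.one_lt_e hm
  have hsg := h.sig_gt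
  set F := (e ^ 2 - r ^ 2) / 2 with hFd
  rw [div_mul_eq_mul_div, le_div_iff₀ hk0]
  rcases le_total e (2 * (1 + r)) with h1 | h1
  · have : k * (e * e) ≤ k * (e * (2 * (1 + r))) := by gcongr
    nlinarith
  · have h2 : 3 / 8 * e ^ 2 ≤ F := by rw [hFd]; nlinarith
    have h3 : F * 1 ≤ F * (a * e + F) := mul_le_mul_of_nonneg_left (by linarith) hF.le
    nlinarith [sq_nonneg e]

theorem F_ge_inv (hm : 0 < m₀) : ∃ c₀ > 0, ∀ a e q c, Split m₀ a e q c → 2 ≤ a + e →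
    c₀ ≤ (e ^ 2 - q) / 2 * (a + e) := by
  set k := min (m₀ / 3) (1 / 9) with hk
  have hk0 : 0 < k := by positivity
  have hk1 : k ≤ 1 / 9 := min_le_right _ _
  refine ⟨k / 2, by positivity, fun a e q c h hs => ?_⟩
  obtain ⟨r, hr, rfl, hF3⟩ := h.F_sigma_ge hm
  have hF := h.F_pos hm
  have he := h.one_lt_e hm
  have hsg := h.sig_gt
  set F := (e ^ 2 - r ^ 2) / 2 with hFd
  rcases le_total (a * e) F with h1 | h1
  · nlinarith
  · have h2 : k ≤ 2 * (a * F) := by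
      have : e * k ≤ e * (2 * (a * F)) := by
        have : F * (a * e + F) ≤ F * (2 * (a * e)) := by
          apply mul_le_mul_of_nonneg_left _ hF.le; linarith
        have h8 : k * (e * 1) ≤ k * (e * (1 + r)) := by gcongr; linarith
        linarith
      exact le_of_mul_le_mul_left this (by linarith)
    nlinarith [mul_pos hF (by linarith : 0 < e)]

theorem F_le {K : ℝ} (hK : 0 ≤ K) (hm : 0 < m₀) (h : Split m₀ a e q c) (hs : 2 ≤ a + e)
    (ha : -K ≤ a) :
    (e ^ 2 - q) / 2 ≤ (1 + K) ^ 2 * (a * e + (e ^ 2 - q) / 2) := by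
  have hF := h.F_pos hm
  have he := h.one_lt_e hm
  have hsg := h.sig_gt
  set F := (e ^ 2 - q) / 2 with hFd
  have h1 : F ≤ a * e + F + K * e := by nlinarith
  have h2 : e ≤ (a * e + F) * (2 + K) := by nlinarith
  nlinarith [mul_le_mul_of_nonneg_left h2 hK]

end Split

/-! ### Elementary facts on power sums of nonnegative numbers -/

theorem sum_cube_le_sqrt {ι : Type*} (S : Finset ι) (x : ι → ℝ) :
    ∑ i ∈ S, x i ^ 3 ≤ Real.sqrt (∑ i ∈ S, x i ^ 2) ^ 3 := by
  have h0 : 0 ≤ ∑ i ∈ S, x i ^ 2 := Finset.sum_nonneg fun i _ => sq_nonneg _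
  set t := Real.sqrt (∑ i ∈ S, x i ^ 2) with ht
  have ht2 : t ^ 2 = ∑ i ∈ S, x i ^ 2 := Real.sq_sqrt h0
  have ht0 : 0 ≤ t := Real.sqrt_nonneg _
  calc ∑ i ∈ S, x i ^ 3 ≤ ∑ i ∈ S, t * x i ^ 2 := by
        refine Finset.sum_le_sum fun i hi => ?_
        have : x i ^ 2 ≤ t ^ 2 := by
          rw [ht2]; exact Finset.single_le_sum (f := fun i => x i ^ 2) (fun i _ => sq_nonneg _) hi
        have hx : x i ≤ t := by nlinarith
        nlinarith [mul_nonneg (sub_nonneg.2 hx) (sq_nonneg (x i))]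
    _ = t ^ 3 := by rw [← Finset.mul_sum, ← ht2]; ring

theorem newton_nonneg {ι : Type*} (S : Finset ι) (x : ι → ℝ) (hx : ∀ i ∈ S, 0 ≤ x i) :
    0 ≤ ∑ i ∈ S, x i ∧ ∑ i ∈ S, x i ^ 2 ≤ (∑ i ∈ S, x i) ^ 2 ∧
    0 ≤ (∑ i ∈ S, x i) ^ 3 - 3 * (∑ i ∈ S, x i) * (∑ i ∈ S, x i ^ 2) + 2 * ∑ i ∈ S, x i ^ 3 := by
  classical
  induction S using Finset.induction_on with
  | empty => simp
  | insert a S ha ih =>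
    obtain ⟨h1, h2, h3⟩ := ih fun i hi => hx i (Finset.mem_insert_of_mem hi)
    have hxa := hx a (Finset.mem_insert_self _ _)
    simp only [Finset.sum_insert ha]
    set p := ∑ i ∈ S, x i
    set p2 := ∑ i ∈ S, x i ^ 2
    set p3 := ∑ i ∈ S, x i ^ 3
    refine ⟨by linarith, by nlinarith, ?_⟩
    nlinarith [mul_nonneg hxa (sub_nonneg.2 h2)]

theorem two_mul_le_sq_sub {ι : Type*} [DecidableEq ι] (S : Finset ι) (x : ι → ℝ)
    (hx : ∀ i ∈ S, 0 ≤ x i) {b c : ι} (hb : b ∈ S) (hc : c ∈ S) (hbc : b ≠ c) :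
    2 * (x b * x c) ≤ (∑ i ∈ S, x i) ^ 2 - ∑ i ∈ S, x i ^ 2 := by
  have hc' : c ∈ S.erase b := Finset.mem_erase.2 ⟨hbc.symm, hc⟩
  obtain ⟨h1, h2, -⟩ := newton_nonneg ((S.erase b).erase c) x fun i hi =>
    hx i (Finset.mem_of_mem_erase (Finset.mem_of_mem_erase hi))
  rw [← Finset.add_sum_erase S x hb, ← Finset.add_sum_erase (S.erase b) x hc',
    ← Finset.add_sum_erase S (fun i => x i ^ 2) hb,
    ← Finset.add_sum_erase (S.erase b) (fun i => x i ^ 2) hc']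
  have := hx b hb
  have := hx c hc
  nlinarith [mul_nonneg (hx b hb) h1, mul_nonneg (hx c hc) h1]

/-! ### Eigenvalues of an admissible Hessian -/

section Eigen

variable {n : ℕ}

/-- `1 + Σ λ`. -/
def es (lam : Fin n → ℝ) : ℝ := 1 + ∑ i, lam i
/-- `1 + Σ λ²`. -/
def eq2 (lam : Fin n → ℝ) : ℝ := 1 + ∑ i, lam i ^ 2
/-- `1 + Σ λ³`. -/
def ec (lam : Fin n → ℝ) : ℝ := 1 + ∑ i, lam i ^ 3
/-- `σ₂ + σ₁`. -/
def esig (lam : Fin n → ℝ) : ℝ := (es lam ^ 2 - eq2 lam) / 2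
/-- `σ₃ + σ₂`. -/
def ef (lam : Fin n → ℝ) : ℝ := (es lam ^ 3 - 3 * es lam * eq2 lam + 2 * ec lam) / 6
/-- The derivative of `σ₃ + σ₂` in the direction of an eigenvalue. -/
def eF (lam : Fin n → ℝ) (i : Fin n) : ℝ := esig lam - es lam * lam i + lam i ^ 2

/-- Admissible semi-convex eigenvalues. -/
structure Adm (K m₀ Λ : ℝ) (lam : Fin n → ℝ) : Prop where
  K_nonneg : 0 ≤ K
  m_pos : 0 < m₀
  lower : ∀ i, -K ≤ lam i
  sum_pos : 1 < es lam
  sig_gt : es lam - 1 < esig lam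
  f_ge : m₀ ≤ ef lam
  f_le : ef lam ≤ Λ

theorem eF_eq (lam : Fin n → ℝ) (i : Fin n) :
    eF lam i = ((es lam - lam i) ^ 2 - (eq2 lam - lam i ^ 2)) / 2 := by
  unfold eF esig; ring

theorem esig_eq (lam : Fin n → ℝ) (i : Fin n) :
    esig lam = lam i * (es lam - lam i) + eF lam i := by
  unfold eF; ring

theorem shift_bounds {n K : ℝ} (hn : 1 ≤ n) (hK : 0 ≤ K) :
    K * (n - 2) ≤ (n + K + 1) ^ 6 ∧ K ^ 2 * ((n - 1) * (n - 2) / 2) ≤ (n + K + 1) ^ 6 ∧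
      K ^ 3 * (n * (n - 1) * (n - 2) / 6) ≤ (n + K + 1) ^ 6 := by
  have hX : 1 ≤ n + K + 1 := by linarith
  have hX1 : K ≤ n + K + 1 := by linarith
  have hX2 : n ≤ n + K + 1 := by linarith
  refine ⟨?_, ?_, ?_⟩
  · calc K * (n - 2) ≤ K * n := by gcongr; linarith
      _ ≤ (n + K + 1) * (n + K + 1) := by gcongr
      _ = (n + K + 1) ^ 2 := by ring
      _ ≤ _ := pow_le_pow_right₀ hX (by norm_num)
  · calc K ^ 2 * ((n - 1) * (n - 2) / 2) ≤ K ^ 2 * n ^ 2 := by gcongr; nlinarith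
      _ ≤ (n + K + 1) ^ 2 * (n + K + 1) ^ 2 := by gcongr
      _ = (n + K + 1) ^ 4 := by ring
      _ ≤ _ := pow_le_pow_right₀ hX (by norm_num)
  · have h1 : 0 ≤ n * (n - 1) := mul_nonneg (by linarith) (by linarith)
    have h2 : 0 ≤ n ^ 3 := by positivity
    calc K ^ 3 * (n * (n - 1) * (n - 2) / 6) ≤ K ^ 3 * n ^ 3 := by gcongr; nlinarith
      _ ≤ (n + K + 1) ^ 3 * (n + K + 1) ^ 3 := by gcongr
      _ = (n + K + 1) ^ 6 := by ring

theorem third_num {B Λ N a b c e F : ℝ} (hB : 1 ≤ B) (hN : 1 ≤ N) (hΛ : 0 < Λ) (hc : B ≤ c)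
    (hcb : c ≤ b) (hba : b ≤ a) (he : 1 < e) (hea : e ≤ N * a)
    (h2 : c * F ≤ (2 * Λ + B) * (1 + e)) (h4 : a * b ≤ F + B ^ 2 * (1 + e)) :
    c ≤ 4 * N * (Λ + B) + 8 * N * B ^ 3 := by
  have hc0 : 0 < c := by linarith
  have ha0 : 0 < a := by linarith
  have h5 : c * (a * b) ≤ (2 * Λ + B) * (1 + e) + c * (B ^ 2 * (1 + e)) := by
    have := mul_le_mul_of_nonneg_left h4 hc0.le
    linarith
  have h6 : 1 + e ≤ 2 * N * a := by linarith
  have c1 : (2 * Λ + B) * 1 ≤ (2 * Λ + B) * c :=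
    mul_le_mul_of_nonneg_left (by linarith) (by linarith)
  have c2 := mul_le_mul_of_nonneg_right c1 (by linarith : 0 ≤ 1 + e)
  have c3 : ((2 * Λ + B) * c + c * B ^ 2) * (1 + e) ≤
      ((2 * Λ + B) * c + c * B ^ 2) * (2 * N * a) :=
    mul_le_mul_of_nonneg_left h6 (by positivity)
  have h7 : c * (a * b) ≤ c * (a * (2 * N * (2 * Λ + B + B ^ 2))) := by linarith
  have h8 := le_of_mul_le_mul_left (le_of_mul_le_mul_left h7 hc0) ha0
  have h9 : B ^ 2 ≤ B ^ 3 := pow_le_pow_right₀ hB (by norm_num)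
  have h10 : N * B ^ 2 ≤ N * B ^ 3 := mul_le_mul_of_nonneg_left h9 (by linarith)
  have : 0 ≤ N * B ^ 3 := by positivity
  have : 0 ≤ N * B := by positivity
  linarith

theorem es_sub (lam : Fin n → ℝ) (i : Fin n) :
    es lam - lam i = 1 + ∑ j ∈ Finset.univ.erase i, lam j := by
  unfold es; rw [← Finset.add_sum_erase _ _ (Finset.mem_univ i)]; ring

theorem eq2_sub (lam : Fin n → ℝ) (i : Fin n) :
    eq2 lam - lam i ^ 2 = 1 + ∑ j ∈ Finset.univ.erase i, lam j ^ 2 := by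
  unfold eq2; rw [← Finset.add_sum_erase _ _ (Finset.mem_univ i)]; ring

theorem ec_sub (lam : Fin n → ℝ) (i : Fin n) :
    ec lam - lam i ^ 3 = 1 + ∑ j ∈ Finset.univ.erase i, lam j ^ 3 := by
  unfold ec; rw [← Finset.add_sum_erase _ _ (Finset.mem_univ i)]; ring

/-- `σ₃` of the remaining eigenvalues, the additional eigenvalue `1` included. -/
def erest (lam : Fin n → ℝ) (i : Fin n) : ℝ :=
  ((es lam - lam i) ^ 3 - 3 * (es lam - lam i) * (eq2 lam - lam i ^ 2)
    + 2 * (ec lam - lam i ^ 3)) / 6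

theorem ef_eq (lam : Fin n → ℝ) (i : Fin n) : ef lam = lam i * eF lam i + erest lam i := by
  unfold ef eF erest esig; ring

namespace Adm

variable {K m₀ Λ : ℝ} {lam : Fin n → ℝ}

theorem split (h : Adm K m₀ Λ lam) (i : Fin n) :
    Split m₀ (lam i) (es lam - lam i) (eq2 lam - lam i ^ 2) (ec lam - lam i ^ 3) where
  sum_pos := by linarith [h.sum_pos]
  sig_gt := by
    have := h.sig_gt
    rw [esig_eq lam i, eF_eq] at this
    linarith
  one_le := by
    rw [eq2_sub]
    linarith [Finset.sum_nonneg fun j (_ : j ∈ Finset.univ.erase i) => sq_nonneg (lam j)]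
  cube := by
    refine ⟨Real.sqrt (∑ j ∈ Finset.univ.erase i, lam j ^ 2), Real.sqrt_nonneg _, ?_, ?_⟩
    · rw [eq2_sub, Real.sq_sqrt]
      exact Finset.sum_nonneg fun i _ => sq_nonneg _
    · rw [ec_sub]
      linarith [sum_cube_le_sqrt (Finset.univ.erase i) lam]
  f_ge := by
    have := h.f_ge
    rw [ef_eq lam i, eF_eq] at this
    exact this

theorem F_pos (h : Adm K m₀ Λ lam) (i : Fin n) : 0 < eF lam i := by
  rw [eF_eq]; exact (h.split i).F_pos h.m_pos

theorem one_lt_e (h : Adm K m₀ Λ lam) (i : Fin n) : 1 < es lam - lam i :=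
  (h.split i).one_lt_e h.m_pos

theorem sq_rest_lt (h : Adm K m₀ Λ lam) (i : Fin n) :
    eq2 lam - lam i ^ 2 < (es lam - lam i) ^ 2 := by
  have := h.F_pos i
  rw [eF_eq] at this; linarith

theorem abs_lt_e (h : Adm K m₀ Λ lam) {i j : Fin n} (hij : j ≠ i) :
    |lam j| < es lam - lam i := by
  have h1 := h.sq_rest_lt i
  have h2 : lam j ^ 2 ≤ ∑ j ∈ Finset.univ.erase i, lam j ^ 2 :=
    Finset.single_le_sum (f := fun j => lam j ^ 2) (fun i _ => sq_nonneg _)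
      (Finset.mem_erase.2 ⟨hij, Finset.mem_univ _⟩)
  rw [eq2_sub] at h1
  exact abs_lt_of_sq_lt_sq (by linarith) (by linarith [h.one_lt_e i])

theorem Fij_pos (h : Adm K m₀ Λ lam) {i j : Fin n} (hij : j ≠ i) :
    0 < es lam - lam i - lam j := by
  linarith [h.abs_lt_e hij, le_abs_self (lam j)]

theorem sig_pos (h : Adm K m₀ Λ lam) : 0 < esig lam := by linarith [h.sum_pos, h.sig_gt]

theorem sig_le_F_mul (n : ℕ) {m₀ : ℝ} (hm : 0 < m₀) : ∃ C > 0, ∀ (K Λ : ℝ) (lam : Fin n → ℝ),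
    Adm K m₀ Λ lam → ∀ i, esig lam ≤ C * (eF lam i * (1 + lam i ^ 2)) := by
  obtain ⟨c, hc, H⟩ := Split.F_mul_ge hm
  refine ⟨1 / c, by positivity, fun K Λ lam h i => ?_⟩
  have := H _ _ _ _ (h.split i)
  rw [← eF_eq, ← esig_eq] at this
  rw [div_mul_eq_mul_div, le_div_iff₀ hc]
  linarith

theorem e_sq_le (n : ℕ) {m₀ : ℝ} (hm : 0 < m₀) : ∃ C > 0, ∀ (K Λ : ℝ) (lam : Fin n → ℝ),
    Adm K m₀ Λ lam → 2 ≤ es lam → ∀ i, (es lam - lam i) ^ 2 ≤ C * (eF lam i * esig lam) := by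
  obtain ⟨c, hc, H⟩ := Split.e_sq_le hm
  refine ⟨c, hc, fun K Λ lam h hs i => ?_⟩
  have := H _ _ _ _ (h.split i) (by linarith)
  rwa [← eF_eq, ← esig_eq] at this

theorem F_ge_inv (n : ℕ) {m₀ : ℝ} (hm : 0 < m₀) : ∃ c > 0, ∀ (K Λ : ℝ) (lam : Fin n → ℝ),
    Adm K m₀ Λ lam → 2 ≤ es lam → ∀ i, c ≤ eF lam i * es lam := by
  obtain ⟨c, hc, H⟩ := Split.F_ge_inv hm
  refine ⟨c, hc, fun K Λ lam h hs i => ?_⟩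
  have := H _ _ _ _ (h.split i) (by linarith)
  rw [← eF_eq] at this
  linarith [show lam i + (es lam - lam i) = es lam by ring]

theorem F_le (h : Adm K m₀ Λ lam) (hs : 2 ≤ es lam) (i : Fin n) :
    eF lam i ≤ (1 + K) ^ 2 * esig lam := by
  have := (h.split i).F_le h.K_nonneg h.m_pos (by linarith) (h.lower i)
  rwa [← eF_eq, ← esig_eq] at this

/-- Semi-convexity bounds `σ₃` of the remaining eigenvalues from below. -/
theorem rest_ge (h : Adm K m₀ Λ lam) (i : Fin n) :
    -((n + K + 1) ^ 6 * (eF lam i + (es lam - lam i) + 1)) ≤ erest lam i := by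
  have hF := h.F_pos i
  have he := h.one_lt_e i
  have hK := h.K_nonneg
  obtain ⟨h1, h2, h3⟩ := newton_nonneg (Finset.univ.erase i) (fun j => lam j + K)
    (fun j _ => by linarith [h.lower j])
  have hcard : ((Finset.univ.erase i).card : ℝ) = n - 1 := by
    rw [Finset.card_erase_of_mem (Finset.mem_univ _), Finset.card_univ, Fintype.card_fin,
      Nat.cast_sub (by have := i.pos; omega)]
    simp
  have hn : (1 : ℝ) ≤ n := by exact_mod_cast i.pos
  have s1 : ∑ j ∈ Finset.univ.erase i, (lam j + K) = (es lam - lam i - 1) + (n - 1) * K := by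
    rw [Finset.sum_add_distrib, es_sub, Finset.sum_const, nsmul_eq_mul, hcard]; ring
  have s2 : ∑ j ∈ Finset.univ.erase i, (lam j + K) ^ 2 =
      (eq2 lam - lam i ^ 2 - 1) + 2 * K * (es lam - lam i - 1) + (n - 1) * K ^ 2 := by
    rw [es_sub, eq2_sub, ← hcard]
    simp only [add_sq, Finset.sum_add_distrib, Finset.sum_const, nsmul_eq_mul, add_sub_cancel_left,
      Finset.mul_sum]
    congr 2
    exact Finset.sum_congr rfl fun j _ => by ring
  have s3 : ∑ j ∈ Finset.univ.erase i, (lam j + K) ^ 3 =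
      (ec lam - lam i ^ 3 - 1) + 3 * K * (eq2 lam - lam i ^ 2 - 1)
        + 3 * K ^ 2 * (es lam - lam i - 1) + (n - 1) * K ^ 3 := by
    rw [es_sub, eq2_sub, ec_sub, ← hcard]
    have : ∀ j, (lam j + K) ^ 3 = lam j ^ 3 + 3 * K * lam j ^ 2 + 3 * K ^ 2 * lam j + K ^ 3 :=
      fun j => by ring
    simp only [this, Finset.sum_add_distrib, Finset.sum_const, nsmul_eq_mul, add_sub_cancel_left,
      Finset.mul_sum]
  simp only [s1, s2, s3] at h1 h2 h3
  have key : 6 * (erest lam i + K * (n - 2) * eF lam i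
      + K ^ 2 * ((n - 1) * (n - 2) / 2) * (es lam - lam i)
      + K ^ 3 * (n * (n - 1) * (n - 2) / 6)) ≥ 0 := by
    rw [eF_eq]
    unfold erest
    linarith [mul_nonneg (by linarith : 0 ≤ 1 + K) (sub_nonneg.2 h2)]
  set e := es lam - lam i
  set F := eF lam i
  obtain ⟨b1, b2, b3⟩ := shift_bounds hn hK
  linarith [mul_le_mul_of_nonneg_right b1 hF.le,
    mul_le_mul_of_nonneg_right b2 (by linarith : 0 ≤ e)]

/-- A large eigenvalue times its coefficient is controlled. -/
theorem mul_F_le (h : Adm K m₀ Λ lam) (i : Fin n) (hi : 2 * (n + K + 1) ^ 6 ≤ lam i) :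
    lam i * eF lam i ≤ 2 * (Λ + (n + K + 1) ^ 6) * (1 + (es lam - lam i)) := by
  have h1 := h.rest_ge i
  have h2 := ef_eq lam i
  have h3 := h.f_le
  have hΛ : 0 < Λ := lt_of_lt_of_le h.m_pos (h.f_ge.trans h.f_le)
  have hF := h.F_pos i
  have he := h.one_lt_e i
  linarith [mul_le_mul_of_nonneg_right hi hF.le, mul_pos hΛ (by linarith : 0 < es lam - lam i)]

theorem sq_mul_F_le (n : ℕ) {K m₀ Λ : ℝ} (hK : 0 ≤ K) (hΛ : 0 < Λ) : ∃ C > 0,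
    ∀ (lam : Fin n → ℝ), Adm K m₀ Λ lam → 2 ≤ es lam → ∀ i,
      eF lam i * (1 + lam i ^ 2) ≤ C * esig lam := by
  set B := 2 * ((n : ℝ) + K + 1) ^ 6 with hB
  have hB1 : 1 ≤ ((n : ℝ) + K + 1) := by linarith [(Nat.cast_nonneg n : (0 : ℝ) ≤ n)]
  have hB0 : K ≤ B := by
    have := pow_le_pow_right₀ hB1 (show 1 ≤ 6 by norm_num)
    have : (0 : ℝ) ≤ n := Nat.cast_nonneg n
    linarith
  have hBpos : 0 < B := by positivity
  refine ⟨(1 + K) ^ 2 * (1 + B ^ 2) + 4 * (Λ + B), by positivity, fun lam h hs i => ?_⟩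
  have hF := h.F_pos i
  have he := h.one_lt_e i
  have hsg := h.sig_pos
  have h1 := h.F_le hs i
  rcases le_total B (lam i) with hi | hi
  · have h2 := h.mul_F_le i hi
    have h3 : lam i * (es lam - lam i) ≤ esig lam := by linarith [esig_eq lam i]
    have hl : 0 < lam i := lt_of_lt_of_le hBpos hi
    have h4 : lam i * (lam i * eF lam i) ≤
        lam i * (2 * (Λ + (n + K + 1) ^ 6) * (1 + (es lam - lam i))) :=
      mul_le_mul_of_nonneg_left h2 hl.le
    have h5 : lam i * (1 + (es lam - lam i)) ≤ 2 * esig lam := by nlinarith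
    have h6 : 2 * (Λ + (n + K + 1) ^ 6) * (lam i * (1 + (es lam - lam i))) ≤
        2 * (Λ + B) * (2 * esig lam) := by
      apply mul_le_mul _ h5 (by positivity) (by positivity)
      have : 0 ≤ ((n : ℝ) + K + 1) ^ 6 := by positivity
      linarith
    have h7 : 0 ≤ (1 + K) ^ 2 * B ^ 2 * esig lam := by positivity
    linarith
  · have h2 : lam i ^ 2 ≤ B ^ 2 := by
      have := h.lower i
      exact sq_le_sq' (by linarith) hi
    have h3 : eF lam i * (1 + lam i ^ 2) ≤ (1 + K) ^ 2 * esig lam * (1 + B ^ 2) := by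
      apply mul_le_mul h1 (by linarith) (by positivity) (by positivity)
    have h7 : 0 ≤ 4 * (Λ + B) * esig lam := by positivity
    linarith

/-- The third largest eigenvalue is bounded. -/
theorem third_le (n : ℕ) {K m₀ Λ : ℝ} (hK : 0 ≤ K) (hΛ : 0 < Λ) : ∃ C > 0,
    ∀ (lam : Fin n → ℝ), Adm K m₀ Λ lam → ∀ i j k, i ≠ j → i ≠ k → j ≠ k →
      (∀ l, lam l ≤ lam i) → lam k ≤ lam j → lam k ≤ C := by
  set B := 2 * ((n : ℝ) + K + 1) ^ 6 with hB
  have hn0 : (0 : ℝ) ≤ n := Nat.cast_nonneg n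
  have hB1 : 1 ≤ ((n : ℝ) + K + 1) := by linarith
  have hB0 : (n : ℝ) + K + 1 ≤ B := by
    have := pow_le_pow_right₀ hB1 (show 1 ≤ 6 by norm_num)
    linarith
  have hBpos : 0 < B := by positivity
  refine ⟨4 * (n + 1) * (Λ + B) + 8 * (n + 1) * B ^ 3, by positivity,
    fun lam h i j k hij hik hjk hi hkj => ?_⟩
  rcases le_total (lam k) B with hk | hk
  · have p1 : 0 ≤ n * B := by positivity
    have p2 : 0 ≤ (n + 1) * Λ := by positivity
    have p3 : 0 ≤ (n + 1) * B ^ 3 := by positivity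
    linarith
  have h2 := h.mul_F_le k hk
  have hF := h.F_pos k
  have he := h.one_lt_e k
  have hcard : ((Finset.univ.erase k).card : ℝ) = n - 1 := by
    rw [Finset.card_erase_of_mem (Finset.mem_univ _), Finset.card_univ, Fintype.card_fin,
      Nat.cast_sub (by have := i.pos; omega)]
    simp
  have hn : (1 : ℝ) ≤ n := by exact_mod_cast i.pos
  have s1 : ∑ j ∈ Finset.univ.erase k, (lam j + K) = (es lam - lam k - 1) + (n - 1) * K := by
    rw [Finset.sum_add_distrib, es_sub, Finset.sum_const, nsmul_eq_mul, hcard]; ring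
  have s2 : ∑ j ∈ Finset.univ.erase k, (lam j + K) ^ 2 =
      (eq2 lam - lam k ^ 2 - 1) + 2 * K * (es lam - lam k - 1) + (n - 1) * K ^ 2 := by
    rw [es_sub, eq2_sub, ← hcard]
    simp only [add_sq, Finset.sum_add_distrib, Finset.sum_const, nsmul_eq_mul, add_sub_cancel_left,
      Finset.mul_sum]
    congr 2
    exact Finset.sum_congr rfl fun j _ => by ring
  have h3 := two_mul_le_sq_sub (Finset.univ.erase k) (fun j => lam j + K)
    (fun j _ => by linarith [h.lower j]) (Finset.mem_erase.2 ⟨hik, Finset.mem_univ i⟩)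
    (Finset.mem_erase.2 ⟨hjk, Finset.mem_univ j⟩) hij
  have hle : es lam - lam k ≤ (n + 1) * lam i := by
    clear hcard s1 s2 h3
    have : es lam ≤ 1 + ∑ _l : Fin n, lam i := by
      unfold es; gcongr with l; exact hi l
    rw [Finset.sum_const, Finset.card_univ, Fintype.card_fin, nsmul_eq_mul] at this
    have := hi k
    linarith
  simp only [s1, s2] at h3
  have hab : lam i * lam j ≤ (lam i + K) * (lam j + K) := by
    have := mul_nonneg hK (by linarith [hi k] : 0 ≤ lam i + lam j)
    linarith [sq_nonneg K]
  set e := es lam - lam k with hed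
  have h4 : lam i * lam j ≤ eF lam k + B ^ 2 * (1 + e) := by
    have h5' : (n : ℝ) * K ≤ B := by
      calc (n : ℝ) * K ≤ (n + K + 1) * (n + K + 1) := by gcongr <;> linarith
        _ = (n + K + 1) ^ 2 := by ring
        _ ≤ (n + K + 1) ^ 6 := pow_le_pow_right₀ hB1 (by norm_num)
        _ ≤ B := by rw [hB]; linarith [pow_pos (by linarith : (0 : ℝ) < n + K + 1) 6]
    have h5 : (n : ℝ) * K ≤ B ^ 2 :=
      h5'.trans (by rw [sq]; exact le_mul_of_one_le_left hBpos.le (by linarith))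
    have h6 : (n : ℝ) * n * K ^ 2 ≤ B ^ 2 := by
      have := pow_le_pow_left₀ (by positivity) h5' 2
      linarith
    have h7 := eF_eq lam k
    rw [← hed] at h7
    have h8 : (e - 1) * ((n - 2) * K) ≤ (e - 1) * B ^ 2 := by
      apply mul_le_mul_of_nonneg_left _ (by linarith); linarith
    have h9 : ((n : ℝ) - 1) * (n - 2) / 2 * K ^ 2 ≤ n * n * K ^ 2 := by
      apply mul_le_mul_of_nonneg_right _ (sq_nonneg K); clear * - hn; nlinarith
    have h10 : 0 ≤ B ^ 2 := sq_nonneg B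
    linarith
  refine third_num (by linarith) (by linarith : (1 : ℝ) ≤ n + 1) hΛ hk hkj (hi j) he hle ?_ h4
  have : 2 * (n + K + 1) ^ 6 * (1 + e) = B * (1 + e) := by rw [hB]
  linarith

end Adm

end Eigen

/-! ### Quadratic form inequalities behind the trace Jacobi inequality -/

theorem h_le_aux {B e h m y E : ℝ} (he : 1 ≤ e) (heB : e ≤ B) (hh : 0 ≤ h)
    (hm : m ^ 2 ≤ (e ^ 2 - 1) * h) (hy : y = e * E - m) :
    h ≤ 2 * B ^ 2 * (h - E ^ 2 + 3 * y ^ 2) := by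
  have h1 : 4 * e ^ 2 * (m * y) ≤ m ^ 2 + 4 * e ^ 4 * y ^ 2 := by
    linarith [sq_nonneg (m - 2 * e ^ 2 * y)]
  have he2 : 1 ≤ e ^ 2 := one_le_pow₀ he
  have h2 : e ^ 2 * (4 * (m * y)) ≤ e ^ 2 * (h + 4 * e ^ 2 * y ^ 2) := by linarith
  have h3 := le_of_mul_le_mul_left h2 (by linarith)
  have h4 : e ^ 2 * E ^ 2 = m ^ 2 + 2 * (m * y) + y ^ 2 := by rw [hy]; ring
  have h5 : h ≤ e ^ 2 * (2 * (h - E ^ 2 + 3 * y ^ 2)) := by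
    linarith [mul_nonneg (sub_nonneg.2 he2) (sq_nonneg y)]
  have h6 : 0 ≤ 2 * (h - E ^ 2 + 3 * y ^ 2) := by
    by_contra hneg
    push Not at hneg
    linarith [mul_neg_of_pos_of_neg (by linarith : 0 < e ^ 2) hneg]
  have h7 : e ^ 2 ≤ B ^ 2 := pow_le_pow_left₀ (by linarith) heB 2
  linarith [mul_le_mul_of_nonneg_right h7 h6]

/-- One large eigenvalue `L`; the others are bounded. -/
theorem one_large {B c₁ : ℝ} (hB : 1 ≤ B) (hc : 0 < c₁) : ∃ C > 0, ∃ N > 0,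
    ∀ L e F x E m v d h D : ℝ, N ≤ L → 1 ≤ e → e ≤ B → c₁ ≤ F * L → F * L ≤ B → 0 ≤ h →
      m ^ 2 ≤ (e ^ 2 - 1) * h → d ^ 2 ≤ B * h → E ^ 2 ≤ B * h → |v| ≤ B * h →
      D = F * x + L * (e * E - m) + d →
      21 / 20 * (F * (x + E) ^ 2) ≤ (L + e) * (-2 * x * (e * E - m) - (L + e) * E ^ 2 + 2 * E * m
        + (L + e) * h - 2 * v + C * D ^ 2) := by
  set G := 8 * B / c₁ + 9 * B + 2 * B ^ 2 + 4 * B + 11 * B ^ 2 with hG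
  have hG0 : 0 < G := by positivity
  refine ⟨8 / c₁ + 9, by positivity, 72 * B + 2 * B ^ 2 * G, by positivity, ?_⟩
  intro L e F x E m v d h D hL he heB hFL hFL2 hh hm hd hE hv hD
  have hL1 : 1 ≤ L := by linarith [mul_pos (pow_pos (by linarith : 0 < B) 2) hG0]
  have hL0 : 0 < L := by linarith
  have hF : 0 < F := by
    by_contra hneg
    push Not at hneg
    linarith [mul_nonneg (neg_nonneg.2 hneg) hL0.le]
  have hFB : F ≤ B := by
    linarith [mul_le_mul_of_nonneg_left hL1 hF.le]
  obtain ⟨y, hy⟩ : ∃ y, y = e * E - m := ⟨_, rfl⟩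
  have hLy : L * y = D - F * x - d := by rw [hy, hD]; ring
  obtain ⟨T, hT⟩ : ∃ T, T * L = F * x ^ 2 := ⟨F * x ^ 2 / L, by field_simp⟩
  have hT0 : 0 ≤ T := by
    by_contra hneg
    push Not at hneg
    linarith [mul_nonneg hF.le (sq_nonneg x), mul_neg_of_neg_of_pos hneg hL0]
  -- lower bound for `h - E²`
  have hB2 : h ≤ 2 * B ^ 2 * (h - E ^ 2 + 3 * y ^ 2) := by
    exact h_le_aux he heB hh hm hy
  -- `3 L y²` is small
  have hy2 : 3 * (L * y ^ 2) ≤ 9 * D ^ 2 + T / 8 + 9 * B * h := by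
    have h1 : (L * y) ^ 2 ≤ 3 * (D ^ 2 + (F * x) ^ 2 + d ^ 2) := by
      rw [hLy]; linarith [sq_nonneg (D + F * x), sq_nonneg (D + d), sq_nonneg (F * x - d)]
    have h2 : (F * x) ^ 2 = F * L * T := by
      have : (F * x) ^ 2 = F * (F * x ^ 2) := by ring
      rw [this, ← hT]; ring
    have h3 : F * L * T ≤ B * T := mul_le_mul_of_nonneg_right hFL2 hT0
    have h4 : L * (3 * (L * y ^ 2)) ≤ L * (9 * D ^ 2 + T / 8 + 9 * B * h) := by
      have e1 : L * (3 * (L * y ^ 2)) = 3 * (L * y) ^ 2 := by ring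
      have e2 : 1 * (9 * D ^ 2) ≤ L * (9 * D ^ 2) := by gcongr
      have e3 : 1 * (9 * B * h) ≤ L * (9 * B * h) := by gcongr
      have e4 : 72 * B * T ≤ L * T := by
        apply mul_le_mul_of_nonneg_right _ hT0
        linarith [mul_pos (pow_pos (by linarith : 0 < B) 2) hG0]
      linarith
    exact le_of_mul_le_mul_left h4 hL0
  have cross : ∀ z : ℝ, 2 * (x * z) ≤ L * (T / 8) + L * (8 / c₁ * z ^ 2) := by
    intro z
    have h1 : c₁ * (2 * (x * z)) ≤ c₁ * (L * (T / 8) + L * (8 / c₁ * z ^ 2)) := by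
      have e1 : c₁ * (L * (T / 8) + L * (8 / c₁ * z ^ 2)) = c₁ * (T * L) / 8 + 8 * L * z ^ 2 := by
        field_simp
      rw [e1, hT]
      have h2 : 2 * (c₁ * F) * (x * z) ≤ c₁ * F * (F * x ^ 2) / 8 + 8 * c₁ * z ^ 2 := by
        linarith [mul_nonneg hc.le (sq_nonneg (F * x - 8 * z))]
      have h3 : F * (c₁ * (2 * (x * z))) ≤ F * (c₁ * (F * x ^ 2) / 8 + 8 * L * z ^ 2) := by
        have := mul_le_mul_of_nonneg_right hFL (sq_nonneg z)
        linarith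
      exact le_of_mul_le_mul_left h3 hF
    exact le_of_mul_le_mul_left h1 hc
  have hxy : 7 / 4 * T - 8 / c₁ * D ^ 2 - 8 / c₁ * (B * h) ≤ -2 * x * y := by
    have h1 := cross D
    have h2 := cross (-d)
    have h3 : 8 / c₁ * d ^ 2 ≤ 8 / c₁ * (B * h) := by gcongr
    have h4 : L * (7 / 4 * T - 8 / c₁ * D ^ 2 - 8 / c₁ * (B * h)) ≤ L * (-2 * x * y) := by
      have e1 : L * (-2 * x * y) = 2 * (T * L) - 2 * (x * D) - 2 * (x * -d) := by
        rw [hT]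
        have : L * (-2 * x * y) = -2 * x * (L * y) := by ring
        rw [this, hLy]; ring
      rw [e1]
      linarith [mul_le_mul_of_nonneg_left h3 hL0.le]
    exact le_of_mul_le_mul_left h4 hL0
  have hv' := abs_le.1 hv
  have hlow : 3 / 2 * T + 11 * B ^ 2 * h ≤
      -2 * x * y - (L + e) * E ^ 2 + 2 * E * m + (L + e) * h - 2 * v + (8 / c₁ + 9) * D ^ 2 := by
    have h1 : L * h ≤ L * (2 * B ^ 2 * (h - E ^ 2 + 3 * y ^ 2)) := by gcongr
    have h2 : 2 * B ^ 2 * (G * h) ≤ L * h := by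
      rw [← mul_assoc]
      exact mul_le_mul_of_nonneg_right (by linarith) hh
    have h3 : G * h ≤ L * (h - E ^ 2 + 3 * y ^ 2) := by
      have : 2 * B ^ 2 * (G * h) ≤ 2 * B ^ 2 * (L * (h - E ^ 2 + 3 * y ^ 2)) := by linarith
      exact le_of_mul_le_mul_left this (by positivity)
    have h4 : -(B ^ 2 * h) ≤ e * (h - E ^ 2) := by
      have : e * E ^ 2 ≤ B * (B * h) := mul_le_mul heB hE (sq_nonneg _) (by linarith)
      linarith [mul_nonneg (by linarith : 0 ≤ e) hh]
    have h5 : m ^ 2 ≤ B ^ 2 * h := by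
      have : (e ^ 2 - 1) * h ≤ B ^ 2 * h := by
        apply mul_le_mul_of_nonneg_right _ hh
        linarith [pow_le_pow_left₀ (by linarith) heB 2]
      linarith
    have h6 : -(B * h) - B ^ 2 * h ≤ 2 * E * m := by linarith [sq_nonneg (E + m)]
    have h7 : G * h = 8 / c₁ * (B * h) + 9 * B * h + 2 * (B ^ 2 * h) + 4 * (B * h) +
        11 * B ^ 2 * h := by
      rw [hG]; ring
    have h8 : 0 ≤ B * h := by positivity
    linarith
  rw [← hy]
  have hfin : 21 / 20 * (F * (x + E) ^ 2) ≤ L * (3 / 2 * T + 11 * B ^ 2 * h) := by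
    have h1 : (x + E) ^ 2 ≤ 9 / 8 * x ^ 2 + 9 * E ^ 2 := by linarith [sq_nonneg (x - 8 * E)]
    have h2 : F * (x + E) ^ 2 ≤ F * (9 / 8 * x ^ 2 + 9 * E ^ 2) := by gcongr
    have h3 : F * E ^ 2 ≤ B * (B * h) := by gcongr
    have h4 : 1 * (B ^ 2 * h) ≤ L * (B ^ 2 * h) := by gcongr
    have h5 : 0 ≤ F * x ^ 2 := by positivity
    have h6 : 0 ≤ B ^ 2 * h := by positivity
    have h7 : L * (3 / 2 * T) = 3 / 2 * (F * x ^ 2) := by rw [← hT]; ring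
    linarith
  have hpos : 0 ≤ 3 / 2 * T + 11 * B ^ 2 * h := by positivity
  calc _ ≤ L * (3 / 2 * T + 11 * B ^ 2 * h) := hfin
    _ ≤ (L + e) * (3 / 2 * T + 11 * B ^ 2 * h) := by gcongr; linarith
    _ ≤ _ := by gcongr

/-- Two large eigenvalues `L, l`; the others are bounded. -/
theorem two_large_aux {B L l R x y t₁ t₂ Θ t₃ f N m d h v D : ℝ} (hB : 1 ≤ B) (hR : 1 ≤ R)
    (hL : R ≤ L) (hl : R ≤ l) (hf : f = L * l * t₁ + (L + l) * t₂ + t₃)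
    (ht₂ : t₂ = (t₁ ^ 2 - Θ) / 2) (hfB : |f| ≤ B) (ht₃ : |t₃| ≤ B) (hΘB : Θ ≤ B)
    (ht₁ : |t₁| ≤ B) (ht₂B : |t₂| ≤ B) (hh : 0 ≤ h) (hm : m ^ 2 ≤ (Θ - 1) * h)
    (hN : N ^ 2 ≤ B * h) (hd : d ^ 2 ≤ B * h) (hv : |v| ≤ B * h)
    (hD : D = (l * t₁ + t₂) * (L * x) + (L * t₁ + t₂) * (l * y) + L * l * N
      + (L + l) * (t₁ * N - m) + d) :
    R * |t₁| ≤ 4 * B ∧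
    R * (l * (Θ * x ^ 2 - 2 * x * m + h) + L * (Θ * y ^ 2 - 2 * y * m + h))
      - 500 * B ^ 3 * (l * x ^ 2 + L * y ^ 2 + (L + l) * h) - 20 * R * D ^ 2 ≤
    R * (2 * (f - t₃) * (x ^ 2 + x * y + y ^ 2) - 2 * t₂ * (l * x ^ 2 + L * y ^ 2)
      - 2 * (l * x + L * y) * m + 2 * t₁ * N * (l * x + L * y) - 2 * (x + y) * D
      + 2 * (x + y) * d + (L + l + t₁) * (h - N ^ 2) + 2 * N * m - 2 * v) := by
  obtain ⟨Z, hZ⟩ : ∃ Z, Z = l * x ^ 2 + L * y ^ 2 + (L + l) * h := ⟨_, rfl⟩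
  have hL0 : 0 < L := by linarith
  have hl0 : 0 < l := by linarith
  have hZ0 : 0 ≤ Z := by rw [hZ]; positivity
  have hLl : R * (L + l) ≤ 2 * (L * l) := by
    linarith [mul_le_mul_of_nonneg_right hL hl0.le, mul_le_mul_of_nonneg_left hl hL0.le]
  have hLl0 : 0 < L * l := by positivity
  have hRt : R * |t₁| ≤ 4 * B := by
    have h1 : L * l * t₁ = f - t₃ - (L + l) * t₂ := by rw [hf]; ring
    have h2 : |f - t₃ - (L + l) * t₂| ≤ 2 * B + (L + l) * B := by
      have := abs_sub (f - t₃) ((L + l) * t₂)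
      have h3 := abs_sub f t₃
      have h4 : |(L + l) * t₂| ≤ (L + l) * B := by
        rw [abs_mul, abs_of_pos (by linarith : 0 < L + l)]; gcongr
      linarith
    have h3 : L * l * (R * |t₁|) ≤ L * l * (4 * B) := by
      have e1 : L * l * (R * |t₁|) = R * |L * l * t₁| := by
        rw [abs_mul, abs_of_pos hLl0]; ring
      rw [e1, h1]
      have e2 : R * |f - t₃ - (L + l) * t₂| ≤ R * (2 * B + (L + l) * B) := by gcongr
      have e3 : R * 1 ≤ L * l := mul_le_mul hL (by linarith) (by linarith) (by linarith)
      linarith [mul_le_mul_of_nonneg_right e3 (by linarith : 0 ≤ B),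
        mul_le_mul_of_nonneg_right hLl (by linarith : 0 ≤ B)]
    exact le_of_mul_le_mul_left h3 hLl0
  refine ⟨hRt, ?_⟩
  rw [← hZ]
  have hsm : R * (x ^ 2 + y ^ 2 + h) ≤ Z := by
    rw [hZ]
    have h1 : R * x ^ 2 ≤ l * x ^ 2 := by gcongr
    have h2 : R * y ^ 2 ≤ L * y ^ 2 := by gcongr
    have h3 : R * h ≤ (L + l) * h := by gcongr; linarith
    linarith
  have hxyZ : l * x ^ 2 + L * y ^ 2 ≤ Z := by
    rw [hZ]
    have : 0 ≤ (L + l) * h := by positivity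
    linarith
  have hhZ : (L + l) * h ≤ Z := by
    rw [hZ]
    have : 0 ≤ l * x ^ 2 := by positivity
    have : 0 ≤ L * y ^ 2 := by positivity
    linarith
  have hB2 : B ≤ B ^ 2 := le_self_pow₀ hB (by norm_num)
  have hB3 : B ^ 2 ≤ B ^ 3 := pow_le_pow_right₀ hB (by norm_num)
  -- the terms bounded by a multiple of `x² + y² + h`
  have small : -(2 * D ^ 2) - 14 * B ^ 2 * (x ^ 2 + y ^ 2 + h) ≤
      2 * (f - t₃) * (x ^ 2 + x * y + y ^ 2) - 2 * (x + y) * D + 2 * (x + y) * d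
      + t₁ * (h - N ^ 2) + 2 * N * m - 2 * v := by
    have a1 : -(6 * B * (x ^ 2 + y ^ 2)) ≤ 2 * (f - t₃) * (x ^ 2 + x * y + y ^ 2) := by
      have h1 : |f - t₃| ≤ 2 * B := by have := abs_sub f t₃; linarith
      have h2 := abs_le.1 h1
      have h3 : 0 ≤ x ^ 2 + x * y + y ^ 2 := by
        linarith [sq_nonneg (x + y), sq_nonneg x, sq_nonneg y]
      have h4 : x ^ 2 + x * y + y ^ 2 ≤ 3 / 2 * (x ^ 2 + y ^ 2) := by linarith [sq_nonneg (x - y)]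
      linarith [mul_le_mul_of_nonneg_right h2.1 h3,
        mul_le_mul_of_nonneg_left h4 (by linarith : 0 ≤ B)]
    have a2 : -(x ^ 2 + y ^ 2) - 2 * D ^ 2 ≤ -2 * (x + y) * D := by
      linarith [sq_nonneg (x - D), sq_nonneg (y - D)]
    have a3 : -(x ^ 2 + y ^ 2) - 2 * (B * h) ≤ 2 * (x + y) * d := by
      linarith [sq_nonneg (x + d), sq_nonneg (y + d)]
    have a4 : -(2 * B ^ 2 * h) ≤ t₁ * (h - N ^ 2) := by
      have h2 := abs_le.1 ht₁
      have h3 : |h - N ^ 2| ≤ 2 * (B * h) := by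
        have : 1 * h ≤ B * h := by gcongr
        rw [abs_le]; constructor <;> linarith [sq_nonneg N]
      have h4 : |t₁ * (h - N ^ 2)| ≤ B * (2 * (B * h)) := by
        rw [abs_mul]; gcongr
      have := (abs_le.1 h4).1
      linarith
    have a5 : -(2 * (B * h)) ≤ 2 * N * m := by
      have : (Θ - 1) * h ≤ B * h := by gcongr; linarith
      linarith [sq_nonneg (N + m)]
    have a6 := (abs_le.1 hv).2
    have b1 : B * h ≤ B ^ 2 * h := by gcongr
    have b2 : B * (x ^ 2 + y ^ 2) ≤ B ^ 2 * (x ^ 2 + y ^ 2) := by gcongr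
    have b3 : 1 * (x ^ 2 + y ^ 2) ≤ B * (x ^ 2 + y ^ 2) := by gcongr
    have b4 : 0 ≤ B ^ 2 * h := by positivity
    have b5 : 0 ≤ B ^ 2 * (x ^ 2 + y ^ 2) := by positivity
    linarith
  have e2 : R * (t₁ ^ 2 * (l * x ^ 2 + L * y ^ 2)) ≤ 4 * B ^ 2 * Z := by
    have h1 : R * t₁ ^ 2 ≤ 4 * B * B := by
      rw [← sq_abs]
      calc R * |t₁| ^ 2 = (R * |t₁|) * |t₁| := by ring
        _ ≤ _ := by gcongr
    calc R * (t₁ ^ 2 * (l * x ^ 2 + L * y ^ 2)) = (R * t₁ ^ 2) * (l * x ^ 2 + L * y ^ 2) := by ring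
      _ ≤ (4 * B * B) * Z := by gcongr
      _ = _ := by ring
  have e3 : -(4 * B ^ 2 * Z) ≤ R * (2 * t₁ * N * (l * x + L * y)) := by
    have h1 : |2 * N * (l * x + L * y)| ≤ B * Z := by
      have c1 : B * ((L + l) * h) + (l * x ^ 2 + L * y ^ 2) ≤ B * Z := by
        have : 1 * (l * x ^ 2 + L * y ^ 2) ≤ B * (l * x ^ 2 + L * y ^ 2) := by gcongr
        rw [hZ]; linarith
      have c2 : (L + l) * N ^ 2 ≤ (L + l) * (B * h) := by gcongr
      rw [abs_le]; constructor <;>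
        linarith [mul_nonneg hl0.le (sq_nonneg (N + x)), mul_nonneg hL0.le (sq_nonneg (N + y)),
          mul_nonneg hl0.le (sq_nonneg (N - x)), mul_nonneg hL0.le (sq_nonneg (N - y))]
    have h2 : |R * (2 * t₁ * N * (l * x + L * y))| ≤ 4 * B * (B * Z) := by
      have : R * (2 * t₁ * N * (l * x + L * y)) = (R * t₁) * (2 * N * (l * x + L * y)) := by ring
      rw [this, abs_mul, abs_mul, abs_of_pos (by linarith : 0 < R)]
      gcongr
    have := (abs_le.1 h2).1
    linarith
  have e6 : R * ((L + l) * N ^ 2) ≤ 200 * B ^ 3 * Z + 10 * D ^ 2 := by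
    have p1 : |(l * t₁ + t₂) * L| ≤ 3 * B * l := by
      have : (l * t₁ + t₂) * L = f - t₃ - l * t₂ := by rw [hf]; ring
      rw [this]
      have q1 := abs_sub (f - t₃) (l * t₂)
      have q2 := abs_sub f t₃
      have q3 : |l * t₂| ≤ l * B := by rw [abs_mul, abs_of_pos hl0]; gcongr
      linarith [mul_le_mul_of_nonneg_left (by linarith : 1 ≤ l) (by linarith : 0 ≤ B)]
    have p2 : |(L * t₁ + t₂) * l| ≤ 3 * B * L := by
      have : (L * t₁ + t₂) * l = f - t₃ - L * t₂ := by rw [hf]; ring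
      rw [this]
      have q1 := abs_sub (f - t₃) (L * t₂)
      have q2 := abs_sub f t₃
      have q3 : |L * t₂| ≤ L * B := by rw [abs_mul, abs_of_pos hL0]; gcongr
      linarith [mul_le_mul_of_nonneg_left (by linarith : 1 ≤ L) (by linarith : 0 ≤ B)]
    have p1' : ((l * t₁ + t₂) * (L * x)) ^ 2 ≤ 9 * B ^ 2 * (l ^ 2 * x ^ 2) := by
      have := sq_le_sq' (by linarith [(abs_le.1 p1).1]) (abs_le.1 p1).2
      linarith [mul_le_mul_of_nonneg_right this (sq_nonneg x)]
    have p2' : ((L * t₁ + t₂) * (l * y)) ^ 2 ≤ 9 * B ^ 2 * (L ^ 2 * y ^ 2) := by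
      have := sq_le_sq' (by linarith [(abs_le.1 p2).1]) (abs_le.1 p2).2
      linarith [mul_le_mul_of_nonneg_right this (sq_nonneg y)]
    have p3 : (t₁ * N - m) ^ 2 ≤ 4 * B ^ 3 * h := by
      have q1 : t₁ ^ 2 ≤ B ^ 2 := sq_le_sq' (abs_le.1 ht₁).1 (abs_le.1 ht₁).2
      have q2 : t₁ ^ 2 * N ^ 2 ≤ B ^ 2 * (B * h) := by gcongr
      have q3 : (Θ - 1) * h ≤ B ^ 3 * h := by gcongr; linarith
      linarith [sq_nonneg (t₁ * N + m)]
    have p4 : ((L + l) * (t₁ * N - m)) ^ 2 ≤ 8 * B ^ 3 * (L * l * ((L + l) * h)) := by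
      have q1 : L + l ≤ 2 * (L * l) := by
        linarith [mul_le_mul_of_nonneg_right hR (by linarith : 0 ≤ L + l)]
      calc ((L + l) * (t₁ * N - m)) ^ 2 = (L + l) * ((L + l) * (t₁ * N - m) ^ 2) := by ring
        _ ≤ 2 * (L * l) * ((L + l) * (4 * B ^ 3 * h)) := by gcongr
        _ = _ := by ring
    have five : ∀ a b c d e : ℝ, (a + b + c + d + e) ^ 2 ≤
        5 * (a ^ 2 + b ^ 2 + c ^ 2 + d ^ 2 + e ^ 2) := by
      intro a b c d e
      linarith [sq_nonneg (a - b), sq_nonneg (a - c), sq_nonneg (a - d), sq_nonneg (a - e),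
        sq_nonneg (b - c), sq_nonneg (b - d), sq_nonneg (b - e), sq_nonneg (c - d),
        sq_nonneg (c - e), sq_nonneg (d - e)]
    have h1 : (L * l * N) ^ 2 ≤
        5 * (D ^ 2 + 9 * B ^ 2 * (l ^ 2 * x ^ 2) + 9 * B ^ 2 * (L ^ 2 * y ^ 2)
        + 8 * B ^ 3 * (L * l * ((L + l) * h)) + B * h) := by
      have := five D (-((l * t₁ + t₂) * (L * x))) (-((L * t₁ + t₂) * (l * y)))
        (-((L + l) * (t₁ * N - m))) (-d)
      have h2 : D + -((l * t₁ + t₂) * (L * x)) + -((L * t₁ + t₂) * (l * y))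
        + -((L + l) * (t₁ * N - m)) + -d = L * l * N := by rw [hD]; ring
      rw [h2] at this
      simp only [neg_sq] at this
      linarith
    have hL1 : 1 ≤ L := by linarith
    have hl1 : 1 ≤ l := by linarith
    have hLl1 : 1 ≤ L * l := one_le_mul_of_one_le_of_one_le hL1 hl1
    have h2 : L * l * (L * l * N ^ 2) ≤ L * l * (100 * B ^ 3 * Z + 5 * D ^ 2) := by
      have k1 : 1 * D ^ 2 ≤ L * l * D ^ 2 := by gcongr
      have k2 : 1 * (l * l * x ^ 2) ≤ L * (l * l * x ^ 2) := by gcongr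
      have k3 : 1 * (L * L * y ^ 2) ≤ l * (L * L * y ^ 2) := by gcongr
      have k4 : B ^ 2 * (l ^ 2 * x ^ 2 + L ^ 2 * y ^ 2) ≤
          B ^ 3 * (L * l * (l * x ^ 2 + L * y ^ 2)) := by
        apply mul_le_mul hB3 _ (by positivity) (by positivity)
        linarith
      have k5 : B ^ 3 * (L * l * (l * x ^ 2 + L * y ^ 2)) ≤ B ^ 3 * (L * l * Z) := by gcongr
      have k6 : B ^ 3 * (L * l * ((L + l) * h)) ≤ B ^ 3 * (L * l * Z) := by gcongr
      have k7 : B * h ≤ B ^ 3 * (L * l * Z) := by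
        have : h ≤ Z := by
          have : 1 * h ≤ (L + l) * h := by gcongr; linarith
          linarith
        apply mul_le_mul (by linarith) _ hh (by positivity)
        calc h ≤ 1 * Z := by linarith
          _ ≤ L * l * Z := by gcongr
      have k8 : 0 ≤ B ^ 3 * (L * l * Z) := by positivity
      linarith
    have h3 := le_of_mul_le_mul_left h2 hLl0
    have h4 : R * (L + l) * N ^ 2 ≤ 2 * (L * l) * N ^ 2 := by gcongr
    linarith
  have e0 : R * (14 * B ^ 2 * (x ^ 2 + y ^ 2 + h)) ≤ 14 * B ^ 2 * Z := by
    have : 14 * B ^ 2 * (R * (x ^ 2 + y ^ 2 + h)) ≤ 14 * B ^ 2 * Z := by gcongr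
    linarith
  have es := mul_le_mul_of_nonneg_left small (by linarith : 0 ≤ R)
  have hBZ : B ^ 2 * Z ≤ B ^ 3 * Z := by gcongr
  have hRD : 1 * D ^ 2 ≤ R * D ^ 2 := by gcongr
  have hB3Z : 0 ≤ B ^ 3 * Z := by positivity
  have hRD0 : 0 ≤ R * D ^ 2 := by positivity
  subst ht₂
  linarith

theorem quad_ge_of_sq_le {Θ m h x : ℝ} (hh : 0 ≤ h) (hΘ : 1 ≤ Θ) (hm : m ^ 2 ≤ (Θ - 1) * h) :
    (3 / 5 * Θ + 2 / 5) * x ^ 2 ≤ Θ * x ^ 2 - 2 * x * m + h + 3 / 2 * h := by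
  have h1 : |2 * x * m| ≤ 2 / 5 * (Θ - 1) * x ^ 2 + 5 / 2 * h := by
    have h0 : 0 ≤ 2 / 5 * (Θ - 1) * x ^ 2 + 5 / 2 * h := by
      have : 0 ≤ Θ - 1 := by linarith
      positivity
    apply abs_le_of_sq_le_sq _ h0
    have := mul_le_mul_of_nonneg_left hm (by positivity : 0 ≤ 4 * x ^ 2)
    linarith [sq_nonneg (2 / 5 * (Θ - 1) * x ^ 2 - 5 / 2 * h)]
  have := (abs_le.1 h1).2
  linarith

theorem quad_ge_coercive {Θ m h y B : ℝ} (hB : 1 ≤ B) (hh : 0 ≤ h) (hΘB : Θ ≤ B)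
    (hΘ : 1 ≤ Θ) (hm : m ^ 2 ≤ (Θ - 1) * h) :
    1 / (2 * B) * (y ^ 2 + h) ≤ Θ * y ^ 2 - 2 * y * m + h := by
  obtain ⟨c, hc⟩ : ∃ c, c = 1 / (2 * B) := ⟨_, rfl⟩
  have hcB : c * (2 * B) = 1 := by rw [hc]; field_simp
  have hc0 : 0 < c := by rw [hc]; positivity
  have hc1 : c ≤ 1 / 2 := by linarith [mul_le_mul_of_nonneg_left hB hc0.le]
  have hcΘ : c * (Θ + 1) ≤ 1 := by
    linarith [mul_le_mul_of_nonneg_left (by linarith : Θ + 1 ≤ 2 * B) hc0.le]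
  rw [← hc]
  have h0 : 0 ≤ (Θ - c) * y ^ 2 + (1 - c) * h := by
    have : 0 ≤ Θ - c := by linarith
    have : 0 ≤ 1 - c := by linarith
    positivity
  have h1 : |2 * y * m| ≤ (Θ - c) * y ^ 2 + (1 - c) * h := by
    apply abs_le_of_sq_le_sq _ h0
    have e1 := mul_le_mul_of_nonneg_left hm (by positivity : 0 ≤ 4 * y ^ 2)
    have e2 : 0 ≤ (1 - c * (Θ + 1) + c ^ 2) * (y ^ 2 * h) := by
      apply mul_nonneg _ (by positivity)
      linarith [sq_nonneg c]
    linarith [sq_nonneg ((Θ - c) * y ^ 2 - (1 - c) * h)]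
  have := (abs_le.1 h1).2
  linarith

set_option maxHeartbeats 2000000 in
/-- Two large eigenvalues `L, l`: the inequality in the direction of `L`. -/
theorem two_large {B L l R x y t₁ t₂ Θ t₃ f N m d h v D S q : ℝ} (hB : 1 ≤ B)
    (hR : 1000000 * B ^ 5 ≤ R)
    (hL : R ≤ L) (hl : R ≤ l) (hf : f = L * l * t₁ + (L + l) * t₂ + t₃)
    (ht₂ : t₂ = (t₁ ^ 2 - Θ) / 2) (hfB : |f| ≤ B) (ht₃ : |t₃| ≤ B) (hΘ : 1 ≤ Θ) (hΘB : Θ ≤ B)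
    (ht₁ : |t₁| ≤ B) (ht₂B : |t₂| ≤ B) (hh : 0 ≤ h) (hm : m ^ 2 ≤ (Θ - 1) * h)
    (hN : N ^ 2 ≤ B * h) (hd : d ^ 2 ≤ B * h) (hv : |v| ≤ B * h)
    (hD : D = (l * t₁ + t₂) * (L * x) + (L * t₁ + t₂) * (l * y) + L * l * N
      + (L + l) * (t₁ * N - m) + d)
    (ht₁0 : 0 < t₁) (hF : 0 < l * t₁ + t₂) (hS : (l - B) * h ≤ S)
    (hq : q = 2 * (f - t₃) * (x ^ 2 + x * y + y ^ 2) - 2 * t₂ * (l * x ^ 2 + L * y ^ 2)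
      - 2 * (l * x + L * y) * m + 2 * t₁ * N * (l * x + L * y) - 2 * (x + y) * D
      + 2 * (x + y) * d + (L + l + t₁) * (h - N ^ 2) + 2 * N * m - 2 * v) :
    0 ≤ q + 20 * D ^ 2 ∧
    21 / 20 * ((l * t₁ + t₂) * (L * x + l * y + N) ^ 2) ≤
      (L + l + t₁) * (q + 20 * D ^ 2 + 2 * (t₁ * (l * y) ^ 2) + 2 * S) := by
  have hB2 : B ≤ B ^ 2 := le_self_pow₀ hB (by norm_num)
  have hB23 : B ^ 2 ≤ B ^ 3 := pow_le_pow_right₀ hB (by norm_num)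
  have hB34 : B ^ 3 ≤ B ^ 4 := pow_le_pow_right₀ hB (by norm_num)
  have hB5 : B ^ 4 ≤ B ^ 5 := pow_le_pow_right₀ hB (by norm_num)
  have hR1 : 1 ≤ R := by linarith
  have hR0 : 0 < R := by linarith
  have hL0 : 0 < L := by linarith
  have hl0 : 0 < l := by linarith
  obtain ⟨hRt, haux⟩ := two_large_aux hB hR1 hL hl hf ht₂ hfB ht₃ hΘB ht₁ ht₂B hh hm hN hd hv hD
  rw [← hq] at haux
  obtain ⟨Z, hZ⟩ : ∃ Z, Z = l * x ^ 2 + L * y ^ 2 + (L + l) * h := ⟨_, rfl⟩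
  have hZ0 : 0 ≤ Z := by rw [hZ]; positivity
  obtain ⟨c, hc⟩ : ∃ c, c = 1 / (2 * B) := ⟨_, rfl⟩
  have hcB : c * (2 * B) = 1 := by rw [hc]; field_simp
  have hc0 : 0 < c := by rw [hc]; positivity
  have hc1 : c ≤ 1 / 2 := by linarith [mul_le_mul_of_nonneg_left hB hc0.le]
  have hlow : l * (Θ * x ^ 2 - 2 * x * m + h) + L * (Θ * y ^ 2 - 2 * y * m + h) - c / 100 * Z
      - 20 * D ^ 2 ≤ q := by
    have h1 : 500 * B ^ 3 * Z ≤ R * (c / 100 * Z) := by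
      have : 500 * B ^ 3 ≤ R * (c / 100) := by
        have e1 : 1000000 * B ^ 5 * (c / 100) ≤ R * (c / 100) := by gcongr
        have e2 : 1000000 * B ^ 5 * (c / 100) = 5000 * B ^ 4 * (c * (2 * B)) := by ring
        rw [e2, hcB] at e1
        linarith
      calc _ ≤ R * (c / 100) * Z := by gcongr
        _ = _ := by ring
    rw [← hZ] at haux
    have h2 : R * (l * (Θ * x ^ 2 - 2 * x * m + h) + L * (Θ * y ^ 2 - 2 * y * m + h) - c / 100 * Z
      - 20 * D ^ 2) ≤ R * q := by linarith
    exact le_of_mul_le_mul_left h2 hR0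
  have gx := quad_ge_of_sq_le (x := x) hh hΘ hm
  have gx' := quad_ge_coercive (y := x) hB hh hΘB hΘ hm
  have gy := quad_ge_coercive (y := y) hB hh hΘB hΘ hm
  rw [← hc] at gx' gy
  have gyL := mul_le_mul_of_nonneg_left gy hL0.le
  have gxl' := mul_le_mul_of_nonneg_left gx' hl0.le
  have gxl := mul_le_mul_of_nonneg_left gx hl0.le
  have hq0 : 0 ≤ q + 20 * D ^ 2 := by
    have h1 : 0 ≤ c * Z := by positivity
    rw [hZ] at h1 hlow
    linarith
  refine ⟨hq0, ?_⟩
  obtain ⟨Y, hY⟩ : ∃ Y, Y = l ^ 2 * y ^ 2 / L := ⟨_, rfl⟩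
  have hYL : L * Y = l ^ 2 * y ^ 2 := by rw [hY]; field_simp
  have hY0 : 0 ≤ Y := by rw [hY]; positivity
  obtain ⟨p, hp⟩ : ∃ p, p = Θ - t₁ ^ 2 := ⟨_, rfl⟩
  have hp9 : 9 / 10 ≤ p := by
    have : t₁ ≤ 1 / 10 := by
      rw [abs_of_pos ht₁0] at hRt
      have : 40 * B * t₁ ≤ 40 * B * (1 / 10) := by
        have : 40 * B * t₁ ≤ R * t₁ := by gcongr; linarith
        linarith
      exact le_of_mul_le_mul_left this (by linarith)
    have : t₁ ^ 2 ≤ (1 / 10) ^ 2 := by gcongr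
    linarith
  have ht₂p : t₂ = -p / 2 := by rw [ht₂, hp]; ring
  have hft : |f - t₃| ≤ 2 * B := by have := abs_sub f t₃; linarith
  obtain ⟨hft1, hft2⟩ := abs_le.1 hft
  have hFL : (l * t₁ + t₂) * L = f - t₃ + l * (p / 2) := by rw [hf, ht₂p]; ring
  have hFLle : (l * t₁ + t₂) * L ≤ 2 * B + l * (Θ / 2) := by
    rw [hFL, hp]
    linarith [mul_nonneg hl0.le (sq_nonneg t₁)]
  have hFx : (l * t₁ + t₂) * (L * x ^ 2) ≤ (2 * B + l * (Θ / 2)) * x ^ 2 := by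
    rw [← mul_assoc]; gcongr
  have hBl : 2 * B ≤ l * (1 / 50) := by linarith
  have hFy : (l * t₁ + t₂) * (l * y ^ 2) ≤ (1 / 50 + p / 2) * Y := by
    have h1 : l * ((l * t₁ + t₂) * (l * y ^ 2)) = ((l * t₁ + t₂) * L) * Y := by
      have : l * ((l * t₁ + t₂) * (l * y ^ 2)) = (l * t₁ + t₂) * (l ^ 2 * y ^ 2) := by ring
      rw [this, ← hYL]; ring
    have h2 : l * ((l * t₁ + t₂) * (l * y ^ 2)) ≤ l * ((1 / 50 + p / 2) * Y) := by
      rw [h1, hFL, ← mul_assoc l]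
      apply mul_le_mul_of_nonneg_right _ hY0
      linarith
    exact le_of_mul_le_mul_left h2 hl0
  have hty : (p - 1 / 25) * Y ≤ 2 * (t₁ * (l * y) ^ 2) := by
    have h1 : l * (2 * (t₁ * (l * y) ^ 2)) = (2 * (f - t₃) + (L + l) * p) * Y := by
      have e1 : l * (2 * (t₁ * (l * y) ^ 2)) = 2 * l * t₁ * (l ^ 2 * y ^ 2) := by ring
      rw [e1, ← hYL, hf, ht₂p]; ring
    have h2 : l * ((p - 1 / 25) * Y) ≤ l * (2 * (t₁ * (l * y) ^ 2)) := by
      rw [h1, ← mul_assoc]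
      apply mul_le_mul_of_nonneg_right _ hY0
      have : 0 ≤ L * p := mul_nonneg hL0.le (by linarith)
      linarith
    exact le_of_mul_le_mul_left h2 hl0
  have hFh : 44 * B * (l * t₁ + t₂) ≤ L + l := by
    have h0 : l * (Θ / 2) ≤ l * (B / 2) := by gcongr
    have h2 : B * (44 * B * (l * t₁ + t₂)) ≤ B * l := by
      have h3 : (44 * B ^ 2) * (l * t₁ + t₂) ≤ L * (l * t₁ + t₂) := by gcongr; linarith
      have h4 : B * 4 ≤ B * l := by gcongr; linarith
      linarith
    linarith [le_of_mul_le_mul_left h2 (by linarith)]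
  have hX : 21 / 20 * ((l * t₁ + t₂) * (L * x + l * y + N) ^ 2) ≤
      (L + l) * (861 / 800 * ((2 * B + l * (Θ / 2)) * x ^ 2 + (1 / 50 + p / 2) * Y) + h) := by
    have h1 : (L * x + l * y + N) ^ 2 ≤
        41 / 40 * ((L + l) * (L * x ^ 2 + l * y ^ 2)) + 41 * (B * h) := by
      have e1 : (L * x + l * y) ^ 2 ≤ (L + l) * (L * x ^ 2 + l * y ^ 2) := by
        have : 0 ≤ L * l * (x - y) ^ 2 := by positivity
        linarith
      linarith [sq_nonneg ((L * x + l * y) - 40 * N)]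
    have h2 := mul_le_mul_of_nonneg_left h1 hF.le
    have h3 := mul_le_mul_of_nonneg_left (add_le_add hFx hFy) (by linarith : 0 ≤ L + l)
    have h4 := mul_le_mul_of_nonneg_right hFh hh
    have h5 : 0 ≤ B * (l * t₁ + t₂) * h := by positivity
    linarith
  have hmain : 861 / 800 * ((2 * B + l * (Θ / 2)) * x ^ 2 + (1 / 50 + p / 2) * Y) + h ≤
      q + 20 * D ^ 2 + 2 * (t₁ * (l * y) ^ 2) + 2 * S := by
    have e1 : 861 / 800 * ((1 / 50 + p / 2) * Y) ≤ (p - 1 / 25) * Y := by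
      rw [← mul_assoc]
      apply mul_le_mul_of_nonneg_right _ hY0
      linarith
    have e2 : c / 100 * Z ≤ 1 / 200 * (l * x ^ 2) + c * (L * y ^ 2) + c / 2 * (L * h)
        + 1 / 200 * (l * h) := by
      have : 0 ≤ (1 / 2 - c) * (l * x ^ 2) := mul_nonneg (by linarith) (by positivity)
      have : 0 ≤ (1 / 2 - c) * (l * h) := mul_nonneg (by linarith) (by positivity)
      have : 0 ≤ c * (L * y ^ 2) := by positivity
      have : 0 ≤ c * (L * h) := by positivity
      rw [hZ]
      linarith
    have e3 : 3 * B * h ≤ c / 2 * (L * h) := by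
      have : 3 * B ≤ c / 2 * L := by
        have k1 : c / 2 * (1000000 * B ^ 5) ≤ c / 2 * L := by gcongr; linarith
        have k2 : c / 2 * (1000000 * B ^ 5) = 250000 * B ^ 4 * (c * (2 * B)) := by ring
        rw [k2, hcB] at k1
        linarith
      calc 3 * B * h ≤ (c / 2 * L) * h := by gcongr
        _ = _ := by ring
    have e4 : 2 * B * x ^ 2 ≤ 1 / 50 * (l * x ^ 2) := by
      have : 2 * B * x ^ 2 ≤ (l * (1 / 50)) * x ^ 2 := by gcongr
      linarith
    have e5 : 0 ≤ l * x ^ 2 := by positivity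
    have e6 : 0 ≤ l * h := by positivity
    have e7 : l * x ^ 2 ≤ l * x ^ 2 * Θ := le_mul_of_one_le_right e5 hΘ
    have e8 : 1 * h ≤ B * h := by gcongr
    linarith
  have hmain0 : 0 ≤ 861 / 800 * ((2 * B + l * (Θ / 2)) * x ^ 2 + (1 / 50 + p / 2) * Y) + h := by
    have : 0 ≤ Θ := by linarith
    have : 0 ≤ p := by linarith
    positivity
  calc _ ≤ (L + l) * (861 / 800 * ((2 * B + l * (Θ / 2)) * x ^ 2 + (1 / 50 + p / 2) * Y) + h) := hX
    _ ≤ (L + l + t₁) *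
        (861 / 800 * ((2 * B + l * (Θ / 2)) * x ^ 2 + (1 / 50 + p / 2) * Y) + h) := by
      exact mul_le_mul_of_nonneg_right (by linarith) hmain0
    _ ≤ _ := mul_le_mul_of_nonneg_left hmain (by linarith)

section Jacobi

open Finset

variable {n : ℕ}

/-- Minus the second derivative of `σ₃ + σ₂` on the diagonal directions. -/
def negQ (lam ξ : Fin n → ℝ) : ℝ :=
  -(es lam * ((∑ p, ξ p) ^ 2 - ∑ p, ξ p ^ 2) - 2 * (∑ p, ξ p) * (∑ p, lam p * ξ p)
    + 2 * ∑ p, lam p * ξ p ^ 2)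

theorem sum_mul_sq_le_card {ι : Type*} (S : Finset ι) (a z : ι → ℝ) {A : ℝ}
    (h : ∀ p ∈ S, |a p| ≤ A) :
    (∑ p ∈ S, a p * z p) ^ 2 ≤ S.card * A ^ 2 * ∑ p ∈ S, z p ^ 2 := by
  refine (sum_mul_sq_le_sq_mul_sq S a z).trans ?_
  refine mul_le_mul_of_nonneg_right ?_ (sum_nonneg fun p _ => sq_nonneg _)
  calc ∑ p ∈ S, a p ^ 2 ≤ ∑ p ∈ S, A ^ 2 :=
        sum_le_sum fun p hp => sq_le_sq' (abs_le.1 (h p hp)).1 (abs_le.1 (h p hp)).2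
    _ = _ := by simp

theorem abs_sum_mul_sq_le {ι : Type*} (S : Finset ι) (a z : ι → ℝ) {A : ℝ}
    (h : ∀ p ∈ S, |a p| ≤ A) : |∑ p ∈ S, a p * z p ^ 2| ≤ A * ∑ p ∈ S, z p ^ 2 := by
  refine (abs_sum_le_sum_abs _ _).trans ?_
  rw [mul_sum]
  refine sum_le_sum fun p hp => ?_
  rw [abs_mul, abs_of_nonneg (sq_nonneg (z p))]
  exact mul_le_mul_of_nonneg_right (h p hp) (sq_nonneg _)

namespace Adm

variable {K m₀ Λ : ℝ} {lam : Fin n → ℝ}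

theorem bounded_direction_num {F X D P R s A a N e : ℝ} (hF : 0 < F) (hP : 0 ≤ P)
    (haA : |a| ≤ A) (hs : 27 * A ≤ s) (hFs : 1 ≤ F * s) (hs0 : 0 < s)
    (hFA : 4 * N * A ^ 2 ≤ F) (he : e = s - a) (he0 : 0 < e) (hN : 0 ≤ N)
    (hR : R ≤ (e - a) * F + N * (a ^ 2 * e)) (hc : (F * X - D) ^ 2 ≤ R * P) :
    21 / 20 * (F * X ^ 2) ≤ s * (2 * P + 23 * D ^ 2) := by
  obtain ⟨ha1, ha2⟩ := abs_le.1 haA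
  have h1 : R ≤ 4 / 3 * (F * s) := by
    have e1 : N * (a ^ 2 * e) ≤ F / 4 * e := by
      have : a ^ 2 ≤ A ^ 2 := sq_le_sq' ha1 ha2
      have : N * a ^ 2 ≤ N * A ^ 2 := by gcongr
      calc N * (a ^ 2 * e) = N * a ^ 2 * e := by ring
        _ ≤ F / 4 * e := by gcongr; linarith
    have e2 := mul_le_mul_of_nonneg_left hs hF.le
    have e3 := mul_le_mul_of_nonneg_left ha1 hF.le
    rw [he] at e1 hR
    linarith
  have h2 : R * P ≤ 4 / 3 * (F * s) * P := by gcongr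
  have h3 : (F * X) ^ 2 ≤ 21 / 20 * (F * X - D) ^ 2 + 21 * D ^ 2 := by
    linarith [sq_nonneg ((F * X - D) - 20 * D)]
  have h4 : 1 * D ^ 2 ≤ F * s * D ^ 2 := by gcongr
  have h5 : F * (21 / 20 * (F * X ^ 2)) ≤ F * (s * (2 * P + 23 * D ^ 2)) := by
    have : 0 ≤ F * s * P := by positivity
    linarith [sq_nonneg D]
  exact le_of_mul_le_mul_left h5 hF

theorem bounded_direction (n : ℕ) {m₀ : ℝ} (hm : 0 < m₀) {A : ℝ} (hA : 0 ≤ A) : ∃ N > 0,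
    ∀ (K Λ : ℝ) (lam : Fin n → ℝ), Adm K m₀ Λ lam → N ≤ es lam → ∀ (k : Fin n) (ξ : Fin n → ℝ),
    |lam k| ≤ A →
    21 / 20 * (eF lam k * (∑ p, ξ p) ^ 2) ≤ es lam *
      (2 * ∑ p ∈ univ.erase k, (es lam - lam k - lam p) * ξ p ^ 2
        + 23 * (∑ p, eF lam p * ξ p) ^ 2) := by
  obtain ⟨C, hC, H⟩ := sig_le_F_mul n hm
  refine ⟨2 + 27 * A + C * ((1 + A ^ 2) * (4 * n * A ^ 2 + 1)), by positivity,
    fun K Λ lam h hs k ξ hk => ?_⟩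
  have hp1 : 0 ≤ C * ((1 + A ^ 2) * (4 * n * A ^ 2 + 1)) := by positivity
  have hF := h.F_pos k
  have he := h.one_lt_e k
  have hFlow : 4 * n * A ^ 2 + 1 ≤ eF lam k := by
    have h1 := H K Λ lam h k
    have h2 := h.sig_gt
    have h3 : lam k ^ 2 ≤ A ^ 2 := sq_le_sq' (abs_le.1 hk).1 (abs_le.1 hk).2
    have h4 : eF lam k * (1 + lam k ^ 2) ≤ eF lam k * (1 + A ^ 2) := by gcongr
    have h5 : C * (1 + A ^ 2) * (4 * n * A ^ 2 + 1) ≤ C * (1 + A ^ 2) * eF lam k := by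
      have := mul_le_mul_of_nonneg_left h4 hC.le
      linarith
    exact le_of_mul_le_mul_left h5 (by positivity)
  have hnA : (0 : ℝ) ≤ 4 * n * A ^ 2 := by positivity
  have hb : ∀ p ∈ univ.erase k, 0 < es lam - lam k - lam p := fun p hp =>
    h.Fij_pos (ne_of_mem_erase hp)
  have hcard : ((univ.erase k).card : ℝ) = n - 1 := by
    rw [card_erase_of_mem (mem_univ _), card_univ, Fintype.card_fin,
      Nat.cast_sub (by have := k.pos; omega)]
    simp
  have h1 := es_sub lam k
  have h2 := eq2_sub lam k
  have h3 := ec_sub lam k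
  have hR : ∑ p ∈ univ.erase k, (lam p - lam k) ^ 2 * (es lam - lam k - lam p) =
      (es lam - lam k - lam k) * eF lam k - 3 * ef lam + (n - 1) * (lam k ^ 2 * (es lam - lam k))
        - (1 - lam k) ^ 2 * (es lam - lam k - 1) := by
    have : ∀ p, (lam p - lam k) ^ 2 * (es lam - lam k - lam p) =
        lam k ^ 2 * (es lam - lam k) - (2 * lam k * (es lam - lam k) + lam k ^ 2) * lam p
        + (es lam - lam k + 2 * lam k) * lam p ^ 2 - lam p ^ 3 := fun p => by ring
    simp only [this, sum_sub_distrib, sum_add_distrib, ← mul_sum, sum_const, nsmul_eq_mul, hcard]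
    rw [eF_eq, ef_eq lam k, eF_eq]
    unfold erest
    rw [show ∑ p ∈ univ.erase k, lam p = es lam - lam k - 1 by linarith,
      show ∑ p ∈ univ.erase k, lam p ^ 2 = eq2 lam - lam k ^ 2 - 1 by linarith,
      show ∑ p ∈ univ.erase k, lam p ^ 3 = ec lam - lam k ^ 3 - 1 by linarith]
    ring
  have hFX : eF lam k * (∑ p, ξ p) - ∑ p, eF lam p * ξ p =
      ∑ p ∈ univ.erase k, (lam p - lam k) * (es lam - lam k - lam p) * ξ p := by
    rw [mul_sum, ← sum_sub_distrib, ← add_sum_erase _ _ (mem_univ k)]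
    rw [sub_self, zero_add]
    refine sum_congr rfl fun p _ => ?_
    unfold eF; ring
  have hc : (eF lam k * (∑ p, ξ p) - ∑ p, eF lam p * ξ p) ^ 2 ≤
      (∑ p ∈ univ.erase k, (lam p - lam k) ^ 2 * (es lam - lam k - lam p)) *
      ∑ p ∈ univ.erase k, (es lam - lam k - lam p) * ξ p ^ 2 := by
    rw [hFX]
    refine sum_sq_le_sum_mul_sum_of_sq_le_mul _ (fun p hp => ?_) (fun p hp => ?_) (fun p hp => ?_)
    · exact mul_nonneg (sq_nonneg _) (hb p hp).le
    · exact mul_nonneg (hb p hp).le (sq_nonneg _)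
    · exact le_of_eq (by ring)
  refine bounded_direction_num (N := n) (a := lam k) (A := A) (e := es lam - lam k) hF
    (sum_nonneg fun p hp => mul_nonneg (hb p hp).le (sq_nonneg _)) hk (by linarith) ?_
    (by linarith) (by linarith) rfl (by linarith) (Nat.cast_nonneg n) ?_ hc
  · have : 1 * 1 ≤ eF lam k * es lam := mul_le_mul (by linarith) (by linarith) (by norm_num) hF.le
    linarith
  · rw [hR]
    have : 0 ≤ (1 - lam k) ^ 2 * (es lam - lam k - 1) := mul_nonneg (sq_nonneg _) (by linarith)
    have : 0 ≤ lam k ^ 2 * (es lam - lam k) := mul_nonneg (sq_nonneg _) (by linarith)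
    linarith [h.f_ge, h.m_pos]

end Adm
end Jacobi

section Jacobi

open Finset

variable {n : ℕ}

theorem sum_bound_le {ι : Type*} (S : Finset ι) (a : ι → ℝ) {A N : ℝ} (hA : 0 ≤ A)
    (hS : (S.card : ℝ) ≤ N) (h : ∀ p ∈ S, |a p| ≤ A) : |∑ p ∈ S, a p| ≤ N * A := by
  calc |∑ p ∈ S, a p| ≤ ∑ p ∈ S, |a p| := abs_sum_le_sum_abs _ _
    _ ≤ ∑ p ∈ S, A := sum_le_sum h
    _ = S.card * A := by simp
    _ ≤ _ := by gcongr

theorem abs_third_le {G t Θ κ : ℝ} (hG : 0 ≤ G) (ht : |t| ≤ G) (hΘ : |Θ| ≤ G ^ 2)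
    (hκ : |κ| ≤ G ^ 3) :
    |(t ^ 3 - 3 * t * Θ + 2 * κ) / 6| ≤ G ^ 3 := by
  have h1 : |t ^ 3| ≤ G ^ 3 := by rw [abs_pow]; gcongr
  have h2 : |t * Θ| ≤ G * G ^ 2 := by rw [abs_mul]; gcongr
  obtain ⟨a1, a2⟩ := abs_le.1 h1
  obtain ⟨b1, b2⟩ := abs_le.1 h2
  obtain ⟨c1, c2⟩ := abs_le.1 hκ
  rw [abs_le]; constructor <;> linarith

theorem growth_bounds {N A : ℝ} (hN : 1 ≤ N) (hA : 1 ≤ A) :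
    1 ≤ N * A + 1 ∧ A ≤ N * A + 1 ∧ 1 + N * A ^ 2 ≤ (N * A + 1) ^ 2 ∧
      1 + N * A ^ 3 ≤ (N * A + 1) ^ 3 := by
  have h0 : 1 * A ≤ N * A := by gcongr
  have h1 : N ≤ N ^ 2 := le_self_pow₀ hN (by norm_num)
  have h2 : N ≤ N ^ 3 := le_self_pow₀ hN (by norm_num)
  have h3 : N * A ^ 2 ≤ N ^ 2 * A ^ 2 := by gcongr
  have h4 : N * A ^ 3 ≤ N ^ 3 * A ^ 3 := by gcongr
  have h5 : 0 ≤ N * A := by positivity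
  have h6 : 0 ≤ N ^ 2 * A ^ 2 := by positivity
  refine ⟨by linarith, by linarith, by linarith, by linarith⟩

theorem large_const_bounds {N G Λ : ℝ} (hN : 1 ≤ N) (hG : 1 ≤ G) (hΛ : 0 ≤ Λ) :
    G ≤ N * (Λ + 5 * G ^ 3 + 1) ^ 2 ∧ G ^ 2 ≤ N * (Λ + 5 * G ^ 3 + 1) ^ 2 ∧
    N ≤ N * (Λ + 5 * G ^ 3 + 1) ^ 2 ∧
    Λ + 5 * G ^ 3 + 1 ≤ N * (Λ + 5 * G ^ 3 + 1) ^ 2 := by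
  have h1 : G ≤ G ^ 3 := le_self_pow₀ hG (by norm_num)
  have h2 : G ^ 2 ≤ G ^ 3 := pow_le_pow_right₀ hG (by norm_num)
  have h3 : 1 ≤ Λ + 5 * G ^ 3 + 1 := by linarith
  have h4 : Λ + 5 * G ^ 3 + 1 ≤ (Λ + 5 * G ^ 3 + 1) ^ 2 := le_self_pow₀ h3 (by norm_num)
  have h5 : 1 * (Λ + 5 * G ^ 3 + 1) ^ 2 ≤ N * (Λ + 5 * G ^ 3 + 1) ^ 2 := by gcongr
  refine ⟨by linarith, by linarith, ?_, by linarith⟩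
  exact le_mul_of_one_le_right (by linarith) (by linarith)

namespace Adm

variable {K m₀ Λ : ℝ} {lam : Fin n → ℝ}

theorem jacobi_one_large (n : ℕ) {m₀ Λ A : ℝ} (hm : 0 < m₀) (hΛ : 0 ≤ Λ) (hA : 1 ≤ A) :
    ∃ C > 0, ∃ N > 0, ∀ (K : ℝ) (lam : Fin n → ℝ), Adm K m₀ Λ lam → ∀ i, N ≤ es lam →
      (∀ p, p ≠ i → |lam p| ≤ A) → ∀ ξ : Fin n → ℝ,
      21 / 20 * (eF lam i * (∑ p, ξ p) ^ 2) ≤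
        es lam * (negQ lam ξ + C * (∑ p, eF lam p * ξ p) ^ 2) := by
  obtain ⟨c, hc, hF1⟩ := F_ge_inv n hm
  obtain ⟨G, hG⟩ : ∃ G : ℝ, G = n * A + 1 := ⟨_, rfl⟩
  obtain ⟨B, hB⟩ : ∃ B : ℝ, B = (n + 1) * (Λ + 5 * G ^ 3 + 1) ^ 2 := ⟨_, rfl⟩
  have hn0 : (0 : ℝ) ≤ n := Nat.cast_nonneg n
  have hG1 : 1 ≤ G := by
    have : 0 ≤ (n : ℝ) * A := by positivity
    linarith
  obtain ⟨b1, b2, b3, b4⟩ := large_const_bounds (N := n + 1) (by linarith) hG1 hΛ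
  rw [← hB] at b1 b2 b3 b4
  have hB1 : 1 ≤ B := by linarith
  obtain ⟨C, hC, N, hN, H⟩ := one_large hB1 (half_pos hc)
  refine ⟨C, hC, N + 2 * G + 2, by positivity, fun K lam h i hs hA' ξ => ?_⟩
  have hn : (1 : ℝ) ≤ n := by exact_mod_cast i.pos
  obtain ⟨g1, g2, g3, g4⟩ := growth_bounds hn hA
  rw [← hG] at g1 g2 g3 g4
  have hA0 : 0 ≤ A := by linarith
  set S : Finset (Fin n) := univ.erase i with hS
  have hcard : (S.card : ℝ) ≤ n := by
    have := card_le_univ S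
    rw [Fintype.card_fin] at this
    exact_mod_cast this
  have hAS : ∀ p ∈ S, |lam p| ≤ A := fun p hp => hA' p (ne_of_mem_erase hp)
  have e1 := es_sub lam i
  have e2 := eq2_sub lam i
  have e3 := ec_sub lam i
  rw [← hS] at e1 e2 e3
  obtain ⟨e, he⟩ : ∃ e, e = es lam - lam i := ⟨_, rfl⟩
  obtain ⟨r, hr⟩ : ∃ r, r = eq2 lam - lam i ^ 2 := ⟨_, rfl⟩
  obtain ⟨κ, hκ⟩ : ∃ κ, κ = ec lam - lam i ^ 3 := ⟨_, rfl⟩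
  have s1 := abs_le.1 (sum_bound_le S lam hA0 hcard hAS)
  have s2 := abs_le.1 (sum_bound_le S (fun p => lam p ^ 2) (by positivity) hcard
    (A := A ^ 2) fun p hp => by rw [abs_pow]; gcongr; exact hAS p hp)
  have s3 := abs_le.1 (sum_bound_le S (fun p => lam p ^ 3) (by positivity) hcard
    (A := A ^ 3) fun p hp => by rw [abs_pow]; gcongr; exact hAS p hp)
  have he1 : 1 < e := he ▸ h.one_lt_e i
  have heG : e ≤ G := by linarith
  have hrest : |erest lam i| ≤ G ^ 3 := by
    apply abs_third_le (by linarith)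
    · rw [← he, abs_of_pos (by linarith)]; exact heG
    · rw [abs_le]; constructor <;> linarith [sq_nonneg G]
    · rw [abs_le]; constructor <;> linarith [pow_nonneg (by linarith : 0 ≤ G) 3]
  have hrest' := abs_le.1 hrest
  have hf := ef_eq lam i
  have hF := h.F_pos i
  have hL : N + G + 2 ≤ lam i := by linarith
  have hG3 : 0 ≤ G ^ 3 := by positivity
  have hFL2 : eF lam i * lam i ≤ Λ + G ^ 3 := by linarith [h.f_le]
  have hFle : eF lam i ≤ Λ + G ^ 3 := by
    linarith [mul_le_mul_of_nonneg_left (by linarith : 1 ≤ lam i) hF.le]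
  have hFL1 : c / 2 ≤ eF lam i * lam i := by
    have := hF1 K Λ lam h (by linarith) i
    linarith [mul_le_mul_of_nonneg_left (by linarith : es lam ≤ 2 * lam i) hF.le]
  obtain ⟨E, hE⟩ : ∃ E, E = ∑ p ∈ S, ξ p := ⟨_, rfl⟩
  obtain ⟨m, hm'⟩ : ∃ m, m = ∑ p ∈ S, lam p * ξ p := ⟨_, rfl⟩
  obtain ⟨v, hv⟩ : ∃ v, v = ∑ p ∈ S, lam p * ξ p ^ 2 := ⟨_, rfl⟩
  obtain ⟨hh, hh'⟩ : ∃ hh, hh = ∑ p ∈ S, ξ p ^ 2 := ⟨_, rfl⟩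
  obtain ⟨d, hd⟩ : ∃ d, d = ∑ p ∈ S, (eF lam i - e * lam p + lam p ^ 2) * ξ p := ⟨_, rfl⟩
  have hh0 : 0 ≤ hh := hh' ▸ sum_nonneg fun p _ => sq_nonneg _
  have key := H (lam i) e (eF lam i) (ξ i) E m v d hh (∑ p, eF lam p * ξ p) (by linarith) he1.le
    (by linarith) hFL1 (by linarith) hh0 ?_ ?_ ?_ ?_ ?_
  · have t1 : ∑ p, ξ p = ξ i + E := by rw [hE, hS, add_sum_erase _ _ (mem_univ i)]
    have t2 : ∑ p, lam p * ξ p = lam i * ξ i + m := by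
      rw [hm', hS, add_sum_erase _ (fun p => lam p * ξ p) (mem_univ i)]
    have t3 : ∑ p, lam p * ξ p ^ 2 = lam i * ξ i ^ 2 + v := by
      rw [hv, hS, add_sum_erase _ (fun p => lam p * ξ p ^ 2) (mem_univ i)]
    have t4 : ∑ p, ξ p ^ 2 = ξ i ^ 2 + hh := by
      rw [hh', hS, add_sum_erase _ (fun p => ξ p ^ 2) (mem_univ i)]
    have t5 : es lam = lam i + e := by rw [he]; ring
    unfold negQ
    rw [t1, t2, t3, t4, t5]
    linarith
  · rw [hm', hh']
    refine (sum_mul_sq_le_sq_mul_sq S lam ξ).trans ?_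
    refine mul_le_mul_of_nonneg_right ?_ (sum_nonneg fun p _ => sq_nonneg _)
    have := h.sq_rest_lt i
    rw [← he] at this
    linarith
  · have hco : ∀ p ∈ S, |eF lam i - e * lam p + lam p ^ 2| ≤ Λ + 5 * G ^ 3 + 1 := by
      intro p hp
      have k1 := abs_le.1 (hAS p hp)
      have k2 : |e * lam p| ≤ G * G := by
        rw [abs_mul, abs_of_pos (by linarith : 0 < e)]
        exact mul_le_mul heG ((hAS p hp).trans g2) (abs_nonneg _) (by linarith)
      have k3 : lam p ^ 2 ≤ G ^ 2 := sq_le_sq' (by linarith) (by linarith)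
      have k4 : G ^ 2 ≤ G ^ 3 := pow_le_pow_right₀ hG1 (by norm_num)
      have k5 := abs_le.1 k2
      rw [abs_le]; constructor <;> linarith [sq_nonneg (lam p)]
    have := sum_mul_sq_le_card S _ ξ hco
    rw [← hd, ← hh'] at this
    refine this.trans ?_
    gcongr
    rw [hB]
    gcongr
    linarith
  · have := sum_mul_sq_le_card S (fun _ => 1) ξ (A := 1) (by simp)
    simp only [one_mul, one_pow, mul_one] at this
    rw [← hE, ← hh'] at this
    refine this.trans ?_
    gcongr
    linarith
  · have := abs_sum_mul_sq_le S lam ξ hAS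
    rw [← hv, ← hh'] at this
    refine this.trans ?_
    gcongr
    linarith
  · rw [← add_sum_erase _ _ (mem_univ i), hE, hm', hd, mul_sum, ← hS, ← sum_sub_distrib, mul_sum,
      add_assoc, ← sum_add_distrib]
    congr 1
    refine sum_congr rfl fun p _ => ?_
    rw [he]
    unfold eF
    ring

end Adm
end Jacobi

section Jacobi

open Finset

variable {n : ℕ}

namespace Adm

variable {K m₀ Λ : ℝ} {lam : Fin n → ℝ}

theorem jacobi_two_large (n : ℕ) {m₀ Λ A : ℝ} (hΛ : 0 ≤ Λ) (hA : 1 ≤ A) :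
    ∃ R > 0, ∀ (K : ℝ) (lam : Fin n → ℝ), Adm K m₀ Λ lam → ∀ i j, i ≠ j → R ≤ lam i → R ≤ lam j →
      (∀ p, p ≠ i → p ≠ j → |lam p| ≤ A) → ∀ ξ : Fin n → ℝ,
      0 ≤ negQ lam ξ + 20 * (∑ p, eF lam p * ξ p) ^ 2 ∧
      21 / 20 * (eF lam i * (∑ p, ξ p) ^ 2) ≤
        es lam * (negQ lam ξ + 20 * (∑ p, eF lam p * ξ p) ^ 2
          + 2 * ∑ p ∈ univ.erase i, (es lam - lam i - lam p) * ξ p ^ 2) := by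
  obtain ⟨G, hG⟩ : ∃ G : ℝ, G = n * A + 1 := ⟨_, rfl⟩
  obtain ⟨B, hB⟩ : ∃ B : ℝ, B = (n + 1) * (Λ + 5 * G ^ 3 + 1) ^ 2 := ⟨_, rfl⟩
  have hn0 : (0 : ℝ) ≤ n := Nat.cast_nonneg n
  have hG1 : 1 ≤ G := by
    have : 0 ≤ (n : ℝ) * A := by positivity
    linarith
  obtain ⟨b1, b2, b3, b4⟩ := large_const_bounds (N := n + 1) (by linarith) hG1 hΛ
  rw [← hB] at b1 b2 b3 b4
  have hB1 : 1 ≤ B := by linarith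
  refine ⟨1000000 * B ^ 5, by positivity, fun K lam h i j hij hi hj hA' ξ => ?_⟩
  have hn : (1 : ℝ) ≤ n := by exact_mod_cast i.pos
  obtain ⟨g1, g2, g3, g4⟩ := growth_bounds hn hA
  rw [← hG] at g1 g2 g3 g4
  have hA0 : 0 ≤ A := by linarith
  have hji : j ∈ univ.erase i := mem_erase.2 ⟨hij.symm, mem_univ _⟩
  set S : Finset (Fin n) := (univ.erase i).erase j with hS
  have hcard : (S.card : ℝ) ≤ n := by
    have := card_le_univ S
    rw [Fintype.card_fin] at this
    exact_mod_cast this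
  have hAS : ∀ p ∈ S, |lam p| ≤ A := fun p hp =>
    hA' p (ne_of_mem_erase (mem_of_mem_erase hp)) (ne_of_mem_erase hp)
  have split : ∀ g : Fin n → ℝ, ∑ p, g p = g i + g j + ∑ p ∈ S, g p := fun g => by
    rw [← add_sum_erase _ _ (mem_univ i), ← add_sum_erase _ _ hji, add_assoc]
  have hR1 : 1 ≤ lam i := by linarith [one_le_pow₀ hB1 (n := 5)]
  have hR2 : 1 ≤ lam j := by linarith [one_le_pow₀ hB1 (n := 5)]
  have hi0 : lam i ≠ 0 := by linarith
  have hj0 : lam j ≠ 0 := by linarith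
  obtain ⟨t₁, ht₁⟩ : ∃ t, t = es lam - lam i - lam j := ⟨_, rfl⟩
  obtain ⟨Θ, hΘ⟩ : ∃ t, t = eq2 lam - lam i ^ 2 - lam j ^ 2 := ⟨_, rfl⟩
  obtain ⟨κ, hκ⟩ : ∃ t, t = ec lam - lam i ^ 3 - lam j ^ 3 := ⟨_, rfl⟩
  obtain ⟨t₂, ht₂⟩ : ∃ t, t = (t₁ ^ 2 - Θ) / 2 := ⟨_, rfl⟩
  obtain ⟨t₃, ht₃⟩ : ∃ t, t = (t₁ ^ 3 - 3 * t₁ * Θ + 2 * κ) / 6 := ⟨_, rfl⟩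
  have e1 : t₁ = 1 + ∑ p ∈ S, lam p := by rw [ht₁, es, split]; ring
  have e2 : Θ = 1 + ∑ p ∈ S, lam p ^ 2 := by rw [hΘ, eq2, split]; ring
  have e3 : κ = 1 + ∑ p ∈ S, lam p ^ 3 := by rw [hκ, ec, split]; ring
  have hes : es lam = lam i + lam j + t₁ := by rw [ht₁]; ring
  have heq2 : eq2 lam = lam i ^ 2 + lam j ^ 2 + Θ := by rw [hΘ]; ring
  have hec : ec lam = lam i ^ 3 + lam j ^ 3 + κ := by rw [hκ]; ring
  have hf : ef lam = lam i * lam j * t₁ + (lam i + lam j) * t₂ + t₃ := by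
    rw [ef, hes, heq2, hec, ht₂, ht₃]; ring
  have hFi : eF lam i = lam j * t₁ + t₂ := by rw [eF_eq, hes, heq2, ht₂]; ring
  have hFj : eF lam j = lam i * t₁ + t₂ := by rw [eF_eq, hes, heq2, ht₂]; ring
  have hFp : ∀ p, eF lam p = lam i * lam j + (lam i + lam j) * (t₁ - lam p)
      + (t₂ - t₁ * lam p + lam p ^ 2) := fun p => by
    rw [eF, esig, hes, heq2, ht₂]; ring
  have s1 := abs_le.1 (sum_bound_le S lam hA0 hcard hAS)
  have s2 := abs_le.1 (sum_bound_le S (fun p => lam p ^ 2) (by positivity) hcard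
    (A := A ^ 2) fun p hp => by rw [abs_pow]; gcongr; exact hAS p hp)
  have s3 := abs_le.1 (sum_bound_le S (fun p => lam p ^ 3) (by positivity) hcard
    (A := A ^ 3) fun p hp => by rw [abs_pow]; gcongr; exact hAS p hp)
  have hΘ1 : 1 ≤ Θ := by rw [e2]; linarith [sum_nonneg fun p (_ : p ∈ S) => sq_nonneg (lam p)]
  have ht₁0 : 0 < t₁ := ht₁ ▸ h.Fij_pos hij.symm
  have ht₁G : |t₁| ≤ G := by rw [abs_of_pos ht₁0]; linarith
  have hΘG : |Θ| ≤ G ^ 2 := by rw [abs_of_pos (by linarith)]; linarith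
  have hκG : |κ| ≤ G ^ 3 := by
    rw [abs_le]; constructor <;> linarith [pow_nonneg (by linarith : 0 ≤ G) 3]
  have ht₃G : |t₃| ≤ G ^ 3 := ht₃ ▸ abs_third_le (by linarith) ht₁G hΘG hκG
  have ht₁2 : t₁ ^ 2 ≤ G ^ 2 := sq_le_sq' (abs_le.1 ht₁G).1 (abs_le.1 ht₁G).2
  have hΘG' := abs_le.1 hΘG
  have ht₂G : |t₂| ≤ G ^ 2 := by
    rw [abs_le]; constructor <;> linarith [sq_nonneg t₁]
  have hG3 : 0 ≤ G ^ 3 := by positivity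
  have hG23 : G ^ 2 ≤ G ^ 3 := pow_le_pow_right₀ hG1 (by norm_num)
  obtain ⟨N, hN⟩ : ∃ E, E = ∑ p ∈ S, ξ p := ⟨_, rfl⟩
  obtain ⟨m, hm'⟩ : ∃ m, m = ∑ p ∈ S, lam p * ξ p := ⟨_, rfl⟩
  obtain ⟨v, hv⟩ : ∃ v, v = ∑ p ∈ S, lam p * ξ p ^ 2 := ⟨_, rfl⟩
  obtain ⟨hh, hh'⟩ : ∃ hh, hh = ∑ p ∈ S, ξ p ^ 2 := ⟨_, rfl⟩
  obtain ⟨d, hd⟩ : ∃ d, d = ∑ p ∈ S, (t₂ - t₁ * lam p + lam p ^ 2) * ξ p := ⟨_, rfl⟩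
  obtain ⟨x, hx⟩ : ∃ x, x = ξ i / lam i := ⟨_, rfl⟩
  obtain ⟨y, hy⟩ : ∃ y, y = ξ j / lam j := ⟨_, rfl⟩
  have hxi : ξ i = lam i * x := by rw [hx]; field_simp
  have hyj : ξ j = lam j * y := by rw [hy]; field_simp
  have hh0 : 0 ≤ hh := hh' ▸ sum_nonneg fun p _ => sq_nonneg _
  have hDeq : ∑ p, eF lam p * ξ p =
      (lam j * t₁ + t₂) * (lam i * x) + (lam i * t₁ + t₂) * (lam j * y)
      + lam i * lam j * N + (lam i + lam j) * (t₁ * N - m) + d := by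
    rw [split, hFi, hFj, hxi, hyj]
    have : ∑ p ∈ S, eF lam p * ξ p = lam i * lam j * N + (lam i + lam j) * (t₁ * N - m) + d := by
      rw [hN, hm', hd, mul_sum, mul_sum, ← sum_sub_distrib, mul_sum, ← sum_add_distrib,
        ← sum_add_distrib]
      exact sum_congr rfl fun p _ => by rw [hFp]; ring
    rw [this]; ring
  have hSi : ∑ p ∈ univ.erase i, (es lam - lam i - lam p) * ξ p ^ 2 =
      t₁ * (lam j * y) ^ 2 + ∑ p ∈ S, (lam j + t₁ - lam p) * ξ p ^ 2 := by
    rw [← add_sum_erase _ _ hji, hyj, ← ht₁]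
    congr 1
    exact sum_congr rfl fun p _ => by rw [hes]; ring
  have hd2 : d = t₂ * N - t₁ * m + ∑ p ∈ S, lam p ^ 2 * ξ p := by
    rw [hd, hN, hm', mul_sum, mul_sum, ← sum_sub_distrib, ← sum_add_distrib]
    exact sum_congr rfl fun p _ => by ring
  have hneg : negQ lam ξ = 2 * (ef lam - t₃) * (x ^ 2 + x * y + y ^ 2)
      - 2 * t₂ * (lam j * x ^ 2 + lam i * y ^ 2)
      - 2 * (lam j * x + lam i * y) * m + 2 * t₁ * N * (lam j * x + lam i * y)
      - 2 * (x + y) * (∑ p, eF lam p * ξ p) + 2 * (x + y) * d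
      + (lam i + lam j + t₁) * (hh - N ^ 2) + 2 * N * m - 2 * v := by
    rw [hDeq, hf]
    unfold negQ
    rw [split ξ, split fun p => ξ p ^ 2, split fun p => lam p * ξ p,
      split fun p => lam p * ξ p ^ 2, ← hN, ← hm', ← hv, ← hh', hxi, hyj, hes]
    ring
  have main := two_large (B := B) (L := lam i) (l := lam j) (x := x) (y := y) (t₁ := t₁) (t₂ := t₂)
    (Θ := Θ) (t₃ := t₃) (f := ef lam) (N := N) (m := m) (d := d) (h := hh) (v := v)
    (S := ∑ p ∈ S, (lam j + t₁ - lam p) * ξ p ^ 2) hB1 le_rfl hi hj hf ht₂ ?_ (by linarith) hΘ1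
    (by linarith) (by linarith) (by linarith) hh0 ?_ ?_ ?_ ?_ hDeq ht₁0 (hFi ▸ h.F_pos i) ?_ hneg
  · rw [hSi, hFi, split ξ, hxi, hyj, ← hN]
    refine ⟨main.1, main.2.trans (le_of_eq ?_)⟩
    rw [hes]; ring
  · rw [abs_le]; constructor <;> linarith [h.f_ge, h.f_le, h.m_pos]
  · rw [hm', hh']
    refine (sum_mul_sq_le_sq_mul_sq S lam ξ).trans (le_of_eq ?_)
    rw [e2]; ring
  · have := sum_mul_sq_le_card S (fun _ => 1) ξ (A := 1) (by simp)
    simp only [one_mul, one_pow, mul_one] at this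
    rw [← hN, ← hh'] at this
    refine this.trans ?_
    gcongr
    linarith
  · have hco : ∀ p ∈ S, |t₂ - t₁ * lam p + lam p ^ 2| ≤ Λ + 5 * G ^ 3 + 1 := by
      intro p hp
      have k1 := abs_le.1 (hAS p hp)
      have k2 : |t₁ * lam p| ≤ G * G := by
        rw [abs_mul]
        exact mul_le_mul ht₁G ((hAS p hp).trans g2) (abs_nonneg _) (by linarith)
      have k3 : lam p ^ 2 ≤ G ^ 2 := sq_le_sq' (by linarith) (by linarith)
      have k5 := abs_le.1 k2
      have k6 := abs_le.1 ht₂G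
      rw [abs_le]; constructor <;> linarith [sq_nonneg (lam p)]
    have := sum_mul_sq_le_card S _ ξ hco
    rw [← hd, ← hh'] at this
    refine this.trans ?_
    gcongr
    rw [hB]
    gcongr
    linarith
  · have := abs_sum_mul_sq_le S lam ξ hAS
    rw [← hv, ← hh'] at this
    refine this.trans ?_
    gcongr
    linarith
  · rw [hh', mul_sum]
    refine sum_le_sum fun p hp => mul_le_mul_of_nonneg_right ?_ (sq_nonneg _)
    linarith [(abs_le.1 (hAS p hp)).2]

/-- The trace Jacobi inequality in an eigenframe. -/
theorem jacobi_diagonal (n : ℕ) {K m₀ Λ : ℝ} (hK : 0 ≤ K) (hm : 0 < m₀) (hΛ : 0 < Λ) :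
    ∃ N > 0, ∃ C > 0, ∀ lam : Fin n → ℝ, Adm K m₀ Λ lam → N ≤ es lam → ∀ k (ξ : Fin n → ℝ),
      21 / 20 * (eF lam k * (∑ p, ξ p) ^ 2) ≤
        es lam * (negQ lam ξ + C * (∑ p, eF lam p * ξ p) ^ 2
          + 2 * ∑ p ∈ univ.erase k, (es lam - lam k - lam p) * ξ p ^ 2) := by
  obtain ⟨C₀, hC₀, H3⟩ := third_le n (m₀ := m₀) hK hΛ
  obtain ⟨R, hR, H2⟩ := jacobi_two_large n (m₀ := m₀) hΛ.le (A := 1 + K + C₀) (by linarith)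
  obtain ⟨C₁, hC₁, N₁, hN₁, H1⟩ := jacobi_one_large n hm hΛ.le (A := 1 + K + C₀ + R) (by linarith)
  obtain ⟨N₂, hN₂, Hb⟩ := bounded_direction n hm (A := 1 + K + C₀ + R) (by linarith)
  refine ⟨N₁ + N₂ + n * (C₀ + R) + 1, by positivity, C₁ + 20 + 23, by positivity,
    fun lam h hs k ξ => ?_⟩
  have hn : (0 : ℝ) ≤ n * (C₀ + R) := by positivity
  have hes : 0 < es lam := by linarith
  have hD := sq_nonneg (∑ p, eF lam p * ξ p)
  obtain ⟨i, -, hi⟩ := exists_max_image univ lam ⟨k, mem_univ k⟩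
  have hi : ∀ l, lam l ≤ lam i := fun l => hi l (mem_univ l)
  have hSk : ∀ k, 0 ≤ ∑ p ∈ univ.erase k, (es lam - lam k - lam p) * ξ p ^ 2 := fun k =>
    sum_nonneg fun p hp => mul_nonneg (h.Fij_pos (ne_of_mem_erase hp)).le (sq_nonneg _)
  have hFk : ∀ k, 0 ≤ 21 / 20 * (eF lam k * (∑ p, ξ p) ^ 2) := fun k => by
    have := h.F_pos k
    positivity
  have hC₁D : 0 ≤ C₁ * (∑ p, eF lam p * ξ p) ^ 2 := by positivity
  have hiR : C₀ + R ≤ lam i := by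
    by_contra hneg
    push Not at hneg
    have : ∑ p, lam p ≤ ∑ p : Fin n, (C₀ + R) := sum_le_sum fun p _ => (hi p).trans hneg.le
    simp only [sum_const, card_univ, Fintype.card_fin, nsmul_eq_mul] at this
    have h2 : es lam = 1 + ∑ p, lam p := rfl
    linarith
  have habs : ∀ p, ∀ c, 0 ≤ c → lam p ≤ c → |lam p| ≤ 1 + K + c := fun p c hc hp => by
    rw [abs_le]; constructor <;> linarith [h.lower p]
  have hbdd : ∀ k, lam k ≤ C₀ + R →
      0 ≤ negQ lam ξ + (C₁ + 20) * (∑ p, eF lam p * ξ p) ^ 2 →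
      21 / 20 * (eF lam k * (∑ p, ξ p) ^ 2) ≤
        es lam * (negQ lam ξ + (C₁ + 20 + 23) * (∑ p, eF lam p * ξ p) ^ 2
          + 2 * ∑ p ∈ univ.erase k, (es lam - lam k - lam p) * ξ p ^ 2) := by
    intro k hk h0
    have h1 := Hb K Λ lam h (by linarith) k ξ (by linarith [habs k _ (by linarith) hk])
    linarith [mul_nonneg hes.le h0]
  by_cases hall : ∀ p, p ≠ i → lam p ≤ C₀ + R
  · have h1 := H1 K lam h i (by linarith)
      (fun p hp => by linarith [habs p _ (by linarith) (hall p hp)]) ξ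
    have h0 : 0 ≤ negQ lam ξ + C₁ * (∑ p, eF lam p * ξ p) ^ 2 := by
      by_contra hneg
      push Not at hneg
      linarith [mul_neg_of_pos_of_neg hes hneg, hFk i]
    by_cases hki : k = i
    · subst hki
      refine h1.trans (mul_le_mul_of_nonneg_left ?_ hes.le)
      linarith [hSk k]
    · exact hbdd k (hall k hki) (by linarith)
  · push Not at hall
    obtain ⟨j, hji, hj⟩ := hall
    have hrest : ∀ p, p ≠ i → p ≠ j → lam p ≤ C₀ := by
      intro p hpi hpj
      rcases le_total (lam p) (lam j) with hp | hp
      · exact H3 lam h i j p hji.symm hpi.symm hpj.symm hi hp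
      · linarith [H3 lam h i p j hpi.symm hji.symm hpj hi hp]
    have h1 := H2 K lam h i j hji.symm (by linarith) (by linarith)
      (fun p hpi hpj => habs p _ hC₀.le (hrest p hpi hpj)) ξ
    have h2 := H2 K lam h j i hji (by linarith) (by linarith)
      (fun p hpj hpi => habs p _ hC₀.le (hrest p hpi hpj)) ξ
    by_cases hki : k = i
    · subst hki
      refine h1.2.trans (mul_le_mul_of_nonneg_left ?_ hes.le)
      linarith
    by_cases hkj : k = j
    · subst hkj
      refine h2.2.trans (mul_le_mul_of_nonneg_left ?_ hes.le)
      linarith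
    · exact hbdd k (by linarith [hrest k hki hkj]) (by linarith)

end Adm
end Jacobi

section MatrixForm

open Finset Matrix

variable {n : ℕ}

/-! ### The operator on symmetric matrices -/

def mS (A : Matrix (Fin n) (Fin n) ℝ) : ℝ := 1 + A.trace

def mSig (A : Matrix (Fin n) (Fin n) ℝ) : ℝ := (mS A ^ 2 - (1 + (A * A).trace)) / 2

def mf (A : Matrix (Fin n) (Fin n) ℝ) : ℝ :=
  (mS A ^ 3 - 3 * mS A * (1 + (A * A).trace) + 2 * (1 + (A * A * A).trace)) / 6

/-- The linearization of `σ₃ + σ₂`. -/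
def mF (A : Matrix (Fin n) (Fin n) ℝ) : Matrix (Fin n) (Fin n) ℝ :=
  mSig A • (1 : Matrix (Fin n) (Fin n) ℝ) - mS A • A + A * A

/-- The linearization of `σ₂ + σ₁`. -/
def mP (A : Matrix (Fin n) (Fin n) ℝ) : Matrix (Fin n) (Fin n) ℝ :=
  (mS A + 1) • (1 : Matrix (Fin n) (Fin n) ℝ) - A

/-- The second derivative of `σ₃ + σ₂` as a quadratic form. -/
def mQf (A B : Matrix (Fin n) (Fin n) ℝ) : ℝ :=
  mS A * B.trace ^ 2 - 2 * B.trace * (A * B).trace - mS A * (B * B).trace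
    + 2 * (A * (B * B)).trace

/-- `A = O diag(lam) Oᵀ` with `O` orthogonal. -/
structure Diag (A O : Matrix (Fin n) (Fin n) ℝ) (lam : Fin n → ℝ) : Prop where
  left : Oᵀ * O = 1
  right : O * Oᵀ = 1
  eq : A = O * diagonal lam * Oᵀ

/-- Symmetric matrices with admissible eigenvalues. -/
def MAdm (K m₀ Λ : ℝ) (A : Matrix (Fin n) (Fin n) ℝ) : Prop :=
  ∃ O lam, Diag A O lam ∧ Adm K m₀ Λ lam

theorem orth_sum {O : Matrix (Fin n) (Fin n) ℝ} (h : O * Oᵀ = 1) (a b : Fin n → ℝ) :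
    ∑ c, (∑ k, O k c * a k) * (∑ l, O l c * b l) = ∑ k, a k * b k := by
  have h1 : ∀ k l, ∑ c, O k c * O l c = if k = l then 1 else 0 := by
    intro k l
    have := congrFun (congrFun h k) l
    simpa [Matrix.mul_apply, Matrix.one_apply] using this
  calc _ = ∑ c, ∑ k, ∑ l, (a k * b l) * (O k c * O l c) := by
        refine sum_congr rfl fun c _ => ?_
        rw [sum_mul_sum]
        exact sum_congr rfl fun k _ => sum_congr rfl fun l _ => by ring
    _ = ∑ k, ∑ l, (a k * b l) * ∑ c, O k c * O l c := by
        rw [sum_comm]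
        refine sum_congr rfl fun k _ => ?_
        rw [sum_comm]
        exact sum_congr rfl fun l _ => by rw [mul_sum]
    _ = _ := by simp [h1]

namespace Diag

variable {A O : Matrix (Fin n) (Fin n) ℝ} {lam : Fin n → ℝ}

theorem trace_conj (h : Diag A O lam) (X : Matrix (Fin n) (Fin n) ℝ) :
    (O * X * Oᵀ).trace = X.trace := by
  rw [Matrix.trace_mul_comm, ← Matrix.mul_assoc, h.left, Matrix.one_mul]

theorem conj_mul (h : Diag A O lam) (X Y : Matrix (Fin n) (Fin n) ℝ) :
    (O * X * Oᵀ) * (O * Y * Oᵀ) = O * (X * Y) * Oᵀ := by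
  have : (O * X * Oᵀ) * (O * Y * Oᵀ) = O * X * (Oᵀ * O) * Y * Oᵀ := by
    simp only [Matrix.mul_assoc]
  rw [this, h.left]; simp [Matrix.mul_assoc]

theorem conj_eq (h : Diag A O lam) (X : Matrix (Fin n) (Fin n) ℝ) :
    X = O * (Oᵀ * X * O) * Oᵀ := by
  have : O * (Oᵀ * X * O) * Oᵀ = (O * Oᵀ) * X * (O * Oᵀ) := by simp only [Matrix.mul_assoc]
  rw [this, h.right]; simp

theorem mul_self (h : Diag A O lam) : A * A = O * diagonal (fun i => lam i ^ 2) * Oᵀ := by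
  conv_lhs => rw [h.eq]
  rw [h.conj_mul, diagonal_mul_diagonal]
  simp only [sq]

theorem mS_eq (h : Diag A O lam) : mS A = es lam := by
  rw [mS, h.eq, h.trace_conj, trace_diagonal, es]

theorem mSig_eq (h : Diag A O lam) : mSig A = esig lam := by
  rw [mSig, h.mS_eq, h.mul_self, h.trace_conj, trace_diagonal, esig, eq2]

theorem mf_eq (h : Diag A O lam) : mf A = ef lam := by
  have h3 : A * A * A = O * diagonal (fun i => lam i ^ 3) * Oᵀ := by
    calc A * A * A = (O * diagonal (fun i => lam i ^ 2) * Oᵀ) * (O * diagonal lam * Oᵀ) := by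
          rw [← h.mul_self, ← h.eq]
      _ = _ := by rw [h.conj_mul, diagonal_mul_diagonal]; simp only [pow_succ]
  rw [mf, h.mS_eq, h3, h.mul_self, h.trace_conj, h.trace_conj, trace_diagonal, trace_diagonal, ef,
    eq2, ec]

theorem one_eq (h : Diag A O lam) : (1 : Matrix (Fin n) (Fin n) ℝ) = O * diagonal 1 * Oᵀ := by
  simp [h.right]

theorem add_smul_one (h : Diag A O lam) (c : ℝ) :
    Diag (A + c • (1 : Matrix (Fin n) (Fin n) ℝ)) O (fun i => lam i + c) := by
  refine ⟨h.left, h.right, ?_⟩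
  have : diagonal (fun i => lam i + c) = diagonal lam + c • (1 : Matrix (Fin n) (Fin n) ℝ) := by
    ext i j; by_cases hij : i = j <;> simp [hij]
  rw [this, Matrix.mul_add, Matrix.add_mul, ← h.eq]
  simp [h.right]

theorem mF_diag (h : Diag A O lam) : Diag (mF A) O (eF lam) := by
  refine ⟨h.left, h.right, ?_⟩
  have : diagonal (eF lam) = esig lam • (1 : Matrix (Fin n) (Fin n) ℝ) - es lam • diagonal lam
      + diagonal (fun i => lam i ^ 2) := by
    ext i j; by_cases hij : i = j <;> simp [hij, eF]
  rw [mF, h.mS_eq, h.mSig_eq, h.mul_self, this, Matrix.mul_add, Matrix.add_mul, Matrix.mul_sub,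
    Matrix.sub_mul]
  simp [h.right, h.eq.symm]

theorem mP_diag (h : Diag A O lam) : Diag (mP A) O (fun i => es lam + 1 - lam i) := by
  refine ⟨h.left, h.right, ?_⟩
  have : diagonal (fun i => es lam + 1 - lam i)
      = (es lam + 1) • (1 : Matrix (Fin n) (Fin n) ℝ) - diagonal lam := by
    ext i j; by_cases hij : i = j <;> simp [hij]
  rw [mP, h.mS_eq, this, Matrix.mul_sub, Matrix.sub_mul]
  simp [h.right, h.eq.symm]

theorem trace_mul_eq (h : Diag A O lam) (X : Matrix (Fin n) (Fin n) ℝ) :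
    (A * X).trace = ∑ i, lam i * (Oᵀ * X * O) i i := by
  have : (A * X).trace = (diagonal lam * (Oᵀ * X * O)).trace := by
    conv_lhs => rw [h.eq, h.conj_eq X]
    rw [h.conj_mul, h.trace_conj]
  rw [this]; simp [Matrix.trace, diagonal_mul]

theorem isSymm (h : Diag A O lam) : Aᵀ = A := by
  rw [h.eq]; simp [Matrix.transpose_mul, Matrix.mul_assoc]

theorem quad (h : Diag A O lam) (v : Fin n → ℝ) :
    v ⬝ᵥ (A *ᵥ v) = ∑ i, lam i * ((Oᵀ *ᵥ v) i) ^ 2 := by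
  rw [h.eq, ← Matrix.mulVec_mulVec, ← Matrix.mulVec_mulVec, dotProduct_mulVec,
    ← Matrix.mulVec_transpose]
  simp only [dotProduct, mulVec_diagonal]
  exact sum_congr rfl fun i _ => by ring

theorem norm_mulVec (h : Diag A O lam) (v : Fin n → ℝ) :
    ∑ i, ((A *ᵥ v) i) ^ 2 = ∑ i, lam i ^ 2 * ((Oᵀ *ᵥ v) i) ^ 2 := by
  have h2 : Diag (A * A) O (fun i => lam i ^ 2) := ⟨h.left, h.right, h.mul_self⟩
  rw [← h2.quad, ← Matrix.mulVec_mulVec, dotProduct_mulVec, ← Matrix.mulVec_transpose, h.isSymm]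
  simp [dotProduct, sq]

theorem norm_sq (h : Diag A O lam) (v : Fin n → ℝ) :
    ∑ i, ((Oᵀ *ᵥ v) i) ^ 2 = ∑ i, v i ^ 2 := by
  have := (⟨h.left, h.right, h.one_eq⟩ : Diag 1 O (1 : Fin n → ℝ)).quad v
  simp at this
  rw [← this]; simp [dotProduct, sq]

theorem mQf_eq (h : Diag A O lam) (B : Matrix (Fin n) (Fin n) ℝ) :
    mQf A B = mQf (diagonal lam) (Oᵀ * B * O) := by
  have h1 : mS A = mS (diagonal lam) := by rw [h.mS_eq, mS, trace_diagonal, es]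
  have hB := h.conj_eq B
  set Y := Oᵀ * B * O
  have ht : ∀ X : Matrix (Fin n) (Fin n) ℝ, (A * (O * X * Oᵀ)).trace =
      (diagonal lam * X).trace := by
    intro X
    conv_lhs => rw [h.eq]
    rw [h.conj_mul, h.trace_conj]
  rw [mQf, mQf, ← h1, hB, h.trace_conj, h.conj_mul, h.trace_conj, ht, ht]

end Diag

theorem mQf_diagonal (lam : Fin n → ℝ) (X : Matrix (Fin n) (Fin n) ℝ) (hX : ∀ i j, X i j = X j i) :
    mQf (diagonal lam) X = es lam * ((∑ i, X i i) * ∑ i, X i i)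
      - 2 * ((∑ i, X i i) * ∑ i, lam i * X i i) - es lam * (∑ i, ∑ j, X i j * X i j)
      + 2 * ∑ i, lam i * ∑ j, X i j * X i j := by
  have h1 : (X * X).trace = ∑ i, ∑ j, X i j * X i j := by
    simp only [Matrix.trace, Matrix.diag, Matrix.mul_apply]
    exact sum_congr rfl fun i _ => sum_congr rfl fun j _ => by rw [hX j i]
  have h2 : (diagonal lam * (X * X)).trace = ∑ i, lam i * ∑ j, X i j * X i j := by
    refine sum_congr rfl fun i _ => ?_
    rw [Matrix.diag, diagonal_mul, Matrix.mul_apply]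
    congr 1; exact sum_congr rfl fun j _ => by rw [hX j i]
  have h3 : (diagonal lam * X).trace = ∑ i, lam i * X i i := by
    simp [Matrix.trace, diagonal_mul]
  rw [mQf, h1, h2, h3, mS, trace_diagonal, es]
  simp only [Matrix.trace, Matrix.diag]
  ring

theorem neg_mQf_diagonal (lam : Fin n → ℝ) (X : Matrix (Fin n) (Fin n) ℝ)
    (hX : ∀ i j, X i j = X j i) :
    -mQf (diagonal lam) X = negQ lam (fun i => X i i)
      + ∑ i, ∑ j ∈ univ.erase i, (es lam - lam i - lam j) * X i j ^ 2 := by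
  have h1 : ∑ i, ∑ j, (es lam - lam i - lam j) * X i j ^ 2 =
      es lam * (∑ i, ∑ j, X i j * X i j) - 2 * ∑ i, lam i * ∑ j, X i j * X i j := by
    have e1 : ∑ i, ∑ j, lam j * X i j ^ 2 = ∑ i, lam i * ∑ j, X i j * X i j := by
      rw [sum_comm]
      refine sum_congr rfl fun i _ => ?_
      rw [mul_sum]
      exact sum_congr rfl fun j _ => by rw [hX j i]; ring
    have e2 : ∑ i, ∑ j, lam i * X i j ^ 2 = ∑ i, lam i * ∑ j, X i j * X i j := by
      refine sum_congr rfl fun i _ => ?_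
      rw [mul_sum]
      exact sum_congr rfl fun j _ => by ring
    have e3 : ∑ i, ∑ j, es lam * X i j ^ 2 = es lam * (∑ i, ∑ j, X i j * X i j) := by
      simp only [mul_sum, sq]
    simp only [sub_mul, sum_sub_distrib, e1, e2, e3]; ring
  have h2 : ∑ i, ∑ j, (es lam - lam i - lam j) * X i j ^ 2 =
      ∑ i, ∑ j ∈ univ.erase i, (es lam - lam i - lam j) * X i j ^ 2
        + ∑ i, (es lam - lam i - lam i) * X i i ^ 2 := by
    rw [← sum_add_distrib]
    exact sum_congr rfl fun i _ => (sum_erase_add _ _ (mem_univ i)).symm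
  have h3 : ∑ i, (es lam - lam i - lam i) * X i i ^ 2 =
      es lam * ∑ i, X i i ^ 2 - 2 * ∑ i, lam i * X i i ^ 2 := by
    rw [mul_sum, mul_sum, ← sum_sub_distrib]
    exact sum_congr rfl fun i _ => by ring
  rw [mQf_diagonal lam X hX, negQ]
  linarith

theorem off_diag_ge {lam : Fin n → ℝ} (hF : ∀ i j, j ≠ i → 0 < es lam - lam i - lam j)
    (Z : Fin n → Matrix (Fin n) (Fin n) ℝ) (h1 : ∀ k i j, Z k i j = Z k j i)
    (h2 : ∀ k i j, Z k i j = Z i k j) :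
    ∑ k, 2 * ∑ p ∈ univ.erase k, (es lam - lam k - lam p) * Z k p p ^ 2 ≤
      ∑ k, ∑ i, ∑ j ∈ univ.erase i, (es lam - lam i - lam j) * Z k i j ^ 2 := by
  rw [sum_comm]
  have h3 : ∀ i, ∑ k, ∑ j ∈ univ.erase i, (es lam - lam i - lam j) * Z k i j ^ 2 =
      ∑ j ∈ univ.erase i, (es lam - lam i - lam j) * ∑ k, Z k i j ^ 2 := fun i => by
    rw [sum_comm]; exact sum_congr rfl fun j _ => by rw [mul_sum]
  simp only [h3]
  have h4 : ∀ i, ∑ j ∈ univ.erase i, (es lam - lam i - lam j) * (Z i i j ^ 2 + Z j i j ^ 2) ≤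
      ∑ j ∈ univ.erase i, (es lam - lam i - lam j) * ∑ k, Z k i j ^ 2 := by
    refine fun i => sum_le_sum fun j hj => ?_
    have hji := ne_of_mem_erase hj
    refine mul_le_mul_of_nonneg_left ?_ (hF i j hji).le
    rw [← sum_pair (f := fun k => Z k i j ^ 2) hji.symm]
    exact sum_le_sum_of_subset_of_nonneg (subset_univ _) fun _ _ _ => sq_nonneg _
  refine le_trans (le_of_eq ?_) (sum_le_sum fun i _ => h4 i)
  have e1 : ∑ i, ∑ j ∈ univ.erase i, (es lam - lam i - lam j) * Z i i j ^ 2 =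
      ∑ k, ∑ p ∈ univ.erase k, (es lam - lam k - lam p) * Z k p p ^ 2 := by
    have : ∀ G : Fin n → Fin n → ℝ, ∑ i, ∑ j ∈ univ.erase i, G i j
        = ∑ j, ∑ i ∈ univ.erase j, G i j := by
      intro G
      refine sum_comm' fun x y => ?_
      simp [eq_comm]
    rw [this]
    refine sum_congr rfl fun j _ => sum_congr rfl fun i _ => ?_
    rw [h1 i i j, h2 i j i]; ring
  have e2 : ∑ i, ∑ j ∈ univ.erase i, (es lam - lam i - lam j) * Z j i j ^ 2 =
      ∑ k, ∑ p ∈ univ.erase k, (es lam - lam k - lam p) * Z k p p ^ 2 := by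
    refine sum_congr rfl fun i _ => sum_congr rfl fun j _ => ?_
    rw [h2 j i j]
  rw [← mul_sum, two_mul]
  nth_rewrite 1 [← e1]
  rw [← e2, ← sum_add_distrib]
  refine sum_congr rfl fun i _ => ?_
  rw [← sum_add_distrib]
  exact sum_congr rfl fun j _ => by ring

theorem matrix_jacobi (n : ℕ) {K m₀ Λ : ℝ} (hK : 0 ≤ K) (hm : 0 < m₀) (hΛ : 0 < Λ) :
    ∃ N > 0, ∃ C > 0, ∀ A : Matrix (Fin n) (Fin n) ℝ, MAdm K m₀ Λ A → N ≤ mS A →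
      ∀ B : Fin n → Matrix (Fin n) (Fin n) ℝ, (∀ k i j, B k i j = B k j i) →
        (∀ k i j, B k i j = B i k j) →
      21 / 20 * ((fun k => (B k).trace) ⬝ᵥ (mF A *ᵥ fun k => (B k).trace)) ≤
        mS A * (-(∑ k, mQf A (B k)) + C * ∑ k, (mF A * B k).trace ^ 2) := by
  obtain ⟨N, hN, C, hC, key⟩ := Adm.jacobi_diagonal n hK hm hΛ
  refine ⟨N, hN, C, hC, ?_⟩
  rintro A ⟨O, lam, hd, ha⟩ hNA B hB1 hB2
  rw [hd.mS_eq] at hNA ⊢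
  obtain ⟨Y, hY⟩ : ∃ Y : Fin n → Matrix (Fin n) (Fin n) ℝ, Y = fun k => Oᵀ * B k * O := ⟨_, rfl⟩
  obtain ⟨Z, hZ⟩ : ∃ Z : Fin n → Matrix (Fin n) (Fin n) ℝ,
    Z = fun c => Matrix.of fun i j => ∑ k, O k c * Y k i j := ⟨_, rfl⟩
  have hYa : ∀ k i j, Y k i j = ∑ a, ∑ b, O a i * O b j * B k a b := by
    intro k i j
    rw [hY]
    simp only [Matrix.mul_apply, Matrix.transpose_apply, sum_mul]
    rw [sum_comm]
    exact sum_congr rfl fun a _ => sum_congr rfl fun b _ => by ring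
  have hZa : ∀ c i j, Z c i j = ∑ k, O k c * Y k i j := fun c i j => by rw [hZ]; rfl
  have hYs : ∀ k i j, Y k i j = Y k j i := by
    intro k i j
    rw [hYa, hYa, sum_comm]
    exact sum_congr rfl fun a _ => sum_congr rfl fun b _ => by rw [hB1 k a b]; ring
  have hZs : ∀ c i j, Z c i j = Z c j i := by
    intro c i j
    simp only [hZa]; exact sum_congr rfl fun k _ => by rw [hYs]
  have hZ2 : ∀ c i j, Z c i j = Z i c j := by
    intro c i j
    simp only [hZa, hYa, mul_sum]
    rw [sum_comm]
    exact sum_congr rfl fun k _ => sum_congr rfl fun a _ => sum_congr rfl fun b _ => by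
      rw [hB2 k a b]; ring
  have horth : ∀ (w : Fin n → ℝ) (w' : Fin n → ℝ),
      ∑ c, (∑ i, w i * Z c i i) * (∑ i, w' i * Z c i i)
        = ∑ k, (∑ i, w i * Y k i i) * (∑ i, w' i * Y k i i) := by
    intro w w'
    rw [← orth_sum hd.right (fun k => ∑ i, w i * Y k i i) fun k => ∑ i, w' i * Y k i i]
    have : ∀ (w : Fin n → ℝ) c, ∑ i, w i * Z c i i = ∑ k, O k c * ∑ i, w i * Y k i i := by
      intro w c
      simp only [hZa, mul_sum]; rw [sum_comm]
      exact sum_congr rfl fun k _ => sum_congr rfl fun a _ => by ring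
    exact sum_congr rfl fun c _ => by rw [this, this]
  have horth1 : ∀ i j, ∑ c, Z c i j * Z c i j = ∑ k, Y k i j * Y k i j := by
    intro i j
    rw [← orth_sum hd.right (fun k => Y k i j) fun k => Y k i j]
    exact sum_congr rfl fun c _ => by rw [hZa]
  have hQ : ∑ k, mQf A (B k) = ∑ c, mQf (diagonal lam) (Z c) := by
    have e1 : ∑ k, mQf A (B k) = ∑ k, mQf (diagonal lam) (Y k) :=
      sum_congr rfl fun k _ => by rw [hd.mQf_eq, hY]
    rw [e1]
    simp only [mQf_diagonal lam _ (hYs _), mQf_diagonal lam _ (hZs _), sum_add_distrib,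
      sum_sub_distrib, ← mul_sum]
    have o1 := horth 1 1
    have o2 := horth 1 lam
    simp only [Pi.one_apply, one_mul] at o1 o2
    have o3 : ∑ c, ∑ i, ∑ j, Z c i j * Z c i j = ∑ k, ∑ i, ∑ j, Y k i j * Y k i j := by
      have : ∀ W : Fin n → Matrix (Fin n) (Fin n) ℝ, ∑ c, ∑ i, ∑ j, W c i j * W c i j
          = ∑ i, ∑ j, ∑ c, W c i j * W c i j := fun W => by
        rw [sum_comm]; exact sum_congr rfl fun i _ => sum_comm
      rw [this, this]; simp only [horth1]
    have o4 : ∑ c, ∑ i, lam i * ∑ j, Z c i j * Z c i j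
        = ∑ k, ∑ i, lam i * ∑ j, Y k i j * Y k i j := by
      have : ∀ W : Fin n → Matrix (Fin n) (Fin n) ℝ, ∑ c, ∑ i, lam i * ∑ j, W c i j * W c i j
          = ∑ i, lam i * ∑ j, ∑ c, W c i j * W c i j := fun W => by
        rw [sum_comm]; refine sum_congr rfl fun i _ => ?_
        rw [← mul_sum, sum_comm]
      rw [this, this]; simp only [horth1]
    rw [o1, o2, o3, o4]
  have hT : ∑ k, (mF A * B k).trace ^ 2 = ∑ c, (∑ p, eF lam p * Z c p p) ^ 2 := by
    simp only [sq]
    rw [horth]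
    exact sum_congr rfl fun k _ => by rw [hd.mF_diag.trace_mul_eq, hY]
  have hG : (fun k => (B k).trace) ⬝ᵥ (mF A *ᵥ fun k => (B k).trace)
      = ∑ c, eF lam c * (∑ p, Z c p p) ^ 2 := by
    rw [hd.mF_diag.quad]
    refine sum_congr rfl fun c _ => ?_
    congr 2
    simp only [mulVec, dotProduct, Matrix.transpose_apply, hZa]
    rw [sum_comm]
    refine sum_congr rfl fun k _ => ?_
    rw [← mul_sum]
    congr 1
    conv_lhs => rw [hd.conj_eq (B k), hd.trace_conj]
    rw [hY]; rfl
  rw [hG, hT, hQ, mul_sum]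
  have hoff := off_diag_ge (lam := lam) (fun i j hij => ha.Fij_pos hij) Z hZs hZ2
  have hsum := sum_le_sum fun c (_ : c ∈ univ) => key lam ha hNA c (fun p => Z c p p)
  refine hsum.trans ?_
  rw [← mul_sum]
  refine mul_le_mul_of_nonneg_left ?_ (by linarith [ha.sum_pos])
  rw [← sum_neg_distrib]
  simp only [neg_mQf_diagonal lam _ (hZs _), sum_add_distrib, ← mul_sum] at hoff ⊢
  linarith

end MatrixForm

section MatrixForm

open Finset Matrix

theorem esymm_cons (s : Multiset ℝ) (a : ℝ) (k : ℕ) :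
    (a ::ₘ s).esymm (k + 1) = s.esymm (k + 1) + a * s.esymm k := by
  simp [Multiset.esymm, Multiset.powersetCard_cons, Multiset.sum_map_mul_left]

theorem esymm_eq_power_sums (s : Multiset ℝ) :
    s.esymm 1 = s.sum ∧ 2 * s.esymm 2 = s.sum ^ 2 - (s.map (· ^ 2)).sum ∧
      6 * s.esymm 3 = s.sum ^ 3 - 3 * s.sum * (s.map (· ^ 2)).sum + 2 * (s.map (· ^ 3)).sum := by
  induction s using Multiset.induction_on with
  | empty => simp [Multiset.esymm, Multiset.powersetCard_zero_right 0,
    Multiset.powersetCard_zero_right 1, Multiset.powersetCard_zero_right 2]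
  | cons a s ih =>
    obtain ⟨h1, h2, h3⟩ := ih
    have h0 : s.esymm 0 = 1 := by simp [Multiset.esymm]
    rw [esymm_cons, esymm_cons, esymm_cons, h0]
    simp only [Multiset.map_cons, Multiset.sum_cons]
    refine ⟨by linarith, by linear_combination h2 + 2 * a * h1, ?_⟩
    linear_combination h3 + 3 * a * h2

variable {n : ℕ}

theorem sigmaMat_eq_esymm {A : Matrix (Fin n) (Fin n) ℝ} (hA : A.IsHermitian) {k : ℕ} (hk : k ≤ n) :
    sigmaMat k A = (univ.val.map hA.eigenvalues).esymm k := by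
  have hr := hA.roots_charpoly_eq_eigenvalues
  have hc : A.charpoly.natDegree = n := by simp
  have := Polynomial.coeff_eq_esymm_roots_of_splits (p := A.charpoly) hA.splits_charpoly
    (k := n - k)
    (by rw [hc]; omega)
  rw [sigmaMat, this, hc, hr, (Matrix.charpoly_monic A).leadingCoeff, Nat.sub_sub_self hk, one_mul,
    ← mul_assoc, ← mul_pow]
  simp

theorem exists_diag {A : Matrix (Fin n) (Fin n) ℝ} (hA : A.IsHermitian) :
    ∃ O, Diag A O hA.eigenvalues := by
  refine ⟨hA.eigenvectorUnitary, ?_, ?_, ?_⟩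
  · have := Unitary.coe_star_mul_self hA.eigenvectorUnitary
    simpa [Matrix.star_eq_conjTranspose] using this
  · have := Unitary.coe_mul_star_self hA.eigenvectorUnitary
    simpa [Matrix.star_eq_conjTranspose] using this
  · have := hA.spectral_theorem
    rw [Unitary.conjStarAlgAut_apply] at this
    simpa [Matrix.star_eq_conjTranspose] using this

theorem Diag.lower_of_posSemidef {A O : Matrix (Fin n) (Fin n) ℝ} {lam : Fin n → ℝ} {K : ℝ}
    (h : Diag A O lam) (hK : (A + K • (1 : Matrix (Fin n) (Fin n) ℝ)).PosSemidef) (i : Fin n) :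
    -K ≤ lam i := by
  have h1 := (h.add_smul_one K).quad (O *ᵥ Pi.single i 1)
  have h2 := hK.dotProduct_mulVec_nonneg (O *ᵥ Pi.single i 1)
  have h3 : star (O *ᵥ Pi.single i (1 : ℝ)) = O *ᵥ Pi.single i 1 := by ext; simp
  rw [h3, h1] at h2
  simp only [Matrix.mulVec_mulVec, h.left, Matrix.one_mulVec] at h2
  rw [sum_eq_single i (fun j _ hj => by simp [hj]) (by simp)] at h2
  simp at h2
  linarith

theorem mAdm_of_sigmaMat (hn : 3 ≤ n) {K m₀ Λ : ℝ} (hK : 0 ≤ K) (hm : 0 < m₀)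
    {A : Matrix (Fin n) (Fin n) ℝ} (hA : A.IsHermitian)
    (hpos : ∀ i : ℕ, 1 ≤ i → i ≤ 2 → 0 < sigmaMat i A)
    (hge : m₀ ≤ sigmaMat 3 A + sigmaMat 2 A) (hle : sigmaMat 3 A + sigmaMat 2 A ≤ Λ)
    (hsc : (A + K • (1 : Matrix (Fin n) (Fin n) ℝ)).PosSemidef) :
    MAdm K m₀ Λ A ∧ mf A = sigmaMat 3 A + sigmaMat 2 A := by
  obtain ⟨O, hO⟩ := exists_diag hA
  have h1 := hpos 1 le_rfl one_le_two
  have h2 := hpos 2 one_le_two le_rfl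
  obtain ⟨e1, e2, e3⟩ := esymm_eq_power_sums (univ.val.map hA.eigenvalues)
  rw [← sigmaMat_eq_esymm hA (by omega)] at e1 e2 e3
  set lam := hA.eigenvalues
  have s1 : (univ.val.map lam).sum = ∑ i, lam i := rfl
  have s2 : ((univ.val.map lam).map (· ^ 2)).sum = ∑ i, lam i ^ 2 := by
    rw [Multiset.map_map]; rfl
  have s3 : ((univ.val.map lam).map (· ^ 3)).sum = ∑ i, lam i ^ 3 := by
    rw [Multiset.map_map]; rfl
  rw [s1, s2] at e2
  rw [s1, s2, s3] at e3
  rw [s1] at e1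
  have hf : ef lam = sigmaMat 3 A + sigmaMat 2 A := by
    rw [ef, es, eq2, ec]
    linear_combination -(1 / 6) * e3 - (1 / 2) * e2
  refine ⟨⟨O, lam, hO, hK, hm, hO.lower_of_posSemidef hsc, ?_, ?_, by rw [hf]; exact hge,
    by rw [hf]; exact hle⟩, by rw [hO.mf_eq, hf]⟩
  · rw [es]; linarith
  · rw [esig, es, eq2]; linarith

end MatrixForm

section MatrixForm

open Finset Matrix

variable {n : ℕ}

theorem Adm.abs_eig_le {K m₀ Λ : ℝ} {lam : Fin n → ℝ} (h : Adm K m₀ Λ lam) (i : Fin n) :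
    |lam i| ≤ (K + 1) * es lam := by
  have h1 := h.one_lt_e i
  have h2 := h.lower i
  have h3 := h.sum_pos
  have h4 := mul_nonneg h.K_nonneg (sub_nonneg.2 h3.le)
  rw [abs_le]; constructor <;> linarith [h.K_nonneg]

theorem prod_le_of_two {ι : Type*} [Fintype ι] [DecidableEq ι] (ν : ι → ℝ) {C D : ℝ} (hC : 1 ≤ C)
    (hD : 0 ≤ D) (hν : ∀ i, 0 ≤ ν i) {a b : ι} (hab : a ≠ b) (h2 : ν a * ν b ≤ D)
    (h : ∀ k, k ≠ a → k ≠ b → ν k ≤ C) : ∏ i, ν i ≤ D * C ^ Fintype.card ι := by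
  rw [← mul_prod_erase univ ν (mem_univ a),
    ← mul_prod_erase (univ.erase a) ν (mem_erase.2 ⟨hab.symm, mem_univ b⟩), ← mul_assoc]
  refine mul_le_mul h2 ?_ (prod_nonneg fun i _ => hν i) hD
  calc ∏ i ∈ (univ.erase a).erase b, ν i ≤ C ^ ((univ.erase a).erase b).card :=
        (prod_le_prod (fun i _ => hν i) fun i hi => by
          simp only [mem_erase] at hi; exact h i hi.2.1 hi.1).trans (by rw [prod_const])
    _ ≤ _ := pow_le_pow_right₀ hC (card_le_univ _)

theorem Adm.prod_le (n : ℕ) (hn : 3 ≤ n) {K m₀ Λ : ℝ} (hK : 0 ≤ K) (hΛ : 0 < Λ) : ∃ C > 0,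
    ∀ lam : Fin n → ℝ, Adm K m₀ Λ lam → 2 ≤ es lam →
      ∏ i, (lam i + (K + 1)) ≤ C * esig lam := by
  obtain ⟨C, hC, key⟩ := Adm.third_le (m₀ := m₀) n hK hΛ
  refine ⟨(K + 2) ^ 2 * (C + K + 1) ^ n, by positivity, fun lam h hs => ?_⟩
  have : NeZero n := ⟨by omega⟩
  obtain ⟨a, -, ha⟩ := exists_max_image univ lam univ_nonempty
  have hne : (univ.erase a).Nonempty := by
    rw [← card_pos, card_erase_of_mem (mem_univ a)]; simp; omega
  obtain ⟨b, hb, hb'⟩ := exists_max_image (univ.erase a) lam hne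
  have hba := ne_of_mem_erase hb
  have hsig := h.sig_gt
  have hν : ∀ i, 0 ≤ lam i + (K + 1) := fun i => by linarith [h.lower i]
  have h2 : (lam a + (K + 1)) * (lam b + (K + 1)) ≤ (K + 2) ^ 2 * esig lam := by
    by_cases h1 : 1 ≤ lam a
    · have e1 : lam a + (K + 1) ≤ (K + 2) * lam a := by
        linarith [mul_nonneg (by linarith : 0 ≤ K + 1) (sub_nonneg.2 h1)]
      have e2 : lam b + (K + 1) ≤ (K + 2) * (es lam - lam a) := by
        have := (abs_lt.1 (h.abs_lt_e hba)).2
        linarith [mul_nonneg (by linarith : 0 ≤ K + 1) (sub_nonneg.2 (h.one_lt_e a).le)]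
      calc _ ≤ ((K + 2) * lam a) * ((K + 2) * (es lam - lam a)) :=
            mul_le_mul e1 e2 (hν b) (by positivity)
        _ = (K + 2) ^ 2 * (lam a * (es lam - lam a)) := by ring
        _ ≤ _ := by
          refine mul_le_mul_of_nonneg_left ?_ (by positivity)
          linarith [esig_eq lam a, h.F_pos a]
    · push Not at h1
      have e1 : lam a + (K + 1) ≤ K + 2 := by linarith
      have e2 : lam b + (K + 1) ≤ K + 2 := by linarith [ha b (mem_univ b)]
      calc _ ≤ (K + 2) * (K + 2) := mul_le_mul e1 e2 (hν b) (by linarith)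
        _ = (K + 2) ^ 2 * 1 := by ring
        _ ≤ _ := mul_le_mul_of_nonneg_left (by linarith) (by positivity)
  have := prod_le_of_two (fun i => lam i + (K + 1)) (C := C + K + 1) (by linarith)
    (D := (K + 2) ^ 2 * esig lam) (by have := h.sig_pos; positivity) hν hba.symm h2
    fun k hka hkb => by
      linarith [key lam h a b k hba.symm hka.symm hkb.symm (fun l => ha l (mem_univ l))
        (hb' k (mem_erase.2 ⟨hka, mem_univ k⟩))]
  rw [Fintype.card_fin] at this
  linarith

theorem Diag.det_eq {A O : Matrix (Fin n) (Fin n) ℝ} {lam : Fin n → ℝ} (h : Diag A O lam) :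
    A.det = ∏ i, lam i := by
  rw [h.eq, Matrix.mul_assoc, Matrix.det_mul_comm, Matrix.mul_assoc, h.left]; simp

theorem Diag.sum_sq_mulVec_le {A O : Matrix (Fin n) (Fin n) ℝ} {lam : Fin n → ℝ}
    (h : Diag A O lam) {B : ℝ} (hB : ∀ i, |lam i| ≤ B) (v : Fin n → ℝ) :
    ∑ i, ((A *ᵥ v) i) ^ 2 ≤ B ^ 2 * ∑ i, v i ^ 2 := by
  rw [h.norm_mulVec, ← h.norm_sq v, mul_sum]
  refine sum_le_sum fun i _ => mul_le_mul_of_nonneg_right ?_ (sq_nonneg _)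
  exact sq_le_sq' (by linarith [(abs_le.1 (hB i)).1]) ((le_abs_self _).trans (hB i))

theorem Diag.abs_entry_le {A O : Matrix (Fin n) (Fin n) ℝ} {lam : Fin n → ℝ}
    (h : Diag A O lam) {B : ℝ} (hB : ∀ i, |lam i| ≤ B) (i j : Fin n) : |A i j| ≤ B := by
  have h1 := h.sum_sq_mulVec_le hB (Pi.single j 1)
  have h2 : ∑ i, (Pi.single j (1 : ℝ) : Fin n → ℝ) i ^ 2 = 1 := by
    rw [sum_eq_single j (fun k _ hk => by simp [hk]) (by simp)]; simp
  have h3 := (single_le_sum (f := fun i => ((A *ᵥ Pi.single j 1) i) ^ 2)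
    (fun _ _ => sq_nonneg _) (mem_univ i)).trans h1
  rw [h2] at h3
  simp only [mulVec_single_one, Matrix.col_apply, mul_one] at h3
  exact abs_le_of_sq_le_sq h3 ((abs_nonneg _).trans (hB i))

theorem det_le_of_entries {X : Matrix (Fin n) (Fin n) ℝ} {ν : Fin n → ℝ} {C : ℝ}
    (h : ∀ i j, |X i j| ≤ C * (ν i * ν j)) :
    |X.det| ≤ (n.factorial * C ^ n) * (∏ i, ν i) ^ 2 := by
  rw [Matrix.det_apply]
  refine (abs_sum_le_sum_abs _ _).trans ?_
  calc _ ≤ ∑ π : Equiv.Perm (Fin n), C ^ n * (∏ i, ν i) ^ 2 := by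
        refine sum_le_sum fun π _ => ?_
        have h1 : |Equiv.Perm.sign π • ∏ i, X (π i) i| = ∏ i, |X (π i) i| := by
          rw [← abs_prod, Units.smul_def, zsmul_eq_mul, abs_mul]
          rcases Int.units_eq_one_or (Equiv.Perm.sign π) with h | h <;> simp [h]
        rw [h1]
        refine (prod_le_prod (fun i _ => abs_nonneg _) fun i _ => h (π i) i).trans (le_of_eq ?_)
        rw [prod_mul_distrib, prod_mul_distrib, Equiv.prod_comp π ν]
        simp [sq]
    _ = _ := by simp [Fintype.card_perm]; ring

theorem abs_entry_le_of_psd {X : Matrix (Fin n) (Fin n) ℝ} (hX : ∀ i j, X i j = X j i)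
    (hp : ∀ v, 0 ≤ v ⬝ᵥ (X *ᵥ v)) {ν : Fin n → ℝ} (hν : ∀ i, 0 < ν i) {C : ℝ}
    (hd : ∀ i, X i i ≤ C * ν i ^ 2) (i j : Fin n) : |X i j| ≤ C * (ν i * ν j) := by
  have key : ∀ x y : ℝ, 0 ≤ x ^ 2 * X i i + 2 * (x * y) * X i j + y ^ 2 * X j j := by
    intro x y
    have h1 := hp (x • Pi.single i 1 + y • Pi.single j 1)
    simp only [mulVec_add, mulVec_smul, dotProduct_add, add_dotProduct, smul_dotProduct,
      dotProduct_smul, mulVec_single_one, single_one_dotProduct, Matrix.col_apply, smul_eq_mul]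
        at h1
    rw [hX j i] at h1
    linarith
  have hpos := mul_pos (hν i) (hν j)
  have e1 := key (ν j) (ν i)
  have e2 := key (ν j) (-ν i)
  have d1 := mul_le_mul_of_nonneg_left (hd i) (sq_nonneg (ν j))
  have d2 := mul_le_mul_of_nonneg_left (hd j) (sq_nonneg (ν i))
  rw [abs_le]
  constructor
  · refine le_of_mul_le_mul_left ?_ hpos
    linarith
  · refine le_of_mul_le_mul_left ?_ hpos
    linarith

namespace MAdm

variable {K m₀ Λ : ℝ} {A : Matrix (Fin n) (Fin n) ℝ}

theorem one_lt (h : MAdm K m₀ Λ A) : 1 < mS A := by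
  obtain ⟨O, lam, hd, ha⟩ := h
  rw [hd.mS_eq]; exact ha.sum_pos

theorem lt_sig (h : MAdm K m₀ Λ A) : mS A - 1 < mSig A := by
  obtain ⟨O, lam, hd, ha⟩ := h
  rw [hd.mS_eq, hd.mSig_eq]; exact ha.sig_gt

theorem sig_pos (h : MAdm K m₀ Λ A) : 0 < mSig A := by linarith [h.one_lt, h.lt_sig]

theorem isSymm (h : MAdm K m₀ Λ A) (i j : Fin n) : A i j = A j i := by
  obtain ⟨O, lam, hd, -⟩ := h
  exact congrFun (congrFun hd.isSymm j) i

theorem sum_sq_mulVec_le (h : MAdm K m₀ Λ A) (v : Fin n → ℝ) :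
    ∑ i, ((A *ᵥ v) i) ^ 2 ≤ ((K + 1) * mS A) ^ 2 * ∑ i, v i ^ 2 := by
  obtain ⟨O, lam, hd, ha⟩ := h
  rw [hd.mS_eq]; exact hd.sum_sq_mulVec_le ha.abs_eig_le v

theorem abs_entry_le (h : MAdm K m₀ Λ A) (i j : Fin n) : |A i j| ≤ (K + 1) * mS A := by
  obtain ⟨O, lam, hd, ha⟩ := h
  rw [hd.mS_eq]; exact hd.abs_entry_le ha.abs_eig_le i j

theorem abs_P_entry_le (h : MAdm K m₀ Λ A) (i j : Fin n) : |mP A i j| ≤ (K + 2) * mS A := by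
  obtain ⟨O, lam, hd, ha⟩ := h
  rw [hd.mS_eq]
  refine hd.mP_diag.abs_entry_le (fun i => ?_) i j
  have h1 := ha.one_lt_e i
  have h2 := ha.lower i
  have h3 := ha.sum_pos
  have h4 := mul_nonneg ha.K_nonneg (sub_nonneg.2 h3.le)
  rw [abs_le]; constructor <;> linarith [ha.K_nonneg]

theorem F_nonneg (h : MAdm K m₀ Λ A) (v : Fin n → ℝ) : 0 ≤ v ⬝ᵥ (mF A *ᵥ v) := by
  obtain ⟨O, lam, hd, ha⟩ := h
  rw [hd.mF_diag.quad]
  exact sum_nonneg fun i _ => mul_nonneg (ha.F_pos i).le (sq_nonneg _)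

theorem F_ge (n : ℕ) {m₀ : ℝ} (hm : 0 < m₀) : ∃ c > 0, ∀ (K Λ : ℝ) (A : Matrix (Fin n) (Fin n) ℝ),
    MAdm K m₀ Λ A → 2 ≤ mS A → ∀ v : Fin n → ℝ, c * ∑ i, v i ^ 2 ≤ mS A * (v ⬝ᵥ (mF A *ᵥ v)) := by
  obtain ⟨c, hc, key⟩ := Adm.F_ge_inv n hm
  refine ⟨c, hc, ?_⟩
  rintro K Λ A ⟨O, lam, hd, ha⟩ hs v
  rw [hd.mS_eq] at hs ⊢
  rw [hd.mF_diag.quad, ← hd.norm_sq v, mul_sum, mul_sum]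
  refine sum_le_sum fun i _ => ?_
  have := mul_le_mul_of_nonneg_right (key K Λ lam ha hs i) (sq_nonneg ((Oᵀ *ᵥ v) i))
  linarith

theorem F_le (h : MAdm K m₀ Λ A) (hs : 2 ≤ mS A) (v : Fin n → ℝ) :
    v ⬝ᵥ (mF A *ᵥ v) ≤ (1 + K) ^ 2 * mSig A * ∑ i, v i ^ 2 := by
  obtain ⟨O, lam, hd, ha⟩ := h
  rw [hd.mS_eq] at hs
  rw [hd.mF_diag.quad, ← hd.norm_sq v, hd.mSig_eq, mul_sum]
  exact sum_le_sum fun i _ => mul_le_mul_of_nonneg_right (ha.F_le hs i) (sq_nonneg _)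

theorem F_cross (h : MAdm K m₀ Λ A) {ε : ℝ} (hε : 0 < ε) (v w : Fin n → ℝ) :
    2 * |v ⬝ᵥ (mF A *ᵥ w)| ≤ ε * (v ⬝ᵥ (mF A *ᵥ v)) + ε⁻¹ * (w ⬝ᵥ (mF A *ᵥ w)) := by
  have hsym : w ⬝ᵥ (mF A *ᵥ v) = v ⬝ᵥ (mF A *ᵥ w) := by
    obtain ⟨O, lam, hd, -⟩ := h
    rw [dotProduct_mulVec, ← mulVec_transpose, hd.mF_diag.isSymm, dotProduct_comm]
  have key : ∀ x : ℝ, 0 ≤ x ^ 2 * (v ⬝ᵥ (mF A *ᵥ v)) + 2 * x * (v ⬝ᵥ (mF A *ᵥ w))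
      + w ⬝ᵥ (mF A *ᵥ w) := by
    intro x
    have := h.F_nonneg (x • v + w)
    simp only [mulVec_add, mulVec_smul, dotProduct_add, add_dotProduct, smul_dotProduct,
      dotProduct_smul, smul_eq_mul, hsym] at this
    linarith
  have e1 := mul_le_mul_of_nonneg_left (key ε) (inv_pos.2 hε).le
  have e2 := mul_le_mul_of_nonneg_left (key (-ε)) (inv_pos.2 hε).le
  have e3 : ε⁻¹ * ε = 1 := inv_mul_cancel₀ hε.ne'
  have e4 : ε⁻¹ * ε ^ 2 = ε := by rw [sq, ← mul_assoc, e3, one_mul]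
  have r1 : ε⁻¹ * (ε ^ 2 * (v ⬝ᵥ (mF A *ᵥ v)) + 2 * ε * (v ⬝ᵥ (mF A *ᵥ w)) + w ⬝ᵥ (mF A *ᵥ w))
      = (ε⁻¹ * ε ^ 2) * (v ⬝ᵥ (mF A *ᵥ v)) + 2 * (ε⁻¹ * ε) * (v ⬝ᵥ (mF A *ᵥ w))
        + ε⁻¹ * (w ⬝ᵥ (mF A *ᵥ w)) := by ring
  have r2 : ε⁻¹ * ((-ε) ^ 2 * (v ⬝ᵥ (mF A *ᵥ v)) + 2 * (-ε) * (v ⬝ᵥ (mF A *ᵥ w))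
      + w ⬝ᵥ (mF A *ᵥ w)) = (ε⁻¹ * ε ^ 2) * (v ⬝ᵥ (mF A *ᵥ v))
        - 2 * (ε⁻¹ * ε) * (v ⬝ᵥ (mF A *ᵥ w)) + ε⁻¹ * (w ⬝ᵥ (mF A *ᵥ w)) := by ring
  rw [r1, e3, e4] at e1
  rw [r2, e3, e4] at e2
  rcases abs_cases (v ⬝ᵥ (mF A *ᵥ w)) with ⟨h, -⟩ | ⟨h, -⟩ <;> rw [h] <;> linarith

theorem P_mulVec_le (n : ℕ) {m₀ : ℝ} (hm : 0 < m₀) : ∃ C > 0,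
    ∀ (K Λ : ℝ) (A : Matrix (Fin n) (Fin n) ℝ), MAdm K m₀ Λ A → 2 ≤ mS A → ∀ b w : Fin n → ℝ,
      (w ⬝ᵥ (mP A *ᵥ b)) ^ 2 ≤ C * (∑ i, w i ^ 2) * (mSig A * (b ⬝ᵥ (mF A *ᵥ b))) := by
  obtain ⟨C, hC, key⟩ := Adm.e_sq_le n hm
  refine ⟨4 * C, by positivity, ?_⟩
  rintro K Λ A ⟨O, lam, hd, ha⟩ hs b w
  rw [hd.mS_eq] at hs
  have h1 : (w ⬝ᵥ (mP A *ᵥ b)) ^ 2 ≤ (∑ i, w i ^ 2) * ∑ i, ((mP A *ᵥ b) i) ^ 2 :=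
    sum_mul_sq_le_sq_mul_sq _ _ _
  refine h1.trans ?_
  have h2 : ∑ i, ((mP A *ᵥ b) i) ^ 2 ≤ 4 * C * (mSig A * (b ⬝ᵥ (mF A *ᵥ b))) := by
    rw [hd.mP_diag.norm_mulVec, hd.mF_diag.quad, hd.mSig_eq, mul_sum, mul_sum]
    refine sum_le_sum fun i _ => ?_
    have e1 := ha.one_lt_e i
    have e2 : (es lam + 1 - lam i) ^ 2 ≤ 4 * (es lam - lam i) ^ 2 := by nlinarith
    have e3 := mul_le_mul_of_nonneg_right (e2.trans (mul_le_mul_of_nonneg_left (key K Λ lam ha hs i)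
      (by norm_num))) (sq_nonneg ((Oᵀ *ᵥ b) i))
    linarith
  have := mul_le_mul_of_nonneg_left h2 (sum_nonneg fun i (_ : i ∈ univ) => sq_nonneg (w i))
  linarith

theorem det_shift_pos (h : MAdm K m₀ Λ A) :
    0 < (A + (K + 1) • (1 : Matrix (Fin n) (Fin n) ℝ)).det := by
  obtain ⟨O, lam, hd, ha⟩ := h
  rw [(hd.add_smul_one (K + 1)).det_eq]
  exact prod_pos fun i _ => by linarith [ha.lower i]

theorem shift_ge (h : MAdm K m₀ Λ A) (v : Fin n → ℝ) :
    ∑ i, v i ^ 2 ≤ v ⬝ᵥ ((A + (K + 1) • (1 : Matrix (Fin n) (Fin n) ℝ)) *ᵥ v) := by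
  obtain ⟨O, lam, hd, ha⟩ := h
  rw [(hd.add_smul_one (K + 1)).quad, ← hd.norm_sq v]
  exact sum_le_sum fun i _ => le_mul_of_one_le_left (sq_nonneg _) (by linarith [ha.lower i])

theorem det_shift_le (hn : 3 ≤ n) {K m₀ Λ : ℝ} (hK : 0 ≤ K) (hΛ : 0 < Λ) : ∃ C > 0,
    ∀ A : Matrix (Fin n) (Fin n) ℝ, MAdm K m₀ Λ A → 2 ≤ mS A →
      (A + (K + 1) • (1 : Matrix (Fin n) (Fin n) ℝ)).det ≤ C * mSig A := by
  obtain ⟨C, hC, key⟩ := Adm.prod_le (m₀ := m₀) n hn hK hΛ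
  refine ⟨C, hC, ?_⟩
  rintro A ⟨O, lam, hd, ha⟩ hs
  rw [hd.mS_eq] at hs
  rw [(hd.add_smul_one (K + 1)).det_eq, hd.mSig_eq]
  exact key lam ha hs

theorem trace_F_shift_sq_le (n : ℕ) {K m₀ Λ : ℝ} (hK : 0 ≤ K) (hΛ : 0 < Λ) : ∃ C > 0,
    ∀ A : Matrix (Fin n) (Fin n) ℝ, MAdm K m₀ Λ A → 2 ≤ mS A →
      (mF A * ((A + (K + 1) • (1 : Matrix (Fin n) (Fin n) ℝ)) *
        (A + (K + 1) • (1 : Matrix (Fin n) (Fin n) ℝ)))).trace ≤ C * mSig A := by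
  obtain ⟨C, hC, key⟩ := Adm.sq_mul_F_le (m₀ := m₀) n hK hΛ
  refine ⟨(n + 1) * (2 * (K + 2) ^ 2 * C), by positivity, ?_⟩
  rintro A ⟨O, lam, hd, ha⟩ hs
  rw [hd.mS_eq] at hs
  rw [(hd.add_smul_one (K + 1)).mul_self, hd.mF_diag.eq, hd.mF_diag.conj_mul, hd.trace_conj,
    diagonal_mul_diagonal, trace_diagonal, hd.mSig_eq]
  have hσ := ha.sig_pos
  calc ∑ i, eF lam i * (lam i + (K + 1)) ^ 2 ≤ ∑ _i : Fin n, 2 * (K + 2) ^ 2 * C * esig lam := by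
        refine sum_le_sum fun i _ => ?_
        have h1 : (lam i + (K + 1)) ^ 2 ≤ 2 * (K + 2) ^ 2 * (1 + lam i ^ 2) := by
          nlinarith [sq_nonneg (lam i - (K + 1)), mul_nonneg (mul_nonneg hK hK) (sq_nonneg (lam i)),
            mul_nonneg hK (sq_nonneg (lam i)), sq_nonneg (lam i)]
        have h2 := mul_le_mul_of_nonneg_left h1 (ha.F_pos i).le
        have h3 := mul_le_mul_of_nonneg_left (key lam ha hs i)
          (by positivity : (0:ℝ) ≤ 2 * (K + 2) ^ 2)
        linarith
    _ = n * (2 * (K + 2) ^ 2 * C * esig lam) := by simp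
    _ ≤ _ := by
        have : 0 ≤ 2 * (K + 2) ^ 2 * C * esig lam := by positivity
        linarith

theorem det_le_of_trace_le (n : ℕ) {K m₀ Λ : ℝ} (hm : 0 < m₀) (hK : 0 ≤ K) {C₀ : ℝ} (hC₀ : 0 < C₀) :
    ∃ C > 0, ∀ A : Matrix (Fin n) (Fin n) ℝ, MAdm K m₀ Λ A →
      ∀ H : Matrix (Fin n) (Fin n) ℝ, (∀ i j, H i j = H j i) → (∀ v, 0 ≤ v ⬝ᵥ (H *ᵥ v)) →
      (mF A * H).trace ≤ C₀ * mSig A →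
      |H.det| ≤ C * (A + (K + 1) • (1 : Matrix (Fin n) (Fin n) ℝ)).det ^ 2 := by
  obtain ⟨C₁, hC₁, key⟩ := Adm.sig_le_F_mul n hm
  obtain ⟨C₂, hC₂⟩ : ∃ x, x = C₀ * C₁ * (2 * (K + 2) ^ 2) := ⟨_, rfl⟩
  have hC₂' : 0 < C₂ := by rw [hC₂]; positivity
  refine ⟨n.factorial * C₂ ^ n, by positivity, ?_⟩
  rintro A ⟨O, lam, hd, ha⟩ H hH hp htr
  rw [(hd.add_smul_one (K + 1)).det_eq]
  obtain ⟨X, hX⟩ : ∃ X, X = Oᵀ * H * O := ⟨_, rfl⟩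
  have hdet : H.det = X.det := by
    have := hd.conj_eq H
    rw [← hX] at this
    rw [this, Matrix.mul_assoc, Matrix.det_mul_comm, Matrix.mul_assoc, hd.left, Matrix.mul_one]
  have hXs : ∀ i j, X i j = X j i := by
    have h1 : Hᵀ = H := by ext i j; exact hH j i
    have h2 : Xᵀ = X := by
      rw [hX]; simp [Matrix.transpose_mul, h1, Matrix.mul_assoc]
    exact fun i j => congrFun (congrFun h2 j) i
  have hXp : ∀ v, 0 ≤ v ⬝ᵥ (X *ᵥ v) := by
    intro v
    have := hp (O *ᵥ v)
    rw [hX, ← Matrix.mulVec_mulVec, ← Matrix.mulVec_mulVec, dotProduct_mulVec, vecMul_transpose]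
    exact this
  have hν : ∀ i, 1 ≤ lam i + (K + 1) := fun i => by linarith [ha.lower i]
  have hXd : ∀ i, 0 ≤ X i i := fun i => by
    have := hXp (Pi.single i 1)
    simpa using this
  rw [hd.mF_diag.trace_mul_eq, ← hX, hd.mSig_eq] at htr
  rw [hdet]
  refine det_le_of_entries (abs_entry_le_of_psd hXs hXp (fun i => by linarith [hν i]) fun i => ?_)
  have hF := ha.F_pos i
  have h1 : eF lam i * X i i ≤ C₀ * esig lam :=
    (single_le_sum (f := fun i => eF lam i * X i i)
      (fun i _ => mul_nonneg (ha.F_pos i).le (hXd i)) (mem_univ i)).trans htr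
  have h2 := mul_le_mul_of_nonneg_left (key K Λ lam ha i) hC₀.le
  have h3 : eF lam i * X i i ≤ eF lam i * (C₀ * C₁ * (1 + lam i ^ 2)) := by linarith
  have h4 := le_of_mul_le_mul_left h3 hF
  have h5 : 1 + lam i ^ 2 ≤ 2 * (K + 2) ^ 2 * (lam i + (K + 1)) ^ 2 := by
    have e1 := hν i
    have e2 : |lam i| ≤ (K + 2) * (lam i + (K + 1)) := by
      have := mul_nonneg (by linarith : 0 ≤ K + 1) (sub_nonneg.2 e1)
      rw [abs_le]; constructor <;> linarith
    have e3 : lam i ^ 2 ≤ ((K + 2) * (lam i + (K + 1))) ^ 2 := by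
      rw [← sq_abs]; exact pow_le_pow_left₀ (abs_nonneg _) e2 2
    have e4 : 1 ≤ ((K + 2) * (lam i + (K + 1))) ^ 2 :=
      one_le_pow₀ (by nlinarith)
    linarith
  rw [hC₂]
  have := mul_le_mul_of_nonneg_left h5 (by positivity : 0 ≤ C₀ * C₁)
  linarith

end MAdm

end MatrixForm

section Calculus

open Finset Matrix MeasureTheory

variable {n : ℕ}

/-! ### Partial derivatives -/

abbrev Eu (n : ℕ) := EuclideanSpace ℝ (Fin n)

/-- The `i`-th partial derivative. -/
def pd (i : Fin n) (g : Eu n → ℝ) (x : Eu n) : ℝ := fderiv ℝ g x (EuclideanSpace.single i 1)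

section

variable {f g : Eu n → ℝ} {x : Eu n} (i : Fin n)

theorem pd_const (c : ℝ) : pd i (fun _ : Eu n => c) x = 0 := by simp [pd]

theorem pd_add (hf : DifferentiableAt ℝ f x) (hg : DifferentiableAt ℝ g x) :
    pd i (fun y => f y + g y) x = pd i f x + pd i g x := by
  simp [pd, fderiv_fun_add hf hg]

theorem pd_sub (hf : DifferentiableAt ℝ f x) (hg : DifferentiableAt ℝ g x) :
    pd i (fun y => f y - g y) x = pd i f x - pd i g x := by
  simp [pd, fderiv_fun_sub hf hg]

theorem pd_mul (hf : DifferentiableAt ℝ f x) (hg : DifferentiableAt ℝ g x) :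
    pd i (fun y => f y * g y) x = pd i f x * g x + f x * pd i g x := by
  simp [pd, fderiv_fun_mul hf hg]; ring

theorem pd_const_mul (c : ℝ) (hf : DifferentiableAt ℝ f x) :
    pd i (fun y => c * f y) x = c * pd i f x := by
  simp [pd, fderiv_const_mul hf]

theorem pd_sum {ι : Type*} {S : Finset ι} {f : ι → Eu n → ℝ}
    (hf : ∀ a ∈ S, DifferentiableAt ℝ (f a) x) :
    pd i (fun y => ∑ a ∈ S, f a y) x = ∑ a ∈ S, pd i (f a) x := by
  simp [pd, fderiv_fun_sum hf]

theorem pd_comp {Φ : ℝ → ℝ} (hΦ : DifferentiableAt ℝ Φ (f x)) (hf : DifferentiableAt ℝ f x) :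
    pd i (fun y => Φ (f y)) x = deriv Φ (f x) * pd i f x := by
  have := fderiv_fun_comp x hΦ hf
  rw [pd, this]
  simp [pd, fderiv_eq_smul_deriv, mul_comm]

end

theorem fderiv_eq_sum (g : Eu n → ℝ) (x v : Eu n) : fderiv ℝ g x v = ∑ i, v i * pd i g x := by
  have : v = ∑ i, v i • (EuclideanSpace.single i (1 : ℝ) : Eu n) := by
    ext j; simp [Finset.sum_apply, Pi.single_apply]
  conv_lhs => rw [this]
  simp [pd]

theorem contDiff_pd {k m : WithTop ℕ∞} {g : Eu n → ℝ} (hg : ContDiff ℝ k g) (hm : m + 1 ≤ k)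
    (i : Fin n) : ContDiff ℝ m (pd i g) :=
  (hg.fderiv_right hm).clm_apply contDiff_const

theorem pd_comm {g : Eu n → ℝ} (hg : ContDiff ℝ 2 g) (i j : Fin n) (x : Eu n) :
    pd i (pd j g) x = pd j (pd i g) x := by
  have h1 : DifferentiableAt ℝ (fderiv ℝ g) x :=
    (hg.fderiv_right (m := 1) (by norm_num)).differentiable (by norm_num) x
  have key : ∀ i j : Fin n, pd i (pd j g) x = fderiv ℝ (fderiv ℝ g) x
      (EuclideanSpace.single i 1) (EuclideanSpace.single j 1) := by
    intro i j
    have : pd j g = fun y => fderiv ℝ g y (EuclideanSpace.single j 1) := rfl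
    rw [this, pd, fderiv_clm_apply h1 (by fun_prop)]
    simp
  rw [key, key]
  exact (hg.contDiffAt.isSymmSndFDerivAt (by simp)) _ _

theorem HasCompactSupport.pd {g : Eu n → ℝ} (hg : HasCompactSupport g) (i : Fin n) :
    HasCompactSupport (pd i g) := hg.fderiv_apply ℝ _

theorem tsupport_pd_subset (g : Eu n → ℝ) (i : Fin n) : tsupport (pd i g) ⊆ tsupport g :=
  tsupport_fderiv_apply_subset ℝ _

theorem integral_pd_eq_zero {g : Eu n → ℝ} (hg : ContDiff ℝ 1 g) (hc : HasCompactSupport g)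
    (i : Fin n) : ∫ x, pd i g x = 0 := by
  have hd := contDiff_pd (m := 0) hg (by norm_num) i
  have := integral_mul_fderiv_eq_neg_fderiv_mul_of_integrable (μ := (volume : Measure (Eu n)))
    (f := fun _ => (1 : ℝ)) (g := g) (v := EuclideanSpace.single i 1) (by simp)
    (by simp only [one_mul]; exact hd.continuous.integrable_of_hasCompactSupport (hc.pd i))
    (by simp only [one_mul]; exact hg.continuous.integrable_of_hasCompactSupport hc)
    (fun x _ => by fun_prop) (fun x _ => hg.differentiable (by norm_num) x)
  simpa [pd] using this

/-- Integration by parts against a matrix field with divergence-free rows. -/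
theorem integral_divFree {M : Eu n → Matrix (Fin n) (Fin n) ℝ} {η : Eu n → ℝ}
    {w : Fin n → Eu n → ℝ} (hM : ∀ i j, ContDiff ℝ 1 fun x => M x i j)
    (hdiv : ∀ x j, ∑ i, pd i (fun y => M y i j) x = 0) (hη : ContDiff ℝ 1 η)
    (hc : HasCompactSupport η) (hw : ∀ j, ContDiff ℝ 1 (w j)) :
    ∫ x, η x * ∑ i, ∑ j, M x i j * pd i (w j) x = -∫ x, ∑ i, ∑ j, M x i j * pd i η x * w j x := by
  have hcw := fun j => (hw j).continuous
  have hcM := fun i j => (hM i j).continuous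
  have hcη := hη.continuous
  have hcpη := fun i => (contDiff_pd (m := 0) hη (by norm_num) i).continuous
  have hcpw := fun i j => (contDiff_pd (m := 0) (hw j) (by norm_num) i).continuous
  have h0 : ∫ x, ∑ i, pd i (fun y => ∑ j, η y * (M y i j * w j y)) x = 0 := by
    have hg : ∀ i, ContDiff ℝ 1 fun y => ∑ j, η y * (M y i j * w j y) := fun i =>
      ContDiff.sum fun j _ => hη.mul ((hM i j).mul (hw j))
    have hs : ∀ i, HasCompactSupport fun y => ∑ j, η y * (M y i j * w j y) := fun i => by
      have : (fun y => ∑ j, η y * (M y i j * w j y)) = η * fun y => ∑ j, M y i j * w j y := by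
        ext y; simp [mul_sum]
      rw [this]; exact hc.mul_right
    rw [integral_finsetSum]
    · exact sum_eq_zero fun i _ => integral_pd_eq_zero (hg i) (hs i) i
    · exact fun i _ => (contDiff_pd (m := 0) (hg i) (by norm_num) i).continuous
        |>.integrable_of_hasCompactSupport ((hs i).pd i)
  have h1 : ∀ x, ∑ i, pd i (fun y => ∑ j, η y * (M y i j * w j y)) x =
      η x * ∑ i, ∑ j, M x i j * pd i (w j) x + ∑ i, ∑ j, M x i j * pd i η x * w j x := by
    intro x
    have dη := hη.differentiable (by norm_num) x
    have dM := fun i j => (hM i j).differentiable (by norm_num) x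
    have dw := fun j => (hw j).differentiable (by norm_num) x
    have e1 : ∀ i, pd i (fun y => ∑ j, η y * (M y i j * w j y)) x =
        (η x * ∑ j, M x i j * pd i (w j) x + ∑ j, M x i j * pd i η x * w j x) +
          ∑ j, η x * w j x * pd i (fun y => M y i j) x := by
      intro i
      have d2 : ∀ j, DifferentiableAt ℝ (fun y => M y i j * w j y) x :=
        fun j => (dM i j).mul (dw j)
      have d3 : ∀ j, DifferentiableAt ℝ (fun y => η y * (M y i j * w j y)) x :=
        fun j => dη.mul (d2 j)
      rw [pd_sum (f := fun j y => η y * (M y i j * w j y)) i fun j _ => d3 j, mul_sum,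
        ← sum_add_distrib, ← sum_add_distrib]
      refine sum_congr rfl fun j _ => ?_
      have e2 := pd_mul i dη (d2 j)
      have e3 := pd_mul i (dM i j) (dw j)
      rw [e2, e3]; ring
    have e4 : ∑ i, ∑ j, η x * w j x * pd i (fun y => M y i j) x = 0 := by
      rw [sum_comm]
      refine sum_eq_zero fun j _ => ?_
      rw [← mul_sum, hdiv, mul_zero]
    rw [sum_congr rfl fun i _ => e1 i, sum_add_distrib, sum_add_distrib, e4, ← mul_sum, add_zero]
  simp only [h1] at h0
  rw [integral_add] at h0
  · linarith
  · refine Continuous.integrable_of_hasCompactSupport (by fun_prop) ?_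
    exact hc.mul_right
  · refine Continuous.integrable_of_hasCompactSupport (by fun_prop) ?_
    refine hc.mono' (Function.support_subset_iff'.2 fun x hx => ?_)
    refine sum_eq_zero fun i _ => sum_eq_zero fun j _ => ?_
    have : pd i η x = 0 := image_eq_zero_of_notMem_tsupport fun h => hx (tsupport_pd_subset η i h)
    rw [this]; ring

end Calculus

section MatrixField

open Finset Matrix MeasureTheory

variable {n : ℕ}

/-! ### Matrix fields -/

/-- Entrywise differentiability of a matrix field. -/
def MDiff (M : Eu n → Matrix (Fin n) (Fin n) ℝ) (x : Eu n) : Prop :=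
  ∀ i j, DifferentiableAt ℝ (fun y => M y i j) x

/-- The entrywise partial derivative of a matrix field. -/
def pdM (k : Fin n) (M : Eu n → Matrix (Fin n) (Fin n) ℝ) (x : Eu n) : Matrix (Fin n) (Fin n) ℝ :=
  Matrix.of fun i j => pd k (fun y => M y i j) x

theorem pdM_apply (k : Fin n) (M : Eu n → Matrix (Fin n) (Fin n) ℝ) (x : Eu n) (i j : Fin n) :
    pdM k M x i j = pd k (fun y => M y i j) x := rfl

namespace MDiff

variable {M N : Eu n → Matrix (Fin n) (Fin n) ℝ} {f : Eu n → ℝ} {x : Eu n}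

theorem mul (hM : MDiff M x) (hN : MDiff N x) : MDiff (fun y => M y * N y) x := by
  intro i j
  have : (fun y => (M y * N y) i j) = fun y => ∑ l, M y i l * N y l j := by
    ext y; rw [Matrix.mul_apply]
  rw [this]
  exact DifferentiableAt.fun_sum fun l _ => (hM i l).mul (hN l j)

theorem add (hM : MDiff M x) (hN : MDiff N x) : MDiff (fun y => M y + N y) x :=
  fun i j => (hM i j).add (hN i j)

theorem sub (hM : MDiff M x) (hN : MDiff N x) : MDiff (fun y => M y - N y) x :=
  fun i j => (hM i j).sub (hN i j)

theorem smul (hf : DifferentiableAt ℝ f x) (hM : MDiff M x) : MDiff (fun y => f y • M y) x :=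
  fun i j => hf.mul (hM i j)

theorem const (A : Matrix (Fin n) (Fin n) ℝ) : MDiff (fun _ => A) x :=
  fun _ _ => differentiableAt_const _

theorem trace (hM : MDiff M x) : DifferentiableAt ℝ (fun y => (M y).trace) x :=
  DifferentiableAt.fun_sum fun l _ => hM l l

theorem pdM_mul (hM : MDiff M x) (hN : MDiff N x) (k : Fin n) :
    pdM k (fun y => M y * N y) x = pdM k M x * N x + M x * pdM k N x := by
  ext i j
  have h1 : ∀ l, DifferentiableAt ℝ (fun y => M y i l * N y l j) x :=
    fun l => (hM i l).mul (hN l j)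
  have h2 : (fun y => (M y * N y) i j) = fun y => ∑ l, M y i l * N y l j := by
    ext y; rw [Matrix.mul_apply]
  rw [pdM_apply, h2, pd_sum (f := fun l y => M y i l * N y l j) k fun l _ => h1 l, Matrix.add_apply,
    Matrix.mul_apply, Matrix.mul_apply, ← sum_add_distrib]
  exact sum_congr rfl fun l _ => pd_mul k (hM i l) (hN l j)

theorem pdM_add (hM : MDiff M x) (hN : MDiff N x) (k : Fin n) :
    pdM k (fun y => M y + N y) x = pdM k M x + pdM k N x := by
  ext i j
  exact pd_add k (hM i j) (hN i j)

theorem pdM_sub (hM : MDiff M x) (hN : MDiff N x) (k : Fin n) :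
    pdM k (fun y => M y - N y) x = pdM k M x - pdM k N x := by
  ext i j
  exact pd_sub k (hM i j) (hN i j)

theorem pdM_smul (hf : DifferentiableAt ℝ f x) (hM : MDiff M x) (k : Fin n) :
    pdM k (fun y => f y • M y) x = pd k f x • M x + f x • pdM k M x := by
  ext i j
  exact pd_mul k hf (hM i j)

theorem pd_trace (hM : MDiff M x) (k : Fin n) :
    pd k (fun y => (M y).trace) x = (pdM k M x).trace :=
  pd_sum (f := fun l y => M y l l) k fun l _ => hM l l

end MDiff

theorem pdM_const (k : Fin n) (A : Matrix (Fin n) (Fin n) ℝ) (x : Eu n) :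
    pdM k (fun _ => A) x = 0 := by
  ext i j
  exact pd_const k _

section

variable {A : Eu n → Matrix (Fin n) (Fin n) ℝ} {x : Eu n}

theorem MDiff.mS (hA : MDiff A x) : DifferentiableAt ℝ (fun y => mS (A y)) x :=
  hA.trace.const_add _

theorem MDiff.mSig (hA : MDiff A x) : DifferentiableAt ℝ (fun y => mSig (A y)) x := by
  have h1 := hA.mS
  have h2 := (hA.mul hA).trace
  simp only [_root_.mSig]
  fun_prop

theorem MDiff.mF (hA : MDiff A x) : MDiff (fun y => mF (A y)) x :=
  ((MDiff.smul hA.mSig (MDiff.const 1)).sub (MDiff.smul hA.mS hA)).add (hA.mul hA)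

theorem pd_mS (hA : MDiff A x) (k : Fin n) : pd k (fun y => mS (A y)) x = (pdM k A x).trace := by
  have h := pd_add k (differentiableAt_const (1 : ℝ)) hA.trace
  rw [pd_const, zero_add, hA.pd_trace] at h
  exact h

theorem pd_trace_sq (hA : MDiff A x) (k : Fin n) :
    pd k (fun y => 1 + (A y * A y).trace) x = 2 * (A x * pdM k A x).trace := by
  have h := pd_add k (differentiableAt_const (1 : ℝ)) (hA.mul hA).trace
  rw [pd_const, zero_add, (hA.mul hA).pd_trace, hA.pdM_mul hA, trace_add,
    Matrix.trace_mul_comm (pdM k A x)] at h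
  rw [h]; ring

theorem pd_mSig (hA : MDiff A x) (k : Fin n) :
    pd k (fun y => mSig (A y)) x = mS (A x) * (pdM k A x).trace - (A x * pdM k A x).trace := by
  have d1 : DifferentiableAt ℝ (fun y => mS (A y) * mS (A y)) x := hA.mS.mul hA.mS
  have d2 : DifferentiableAt ℝ (fun y => 1 + (A y * A y).trace) x :=
    (hA.mul hA).trace.const_add _
  have d3 : DifferentiableAt ℝ
      (fun y => mS (A y) * mS (A y) - (1 + (A y * A y).trace)) x := d1.sub d2
  have h0 : (fun y => mSig (A y)) = fun y =>
      (1 / 2 : ℝ) * (mS (A y) * mS (A y) - (1 + (A y * A y).trace)) := by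
    ext y; rw [_root_.mSig]; ring
  rw [h0, pd_const_mul k _ d3, pd_sub k d1 d2, pd_mul k hA.mS hA.mS, pd_mS hA,
    pd_trace_sq hA]
  ring

theorem pd_mf (hA : MDiff A x) (k : Fin n) :
    pd k (fun y => mf (A y)) x = (mF (A x) * pdM k A x).trace := by
  have d0 : DifferentiableAt ℝ (fun y => mS (A y) * mS (A y)) x := hA.mS.mul hA.mS
  have d1 : DifferentiableAt ℝ (fun y => mS (A y) * (mS (A y) * mS (A y))) x := hA.mS.mul d0
  have d2 : DifferentiableAt ℝ (fun y => 1 + (A y * A y).trace) x :=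
    (hA.mul hA).trace.const_add _
  have d3 : DifferentiableAt ℝ (fun y => mS (A y) * (1 + (A y * A y).trace)) x := hA.mS.mul d2
  have d4 : DifferentiableAt ℝ (fun y => 3 * (mS (A y) * (1 + (A y * A y).trace))) x :=
    d3.const_mul _
  have d5 : DifferentiableAt ℝ (fun y => 1 + (A y * A y * A y).trace) x :=
    ((hA.mul hA).mul hA).trace.const_add _
  have d6 : DifferentiableAt ℝ (fun y => 2 * (1 + (A y * A y * A y).trace)) x := d5.const_mul _
  have d7 : DifferentiableAt ℝ (fun y => mS (A y) * (mS (A y) * mS (A y)) -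
      3 * (mS (A y) * (1 + (A y * A y).trace))) x := d1.sub d4
  have d8 : DifferentiableAt ℝ (fun y => (mS (A y) * (mS (A y) * mS (A y)) -
      3 * (mS (A y) * (1 + (A y * A y).trace))) + 2 * (1 + (A y * A y * A y).trace)) x := d7.add d6
  have h0 : (fun y => mf (A y)) = fun y => (1 / 6 : ℝ) * ((mS (A y) * (mS (A y) * mS (A y)) -
      3 * (mS (A y) * (1 + (A y * A y).trace))) + 2 * (1 + (A y * A y * A y).trace)) := by
    ext y; rw [mf]; ring
  have h5 : pd k (fun y => 1 + (A y * A y * A y).trace) x = 3 * (A x * A x * pdM k A x).trace := by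
    have h := pd_add k (differentiableAt_const (1 : ℝ)) ((hA.mul hA).mul hA).trace
    rw [pd_const, zero_add, ((hA.mul hA).mul hA).pd_trace, (hA.mul hA).pdM_mul hA,
      hA.pdM_mul hA, add_mul, trace_add, trace_add] at h
    have e1 : (pdM k A x * A x * A x).trace = (A x * A x * pdM k A x).trace := by
      rw [Matrix.mul_assoc, Matrix.trace_mul_comm]
    have e2 : (A x * pdM k A x * A x).trace = (A x * A x * pdM k A x).trace := by
      rw [Matrix.trace_mul_comm, ← Matrix.mul_assoc]
    rw [h, e1, e2]; ring
  rw [h0, pd_const_mul k _ d8, pd_add k d7 d6, pd_sub k d1 d4, pd_mul k hA.mS d0,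
    pd_mul k hA.mS hA.mS, pd_const_mul k _ d3, pd_mul k hA.mS d2, pd_const_mul k _ d5, h5,
    pd_trace_sq hA, pd_mS hA, mF, add_mul, sub_mul, trace_add, trace_sub, smul_mul_assoc,
    smul_mul_assoc, one_mul, trace_smul, trace_smul, smul_eq_mul, smul_eq_mul, mSig]
  ring

theorem pdM_mF (hA : MDiff A x) (k : Fin n) : pdM k (fun y => mF (A y)) x =
    (mS (A x) * (pdM k A x).trace - (A x * pdM k A x).trace) • (1 : Matrix (Fin n) (Fin n) ℝ)
      - (pdM k A x).trace • A x - mS (A x) • pdM k A x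
      + (pdM k A x * A x + A x * pdM k A x) := by
  have d1 : MDiff (fun y => mSig (A y) • (1 : Matrix (Fin n) (Fin n) ℝ)) x :=
    MDiff.smul hA.mSig (MDiff.const 1)
  have d2 : MDiff (fun y => mS (A y) • A y) x := MDiff.smul hA.mS hA
  have h := (d1.sub d2).pdM_add (hA.mul hA) k
  rw [d1.pdM_sub d2, MDiff.pdM_smul hA.mSig (MDiff.const 1), MDiff.pdM_smul hA.mS hA,
    hA.pdM_mul hA, pdM_const, smul_zero, add_zero, pd_mSig hA, pd_mS hA] at h
  have h0 : pdM k (fun y => mF (A y)) x = pdM k (fun y =>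
    mSig (A y) • (1 : Matrix (Fin n) (Fin n) ℝ) - mS (A y) • A y + A y * A y) x := rfl
  rw [h0, h, sub_sub]

theorem pdM_mP (hA : MDiff A x) (k : Fin n) : pdM k (fun y => mP (A y)) x =
    (pdM k A x).trace • (1 : Matrix (Fin n) (Fin n) ℝ) - pdM k A x := by
  have dS : DifferentiableAt ℝ (fun y => mS (A y) + 1) x := hA.mS.add_const _
  have d1 : MDiff (fun y => (mS (A y) + 1) • (1 : Matrix (Fin n) (Fin n) ℝ)) x :=
    MDiff.smul dS (MDiff.const 1)
  have h := d1.pdM_sub hA k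
  rw [MDiff.pdM_smul dS (MDiff.const 1), pdM_const, smul_zero, add_zero,
    pd_add k hA.mS (differentiableAt_const _), pd_mS hA, pd_const, add_zero] at h
  exact h

theorem trace_pdM_mF_mul (hA : MDiff A x) (k : Fin n) :
    (pdM k (fun y => mF (A y)) x * pdM k A x).trace = mQf (A x) (pdM k A x) := by
  have e : (pdM k A x * A x * pdM k A x).trace = (A x * (pdM k A x * pdM k A x)).trace := by
    rw [Matrix.mul_assoc, Matrix.trace_mul_comm, Matrix.mul_assoc]
  rw [pdM_mF hA, add_mul, sub_mul, sub_mul, add_mul, smul_mul_assoc, smul_mul_assoc,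
    smul_mul_assoc, one_mul, trace_add, trace_sub, trace_sub, trace_add, trace_smul, trace_smul,
    trace_smul, e, mQf, Matrix.mul_assoc (A x)]
  simp only [smul_eq_mul]; ring

end

theorem trace_mP_mul (A : Matrix (Fin n) (Fin n) ℝ) : (mP A * A).trace = 2 * mSig A := by
  rw [mP, sub_mul, trace_sub, smul_mul_assoc, one_mul, trace_smul, mSig, smul_eq_mul]
  have : A.trace = mS A - 1 := by rw [mS]; ring
  rw [this]; ring

/-! ### The Hessian of a `C⁴` function -/

section Hessian

variable {u : Eu n → ℝ}

theorem contDiff_hess (hu : ContDiff ℝ 4 u) (i j : Fin n) : ContDiff ℝ 2 fun x => hess u x i j :=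
  contDiff_pd (m := 2) (contDiff_pd (m := 3) hu (by norm_num) j) (by norm_num) i

theorem mDiff_hess (hu : ContDiff ℝ 4 u) (x : Eu n) : MDiff (hess u) x :=
  fun i j => (contDiff_hess hu i j).differentiable (by norm_num) x

theorem mDiff_pdM_hess (hu : ContDiff ℝ 4 u) (k : Fin n) (x : Eu n) : MDiff (pdM k (hess u)) x :=
  fun i j => (contDiff_pd (m := 1) (contDiff_hess hu i j) (by norm_num) k).differentiable
    (by norm_num) x

theorem hess_symm (hu : ContDiff ℝ 2 u) (x : Eu n) (i j : Fin n) : hess u x i j = hess u x j i :=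
  pd_comm hu i j x

theorem pdM_hess_symm (hu : ContDiff ℝ 4 u) (x : Eu n) (k i j : Fin n) :
    pdM k (hess u) x i j = pdM k (hess u) x j i := by
  have : (fun y => hess u y i j) = fun y => hess u y j i :=
    funext fun y => hess_symm (hu.of_le (by norm_num)) y i j
  rw [pdM_apply, this, pdM_apply]

theorem pdM_hess_swap (hu : ContDiff ℝ 4 u) (x : Eu n) (k i j : Fin n) :
    pdM k (hess u) x i j = pdM i (hess u) x k j :=
  pd_comm (contDiff_pd (m := 2) hu (by norm_num) j) k i x

theorem contDiff_mS_hess (hu : ContDiff ℝ 4 u) : ContDiff ℝ 2 fun x => mS (hess u x) :=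
  contDiff_const.add (ContDiff.sum fun i _ => contDiff_hess hu i i)

theorem contDiff_mul_hess (hu : ContDiff ℝ 4 u) (i j : Fin n) :
    ContDiff ℝ 2 fun x => (hess u x * hess u x) i j := by
  simp only [Matrix.mul_apply]
  exact ContDiff.sum fun l _ => (contDiff_hess hu i l).mul (contDiff_hess hu l j)

theorem contDiff_mSig_hess (hu : ContDiff ℝ 4 u) : ContDiff ℝ 2 fun x => mSig (hess u x) := by
  have h1 := contDiff_mS_hess hu
  have h2 : ContDiff ℝ 2 fun x => (hess u x * hess u x).trace :=
    ContDiff.sum fun i _ => contDiff_mul_hess hu i i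
  simp only [mSig]
  fun_prop

theorem contDiff_mF_hess (hu : ContDiff ℝ 4 u) (i j : Fin n) :
    ContDiff ℝ 2 fun x => mF (hess u x) i j :=
  (((contDiff_mSig_hess hu).mul contDiff_const).sub
    ((contDiff_mS_hess hu).mul (contDiff_hess hu i j))).add (contDiff_mul_hess hu i j)

theorem contDiff_mP_hess (hu : ContDiff ℝ 4 u) (i j : Fin n) :
    ContDiff ℝ 2 fun x => mP (hess u x) i j :=
  (((contDiff_mS_hess hu).add contDiff_const).mul contDiff_const).sub (contDiff_hess hu i j)

theorem contDiff_mf_hess (hu : ContDiff ℝ 4 u) : ContDiff ℝ 2 fun x => mf (hess u x) := by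
  have h1 := contDiff_mS_hess hu
  have h2 : ContDiff ℝ 2 fun x => (hess u x * hess u x).trace :=
    ContDiff.sum fun i _ => contDiff_mul_hess hu i i
  have h3 : ContDiff ℝ 2 fun x => (hess u x * hess u x * hess u x).trace := by
    refine ContDiff.sum fun i _ => ?_
    simp only [Matrix.diag_apply, Matrix.mul_apply (M := hess u _ * hess u _)]
    exact ContDiff.sum fun l _ => (contDiff_mul_hess hu i l).mul (contDiff_hess hu l i)
  simp only [mf]
  fun_prop

/-- The trace of the third derivatives. -/
theorem trace_pdM_hess (hu : ContDiff ℝ 4 u) (x : Eu n) (k : Fin n) :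
    (pdM k (hess u) x).trace = pd k (fun y => mS (hess u y)) x :=
  (pd_mS (mDiff_hess hu x) k).symm

theorem sum_pdM_hess (hu : ContDiff ℝ 4 u) (x : Eu n) (j : Fin n) :
    ∑ i, pdM i (hess u) x i j = (pdM j (hess u) x).trace := by
  refine sum_congr rfl fun i _ => ?_
  rw [pdM_hess_symm hu, pdM_hess_swap hu, diag_apply, pdM_hess_symm hu]

theorem sum_pd_mP_hess (hu : ContDiff ℝ 4 u) (x : Eu n) (j : Fin n) :
    ∑ i, pd i (fun y => mP (hess u y) i j) x = 0 := by
  have h : ∀ i, pd i (fun y => mP (hess u y) i j) x =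
      (pdM i (hess u) x).trace * (1 : Matrix (Fin n) (Fin n) ℝ) i j - pdM i (hess u) x i j := by
    intro i
    have := congrFun (congrFun (pdM_mP (mDiff_hess hu x) i) i) j
    exact this
  rw [sum_congr rfl fun i _ => h i, sum_sub_distrib, sum_pdM_hess hu]
  simp [Matrix.one_apply]

theorem sum_pd_mF_hess (hu : ContDiff ℝ 4 u) (x : Eu n) (j : Fin n) :
    ∑ i, pd i (fun y => mF (hess u y) i j) x = 0 := by
  obtain ⟨A, hA⟩ : ∃ A, A = hess u x := ⟨_, rfl⟩
  obtain ⟨B, hB⟩ : ∃ B : Fin n → Matrix (Fin n) (Fin n) ℝ, B = fun i => pdM i (hess u) x :=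
    ⟨_, rfl⟩
  have hB1 : ∀ k i j, B k i j = B k j i := by subst hB; exact fun k i j => pdM_hess_symm hu x k i j
  have hB2 : ∀ k i j, B k i j = B i k j := by subst hB; exact fun k i j => pdM_hess_swap hu x k i j
  have hB3 : ∀ j, ∑ i, B i i j = (B j).trace := by subst hB; exact fun j => sum_pdM_hess hu x j
  have h : ∀ i, pd i (fun y => mF (hess u y) i j) x =
      (mS A * (B i).trace - (A * B i).trace) * (1 : Matrix (Fin n) (Fin n) ℝ) i j
      - (B i).trace * A i j - mS A * B i i j + ((B i * A) i j + (A * B i) i j) := by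
    intro i
    have := congrFun (congrFun (pdM_mF (mDiff_hess hu x) i) i) j
    subst hA hB
    exact this
  have e1 : ∑ i, (B i * A) i j = ∑ i, (B i).trace * A i j := by
    simp only [Matrix.mul_apply]
    rw [sum_comm]
    exact sum_congr rfl fun l _ => by rw [← sum_mul, hB3]
  have e2 : ∑ i, (A * B i) i j = (A * B j).trace := by
    simp only [Matrix.mul_apply, Matrix.trace, diag_apply]
    refine sum_congr rfl fun i _ => sum_congr rfl fun l _ => ?_
    rw [hB2 i l j, hB1 l i j, hB2 l j i]
  rw [sum_congr rfl fun i _ => h i, sum_add_distrib, sum_add_distrib, sum_sub_distrib,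
    sum_sub_distrib, ← mul_sum, hB3, e1, e2]
  simp [Matrix.one_apply]
  ring

theorem pd_mf_hess (hu : ContDiff ℝ 4 u) (x : Eu n) (k : Fin n) :
    pd k (fun y => mf (hess u y)) x = (mF (hess u x) * pdM k (hess u) x).trace :=
  pd_mf (mDiff_hess hu x) k

/-- The twice differentiated equation. -/
theorem sum_pd_pd_mf_hess (hu : ContDiff ℝ 4 u) (x : Eu n) :
    ∑ k, pd k (pd k fun y => mf (hess u y)) x =
      ∑ k, mQf (hess u x) (pdM k (hess u) x) +
        (mF (hess u x) * hess (fun y => mS (hess u y)) x).trace := by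
  have h1 : ∀ k, pd k (pd k fun y => mf (hess u y)) x = mQf (hess u x) (pdM k (hess u) x) +
      (mF (hess u x) * pdM k (pdM k (hess u)) x).trace := by
    intro k
    have e : pd k (fun y => mf (hess u y)) =
        fun y => (mF (hess u y) * pdM k (hess u) y).trace := funext fun y => pd_mf_hess hu y k
    have dF := (mDiff_hess hu x).mF
    have dB := mDiff_pdM_hess hu k x
    rw [e, (dF.mul dB).pd_trace, dF.pdM_mul dB, trace_add, trace_pdM_mF_mul (mDiff_hess hu x)]
  have hS : ∀ y i j, hess (fun y => mS (hess u y)) y i j = ∑ k, pdM k (pdM k (hess u)) y i j := by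
    intro y i j
    have e1 : (pd j fun y => mS (hess u y)) = fun y => ∑ k, pd j (fun z => hess u z k k) y := by
      funext y
      rw [pd_mS (mDiff_hess hu y)]; rfl
    have d1 : ∀ k, DifferentiableAt ℝ (pd j fun z => hess u z k k) y := fun k =>
      (contDiff_pd (m := 1) (contDiff_hess hu k k) (by norm_num) j).differentiable (by norm_num) y
    have e2 : hess (fun y => mS (hess u y)) y i j = pd i (pd j fun y => mS (hess u y)) y := rfl
    rw [e2, e1, pd_sum (f := fun k y => pd j (fun z => hess u z k k) y) i fun k _ => d1 k]
    refine sum_congr rfl fun k _ => ?_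
    have c3 := contDiff_pd (m := 3) hu (by norm_num)
    have c2 := fun i => contDiff_pd (m := 2) (c3 i) (by norm_num)
    have e3 : (pd j fun z => hess u z k k) = pd k fun z => hess u z k j := by
      funext z
      have := pdM_hess_swap hu z j k k
      have h' := pdM_hess_symm hu z k j k
      rw [pdM_apply, pdM_apply] at this h'
      rw [this, h']
    have e4 : pd i (fun z => hess u z k j) = pd k fun z => hess u z i j := by
      funext z
      exact pdM_hess_swap hu z i k j
    calc pd i (fun y => pd j (fun z => hess u z k k) y) y
        = pd i (pd k fun z => hess u z k j) y := by rw [← e3]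
      _ = pd k (pd i fun z => hess u z k j) y := pd_comm (contDiff_hess hu k j) i k y
      _ = pd k (pd k fun z => hess u z i j) y := by rw [e4]
      _ = _ := rfl
  have hS' : hess (fun y => mS (hess u y)) x = ∑ k, pdM k (pdM k (hess u)) x := by
    ext i j
    rw [hS, Matrix.sum_apply]
  rw [sum_congr rfl fun k _ => h1 k, sum_add_distrib, hS', mul_sum, trace_sum]

end Hessian

end MatrixField

section LogCutoff

open Finset Matrix MeasureTheory

/-! ### A convex-in-the-logarithm cutoff of the logarithm -/

/-- A smooth function vanishing up to `N`, growing like `log`, and convex in `log t`. -/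
structure LogLike (N : ℝ) (Φ : ℝ → ℝ) : Prop where
  contDiff : ContDiff ℝ 2 Φ
  eq_zero : ∀ t ≤ N, Φ t = 0
  nonneg : ∀ t, 0 ≤ Φ t
  le_self : ∀ t, 0 ≤ t → Φ t ≤ t
  deriv_eq_zero : ∀ t ≤ N, deriv Φ t = 0
  deriv_nonneg : ∀ t, 0 ≤ deriv Φ t
  mul_deriv_le : ∀ t, 0 ≤ t → t * deriv Φ t ≤ 1
  convex : ∀ t, 0 < t → 0 ≤ deriv (deriv Φ) t + deriv Φ t / t
  proper : ∀ B, ∃ T > 0, ∀ t, Φ t ≤ B → t ≤ T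

theorem exists_logLike {N : ℝ} (hN : 1 ≤ N) : ∃ Φ, LogLike N Φ := by
  have hN0 : 0 < N := by linarith
  obtain ⟨χ, hχ⟩ : ∃ χ : ℝ → ℝ, χ = fun t => Real.smoothTransition ((t - N) / N) := ⟨_, rfl⟩
  have hχs : ContDiff ℝ 2 χ := by
    rw [hχ]
    exact Real.smoothTransition.contDiff.comp
      ((contDiff_id.sub contDiff_const).div_const _)
  have hχ0 : ∀ t ≤ N, χ t = 0 := fun t ht => by
    rw [hχ]
    exact Real.smoothTransition.zero_of_nonpos (div_nonpos_of_nonpos_of_nonneg (by linarith) hN0.le)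
  have hχ1 : ∀ t, 2 * N ≤ t → χ t = 1 := fun t ht => by
    rw [hχ]
    exact Real.smoothTransition.one_of_one_le (by rw [le_div_iff₀ hN0]; linarith)
  have hχn : ∀ t, 0 ≤ χ t := fun t => by rw [hχ]; exact Real.smoothTransition.nonneg _
  have hχl : ∀ t, χ t ≤ 1 := fun t => by rw [hχ]; exact Real.smoothTransition.le_one _
  have hχm : Monotone χ := by
    rw [hχ]
    intro a b hab
    refine Real.smoothTransition.monotone ?_
    exact div_le_div_of_nonneg_right (by linarith) hN0.le
  obtain ⟨g, hg⟩ : ∃ g : ℝ → ℝ, g = fun t => χ t / t := ⟨_, rfl⟩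
  have hg0 : ∀ t ≤ N, g t = 0 := fun t ht => by rw [hg]; simp [hχ0 t ht]
  have hgn : ∀ t, 0 ≤ g t := fun t => by
    rcases le_total t N with h | h
    · rw [hg0 t h]
    · rw [hg]; exact div_nonneg (hχn t) (by linarith)
  have hgs : ContDiff ℝ 2 g := by
    rw [contDiff_iff_contDiffAt]
    intro t
    rcases lt_or_ge t N with h | h
    · refine (contDiffAt_const (c := (0 : ℝ))).congr_of_eventuallyEq ?_
      filter_upwards [Iio_mem_nhds h] with y hy using hg0 y (le_of_lt hy)
    · rw [hg]
      exact hχs.contDiffAt.div contDiffAt_id (by simp; linarith)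
  have hgc : Continuous g := hgs.continuous
  obtain ⟨Φ, hΦ⟩ : ∃ Φ : ℝ → ℝ, Φ = fun t => ∫ r in N..t, g r := ⟨_, rfl⟩
  have hd : ∀ t, HasDerivAt Φ (g t) t := fun t => by
    rw [hΦ]
    exact intervalIntegral.integral_hasDerivAt_right (hgc.intervalIntegrable _ _)
      hgc.aestronglyMeasurable.stronglyMeasurableAtFilter hgc.continuousAt
  have hd' : deriv Φ = g := funext fun t => (hd t).deriv
  have hdiff : Differentiable ℝ Φ := fun t => (hd t).differentiableAt
  have hmono : Monotone Φ := monotone_of_deriv_nonneg hdiff (by rw [hd']; exact hgn)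
  have h0 : ∀ t ≤ N, Φ t = 0 := fun t ht => by
    rw [hΦ]
    refine intervalIntegral.integral_zero_ae (Filter.Eventually.of_forall fun r hr => hg0 r ?_)
    rw [Set.uIoc_of_ge ht] at hr
    exact hr.2
  have hnn : ∀ t, 0 ≤ Φ t := fun t => by
    rcases le_total t N with h | h
    · rw [h0 t h]
    · rw [← h0 N le_rfl]; exact hmono h
  have htg : ∀ t, 0 ≤ t → t * g t ≤ 1 := fun t ht => by
    rcases le_total t N with h | h
    · rw [hg0 t h]; simp
    · have : 0 < t := by linarith
      rw [hg]
      simp only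
      rw [mul_div_cancel₀ _ this.ne']
      exact hχl t
  refine ⟨Φ, ?_, h0, hnn, ?_, ?_, ?_, ?_, ?_, ?_⟩
  · have : ContDiff ℝ (1 + 1) Φ := by
      rw [contDiff_succ_iff_deriv]
      exact ⟨hdiff, by simp, by rw [hd']; exact hgs.of_le (by norm_num)⟩
    simpa [one_add_one_eq_two] using this
  · have hanti : Antitone fun t => Φ t - t := by
      refine antitone_of_deriv_nonpos (hdiff.sub differentiable_id) fun t => ?_
      have : HasDerivAt (fun t => Φ t - t) (g t - 1) t := (hd t).sub (hasDerivAt_id t)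
      rw [this.deriv]
      rcases le_total t N with h | h
      · rw [hg0 t h]; norm_num
      · have h1 := htg t (by linarith)
        nlinarith [hgn t]
    intro t ht
    have := hanti ht
    simp only [h0 0 hN0.le] at this
    linarith
  · intro t ht; rw [hd', hg0 t ht]
  · intro t; rw [hd']; exact hgn t
  · intro t ht; rw [hd']; exact htg t ht
  · intro t ht
    rw [hd']
    have h1 : HasDerivAt g ((deriv χ t * t - χ t * 1) / t ^ 2) t := by
      rw [hg]
      exact ((hχs.differentiable (by norm_num) t).hasDerivAt).div (hasDerivAt_id t) ht.ne'
    rw [h1.deriv]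
    have h2 : (deriv χ t * t - χ t * 1) / t ^ 2 + g t / t = deriv χ t / t := by
      rw [hg]; field_simp; ring
    rw [h2]
    exact div_nonneg hχm.deriv_nonneg ht.le
  · intro B
    refine ⟨2 * N * Real.exp (max B 0), by positivity, fun t ht => ?_⟩
    by_contra! hlt
    have hpos : (1 : ℝ) ≤ Real.exp (max B 0) := Real.one_le_exp (le_max_right _ _)
    have h2N : 2 * N ≤ t := by nlinarith
    have h2 : Φ (2 * N) + ∫ r in (2 * N)..t, r⁻¹ = Φ t := by
      rw [hΦ]
      simp only
      rw [← intervalIntegral.integral_add_adjacent_intervals (b := 2 * N)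
        (hgc.intervalIntegrable N (2 * N)) (hgc.intervalIntegrable (2 * N) t)]
      congr 1
      refine intervalIntegral.integral_congr fun r hr => ?_
      rw [Set.uIcc_of_le h2N] at hr
      rw [hg]
      simp only
      rw [hχ1 r hr.1, one_div]
    rw [integral_inv_of_pos (by linarith) (by linarith)] at h2
    have h3 : max B 0 < Real.log (t / (2 * N)) := by
      rw [Real.lt_log_iff_exp_lt (div_pos (by linarith) (by positivity)),
        lt_div_iff₀ (by positivity)]
      linarith
    linarith [hnn (2 * N), le_max_left B 0]

end LogCutoff

section Solution

open Finset Matrix MeasureTheory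

variable {n : ℕ}

/-- A globally smooth function which solves the equation on a ball, in terms of the
differentiated equation only. -/
structure Sol (K m₀ Λ C₁ M : ℝ) (u : Eu n → ℝ) : Prop where
  smooth : ContDiff ℝ 4 u
  adm : ∀ x, ‖x‖ < 9 / 2 → MAdm K m₀ Λ (hess u x)
  grad_le : ∀ x, ‖x‖ < 9 / 2 → ∀ k, |pd k u x| ≤ M
  pd_le : ∀ x, ‖x‖ < 9 / 2 → ∀ k, |pd k (fun y => mf (hess u y)) x| ≤ C₁ * mS (hess u x)
  lap_ge : ∀ x, ‖x‖ < 9 / 2 → -(C₁ * ∑ k, |pd k (fun y => mS (hess u y)) x|) -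
    C₁ * mS (hess u x) ^ 2 ≤ ∑ k, pd k (pd k fun y => mf (hess u y)) x

/-- The gradient as a plain vector. -/
def gradV (g : Eu n → ℝ) (x : Eu n) : Fin n → ℝ := fun k => pd k g x

theorem Sol.jacobi (n : ℕ) {K m₀ Λ C₁ : ℝ} (hK : 0 ≤ K) (hm : 0 < m₀) (hΛ : 0 < Λ) (hC₁ : 0 < C₁) :
    ∃ N ≥ 2, ∃ C > 0, ∀ (M : ℝ) (u : Eu n → ℝ), Sol K m₀ Λ C₁ M u → ∀ x, ‖x‖ < 9 / 2 →
      N ≤ mS (hess u x) →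
      41 / 40 * (gradV (fun y => mS (hess u y)) x ⬝ᵥ
        (mF (hess u x) *ᵥ gradV (fun y => mS (hess u y)) x)) ≤
      mS (hess u x) * ((mF (hess u x) * hess (fun y => mS (hess u y)) x).trace
        + C * mSig (hess u x) * mS (hess u x)) := by
  obtain ⟨N, hN, C, hC, key⟩ := matrix_jacobi n hK hm hΛ
  obtain ⟨c, hc, hFge⟩ := MAdm.F_ge n hm
  refine ⟨max N 2, le_max_right _ _, 2 * (C * (n * C₁ ^ 2) + C₁ + 10 * n * C₁ ^ 2 / c),
    by positivity,
    ?_⟩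
  intro M u hu x hx hs
  have hA := hu.adm x hx
  have hs2 : 2 ≤ mS (hess u x) := le_trans (le_max_right _ _) hs
  have h1 := key _ hA (le_trans (le_max_left _ _) hs) (fun k => pdM k (hess u) x)
    (fun k i j => pdM_hess_symm hu.smooth x k i j) (fun k i j => pdM_hess_swap hu.smooth x k i j)
  have hv : (fun k => (pdM k (hess u) x).trace) = gradV (fun y => mS (hess u y)) x :=
    funext fun k => trace_pdM_hess hu.smooth x k
  have h2 := hFge K Λ _ hA hs2 (gradV (fun y => mS (hess u y)) x)
  have h3 := sum_pd_pd_mf_hess hu.smooth x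
  have h4 := hu.lap_ge x hx
  have h5 : ∑ k, (mF (hess u x) * pdM k (hess u) x).trace ^ 2 ≤
      n * (C₁ ^ 2 * mS (hess u x) ^ 2) := by
    calc _ ≤ ∑ _k : Fin n, C₁ ^ 2 * mS (hess u x) ^ 2 := by
          refine sum_le_sum fun k _ => ?_
          rw [← pd_mf_hess hu.smooth, ← mul_pow, ← sq_abs]
          exact pow_le_pow_left₀ (abs_nonneg _) (hu.pd_le x hx k) 2
      _ = _ := by simp
  have h6 := hA.lt_sig
  simp only [hv] at h1
  obtain ⟨q, hq⟩ : ∃ q, q = gradV (fun y => mS (hess u y)) x ⬝ᵥ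
        (mF (hess u x) *ᵥ gradV (fun y => mS (hess u y)) x) := ⟨_, rfl⟩
  obtain ⟨s, hs'⟩ : ∃ s, s = mS (hess u x) := ⟨_, rfl⟩
  obtain ⟨σ, hσ⟩ : ∃ σ, σ = mSig (hess u x) := ⟨_, rfl⟩
  obtain ⟨T, hT⟩ : ∃ T, T = (mF (hess u x) * hess (fun y => mS (hess u y)) x).trace := ⟨_, rfl⟩
  obtain ⟨Q, hQ⟩ : ∃ Q, Q = ∑ k, mQf (hess u x) (pdM k (hess u) x) := ⟨_, rfl⟩
  obtain ⟨R, hR⟩ : ∃ R, R = ∑ k, (mF (hess u x) * pdM k (hess u) x).trace ^ 2 := ⟨_, rfl⟩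
  rw [← hq, ← hs', ← hQ, ← hR] at h1
  rw [← hq, ← hs'] at h2
  rw [← hT, ← hQ] at h3
  rw [h3, ← hs'] at h4
  rw [← hs', ← hR] at h5
  rw [← hs', ← hσ] at h6
  rw [← hs'] at hs2
  rw [← hq, ← hs', ← hσ, ← hT]
  have h7 : s ^ 2 * (C₁ * ∑ k, |pd k (fun y => mS (hess u y)) x|) ≤
      c / 40 * ∑ k, gradV (fun y => mS (hess u y)) x k ^ 2 + 10 * n * C₁ ^ 2 / c * s ^ 4 := by
    have : ∀ k, s ^ 2 * (C₁ * |pd k (fun y => mS (hess u y)) x|) ≤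
        c / 40 * gradV (fun y => mS (hess u y)) x k ^ 2 + 10 * C₁ ^ 2 / c * s ^ 4 := by
      intro k
      rw [gradV, ← sq_abs (pd k _ x)]
      obtain ⟨a, ha⟩ : ∃ a, a = |pd k (fun y => mS (hess u y)) x| := ⟨_, rfl⟩
      rw [← ha]
      have e : c / 40 * a ^ 2 + 10 * C₁ ^ 2 / c * s ^ 4 - s ^ 2 * (C₁ * a) =
          (c * a - 20 * C₁ * s ^ 2) ^ 2 / (40 * c) := by field_simp; ring
      have : 0 ≤ (c * a - 20 * C₁ * s ^ 2) ^ 2 / (40 * c) := by positivity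
      linarith
    calc _ = ∑ k, s ^ 2 * (C₁ * |pd k (fun y => mS (hess u y)) x|) := by simp only [mul_sum]
      _ ≤ ∑ k, (c / 40 * gradV (fun y => mS (hess u y)) x k ^ 2 + 10 * C₁ ^ 2 / c * s ^ 4) :=
          sum_le_sum fun k _ => this k
      _ = _ := by rw [sum_add_distrib, ← mul_sum]; simp; ring
  have h8 : s * (C₁ * ∑ k, |pd k (fun y => mS (hess u y)) x|) ≤
      1 / 40 * q + 10 * n * C₁ ^ 2 / c * s ^ 3 := by
    have : s * (s * (C₁ * ∑ k, |pd k (fun y => mS (hess u y)) x|)) ≤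
        s * (1 / 40 * q + 10 * n * C₁ ^ 2 / c * s ^ 3) := by nlinarith
    exact le_of_mul_le_mul_left this (by linarith)
  have h9 : s ≤ 2 * σ := by linarith
  obtain ⟨E, hE⟩ : ∃ E, E = 10 * n * C₁ ^ 2 / c := ⟨_, rfl⟩
  have hE0 : 0 ≤ E := by rw [hE]; positivity
  rw [← hE] at h8 ⊢
  obtain ⟨G, hG⟩ : ∃ G, G = C₁ * ∑ k, |pd k (fun y => mS (hess u y)) x| := ⟨_, rfl⟩
  rw [← hG] at h4 h8
  have g1 : s * (C * R) ≤ s * (C * (n * (C₁ ^ 2 * s ^ 2))) := by gcongr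
  have g2 : s * (-Q) ≤ s * (T + G + C₁ * s ^ 2) := mul_le_mul_of_nonneg_left (by linarith)
      (by linarith)
  have g3 : (C * (n * C₁ ^ 2) + C₁ + E) * (s ^ 2 * s) ≤
      (C * (n * C₁ ^ 2) + C₁ + E) * (s ^ 2 * (2 * σ)) := by gcongr
  linarith

/-- The Jacobi inequality for `Φ(1 + Δu)`. -/
theorem Sol.jacobi_log (n : ℕ) {K m₀ Λ C₁ : ℝ} (hK : 0 ≤ K) (hm : 0 < m₀) (hΛ : 0 < Λ)
    (hC₁ : 0 < C₁) : ∃ N ≥ 2, ∃ C > 0, ∀ Φ, LogLike N Φ → ∀ (M : ℝ) (u : Eu n → ℝ),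
      Sol K m₀ Λ C₁ M u → ∀ x, ‖x‖ < 9 / 2 →
      1 / 40 * (gradV (fun y => Φ (mS (hess u y))) x ⬝ᵥ
        (mF (hess u x) *ᵥ gradV (fun y => Φ (mS (hess u y))) x)) ≤
      (mF (hess u x) * hess (fun y => Φ (mS (hess u y))) x).trace + C * mSig (hess u x) := by
  obtain ⟨N, hN, C, hC, key⟩ := Sol.jacobi n hK hm hΛ hC₁
  refine ⟨N, hN, C, hC, ?_⟩
  intro Φ hΦ M u hu x hx
  have hA := hu.adm x hx
  have hsC := contDiff_mS_hess hu.smooth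
  obtain ⟨s, hs⟩ : ∃ s : Eu n → ℝ, s = fun y => mS (hess u y) := ⟨_, rfl⟩
  have hsx : mS (hess u x) = s x := by rw [hs]
  have hsy : ∀ y, mS (hess u y) = s y := fun y => by rw [hs]
  rw [← hs] at hsC
  have hsd : ∀ y, DifferentiableAt ℝ s y := fun y => hsC.differentiable (by norm_num) y
  have hΦd : ∀ t, DifferentiableAt ℝ Φ t := fun t => hΦ.contDiff.differentiable (by norm_num) t
  have hΦ'd : ∀ t, DifferentiableAt ℝ (deriv Φ) t := fun t =>
    ((contDiff_succ_iff_deriv (n := 1)).1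
      (by simpa [one_add_one_eq_two] using hΦ.contDiff)).2.2.differentiable (by norm_num) t
  have e1 : ∀ i y, pd i (fun y => Φ (s y)) y = deriv Φ (s y) * pd i s y :=
    fun i y => pd_comp i (hΦd _) (hsd y)
  have e2 : gradV (fun y => Φ (s y)) x = deriv Φ (s x) • gradV s x :=
    funext fun i => e1 i x
  have e3 : hess (fun y => Φ (s y)) x =
      deriv Φ (s x) • hess s x + deriv (deriv Φ) (s x) • vecMulVec (gradV s x) (gradV s x) := by
    ext i j
    have h0 : hess (fun y => Φ (s y)) x i j = pd i (pd j fun y => Φ (s y)) x := rfl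
    have h1 : DifferentiableAt ℝ (fun y => deriv Φ (s y)) x := (hΦ'd (s x)).comp x (hsd x)
    have h2 : DifferentiableAt ℝ (fun y => pd j s y) x :=
      (contDiff_pd (m := 1) hsC (by norm_num) j).differentiable (by norm_num) x
    have h3 := pd_comp (Φ := deriv Φ) i (hΦ'd _) (hsd x)
    have h4 : (pd j fun y => Φ (s y)) = fun y => deriv Φ (s y) * pd j s y := funext (e1 j)
    rw [h0, h4, pd_mul i h1 h2, h3]
    simp only [Matrix.add_apply, Matrix.smul_apply, vecMulVec_apply, gradV, smul_eq_mul]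
    have : hess s x i j = pd i (pd j s) x := rfl
    rw [this]; ring
  have e4 : (mF (hess u x) * vecMulVec (gradV s x) (gradV s x)).trace =
      gradV s x ⬝ᵥ (mF (hess u x) *ᵥ gradV s x) := by
    rw [mul_vecMulVec, trace_vecMulVec, dotProduct_comm]
  simp only [hsy]
  rw [e2, e3, mul_add, trace_add, Matrix.mul_smul, Matrix.mul_smul, trace_smul, trace_smul, e4,
    mulVec_smul,
    dotProduct_smul, smul_dotProduct]
  have hq := hA.F_nonneg (gradV s x)
  have hσ := hA.sig_pos
  have hs1 := hA.one_lt
  rw [hsx] at hs1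
  simp only [smul_eq_mul]
  rcases le_total N (s x) with hN' | hN'
  · have h1 := key M u hu x hx (by rw [hsx]; exact hN')
    rw [← hs, hsx] at h1
    have p1 := hΦ.deriv_nonneg (s x)
    have p2 := hΦ.mul_deriv_le (s x) (by linarith)
    have p3 := hΦ.convex (s x) (by linarith)
    obtain ⟨q, hq'⟩ : ∃ q, q = gradV s x ⬝ᵥ (mF (hess u x) *ᵥ gradV s x) := ⟨_, rfl⟩
    obtain ⟨T, hT⟩ : ∃ T, T = (mF (hess u x) * hess s x).trace := ⟨_, rfl⟩
    obtain ⟨t, ht⟩ : ∃ t, t = s x := ⟨_, rfl⟩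
    obtain ⟨σ, hσ'⟩ : ∃ σ, σ = mSig (hess u x) := ⟨_, rfl⟩
    rw [← hq', ← hT, ← ht, ← hσ'] at h1
    rw [← hq'] at hq
    rw [← hσ'] at hσ
    rw [← ht] at p1 p2 p3 hs1
    rw [← hq', ← hT, ← ht, ← hσ']
    obtain ⟨d, hd⟩ : ∃ d, d = deriv Φ t := ⟨_, rfl⟩
    obtain ⟨d2, hd2⟩ : ∃ d, d = deriv (deriv Φ) t := ⟨_, rfl⟩
    rw [← hd] at p1 p2 p3
    rw [← hd2] at p3
    rw [← hd, ← hd2]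
    have ht0 : 0 < t := by linarith
    have p4 : 0 ≤ t * d2 + d := by
      have : t * (d2 + d / t) = t * d2 + d := by field_simp
      rw [← this]; positivity
    refine le_of_mul_le_mul_left ?_ ht0
    have g1 := mul_le_mul_of_nonneg_left h1 p1
    have g2 : 0 ≤ (t * d2 + d) * q := mul_nonneg p4 hq
    have g3 : (t * d) * (d * q) ≤ 1 * (d * q) := by gcongr
    have g4 : (t * d) * (C * σ * t) ≤ 1 * (C * σ * t) := by gcongr
    linarith
  · have p1 := hΦ.deriv_eq_zero (s x) hN'
    have p3 := hΦ.convex (s x) (by linarith)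
    rw [p1, zero_div, add_zero] at p3
    rw [p1]
    have := mul_nonneg p3 hq
    have := mul_pos hC hσ
    linarith

end Solution

section Energy

open Finset Matrix MeasureTheory

variable {n : ℕ}

/-! ### Cutoff functions -/

/-- A smooth cutoff function between the balls of radius `r` and `R`. -/
structure Cut (r R : ℝ) (η : Eu n → ℝ) : Prop where
  smooth : ContDiff ℝ 4 η
  one : ∀ x, ‖x‖ ≤ r → η x = 1
  zero : ∀ x, R ≤ ‖x‖ → η x = 0
  pd_zero : ∀ x, R ≤ ‖x‖ → ∀ k, pd k η x = 0
  nonneg : ∀ x, 0 ≤ η x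
  le_one : ∀ x, η x ≤ 1
  bound : ∃ D > 0, ∀ x k, |pd k η x| ≤ D

theorem hasCompactSupport_of_zero {g : Eu n → ℝ} {R : ℝ} (h : ∀ x, R ≤ ‖x‖ → g x = 0) :
    HasCompactSupport g := by
  refine HasCompactSupport.intro (isCompact_closedBall (0 : Eu n) R) fun x hx => h x ?_
  rw [mem_closedBall_zero_iff, not_le] at hx
  exact hx.le

theorem integrable_of_zero {g : Eu n → ℝ} {R : ℝ} (hg : Continuous g)
    (h : ∀ x, R ≤ ‖x‖ → g x = 0) : Integrable g :=
  hg.integrable_of_hasCompactSupport (hasCompactSupport_of_zero h)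

theorem exists_cut {r R : ℝ} (hr : 0 < r) (hR : r < R) : ∃ η : Eu n → ℝ, Cut r R η := by
  let f : ContDiffBump (0 : Eu n) := ⟨r, (r + R) / 2, hr, by linarith⟩
  have hs : ContDiff ℝ 4 f := f.contDiff
  have hz : ∀ x : Eu n, R ≤ ‖x‖ → f x = 0 := fun x hx =>
    f.zero_of_le_dist (by rw [dist_zero_right]; show (r + R) / 2 ≤ ‖x‖; linarith)
  have hpz : ∀ x : Eu n, R ≤ ‖x‖ → ∀ k, pd k f x = 0 := by
    intro x hx k
    have h1 : (f : Eu n → ℝ) =ᶠ[nhds x] fun _ => 0 := by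
      have : {y : Eu n | (r + R) / 2 < ‖y‖} ∈ nhds x :=
        (isOpen_lt continuous_const continuous_norm).mem_nhds (by show (r + R) / 2 < ‖x‖; linarith)
      filter_upwards [this] with y hy
      exact f.zero_of_le_dist (by rw [dist_zero_right]; exact le_of_lt hy)
    rw [pd, h1.fderiv_eq]
    simp
  refine ⟨f, hs, fun x hx => f.one_of_mem_closedBall (by simpa using hx), hz, hpz,
    fun x => f.nonneg, fun x => f.le_one, ?_⟩
  have hb : ∀ k : Fin n, ∃ D, ∀ x, |pd k f x| ≤ D := fun k => by
    have hc : Continuous (pd k f) := (contDiff_pd (m := 3) hs (by norm_num) k).continuous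
    obtain ⟨D, hD⟩ := hc.bounded_above_of_compact_support
      (hasCompactSupport_of_zero fun x hx => hpz x hx k)
    exact ⟨D, hD⟩
  choose D hD using hb
  refine ⟨1 + ∑ k, |D k|, by positivity, fun x k => (hD k x).trans ?_⟩
  have := single_le_sum (f := fun k => |D k|) (fun k _ => abs_nonneg (D k)) (mem_univ k)
  linarith [le_abs_self (D k)]

theorem Cut.sq {r R : ℝ} {η : Eu n → ℝ} (h : Cut r R η) : Cut r R fun x => η x ^ 2 := by
  have hd : ∀ x k, pd k (fun x => η x ^ 2) x = 2 * η x * pd k η x := by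
    intro x k
    have d := h.smooth.differentiable (by norm_num) x
    simp only [pow_two]
    rw [pd_mul k d d]; ring
  obtain ⟨D, hD, hb⟩ := h.bound
  refine ⟨h.smooth.pow 2, fun x hx => by simp [h.one x hx], fun x hx => by simp [h.zero x hx],
    fun x hx k => by rw [hd, h.pd_zero x hx]; ring, fun x => sq_nonneg _,
    fun x => pow_le_one₀ (h.nonneg x) (h.le_one x), 2 * D, by positivity, fun x k => ?_⟩
  rw [hd, abs_mul, abs_mul, abs_of_nonneg (h.nonneg x), abs_two]
  exact mul_le_mul (by linarith [h.le_one x]) (hb x k) (abs_nonneg _) (by positivity)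

/-- Comparison of integrals through a larger cutoff function. -/
theorem Cut.integral_le {r R R₀ : ℝ} {η f h : Eu n → ℝ} (hη : Cut r R η) (hf : Continuous f)
    (hf0 : ∀ x, R₀ ≤ ‖x‖ → f x = 0) (hR₀ : R₀ ≤ r) (hR : R ≤ 9 / 2) (hh : Continuous h)
    (hh0 : ∀ x, ‖x‖ < 9 / 2 → 0 ≤ h x) (hfh : ∀ x, ‖x‖ < R₀ → ‖x‖ < 9 / 2 → f x ≤ h x) :
    ∫ x, f x ≤ ∫ x, η x * h x := by
  refine integral_mono (integrable_of_zero hf hf0) (integrable_of_zero (R := R)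
    (hη.smooth.continuous.mul hh) fun x hx => by rw [hη.zero x hx, zero_mul]) fun x => ?_
  have h1 : 0 ≤ η x * h x := by
    rcases lt_or_ge ‖x‖ R with hx | hx
    · exact mul_nonneg (hη.nonneg x) (hh0 x (by linarith))
    · rw [hη.zero x hx, zero_mul]
  rcases lt_or_ge ‖x‖ R₀ with hx | hx
  · rcases lt_or_ge ‖x‖ (9 / 2) with hx' | hx'
    · simp only
      rw [hη.one x (by linarith), one_mul]
      exact hfh x hx hx'
    · have hrR : ‖x‖ < R := by
        by_contra! hc
        have a := hη.one x (by linarith)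
        rw [hη.zero x hc] at a
        exact zero_ne_one a
      linarith
  · simp only
    rw [hf0 x hx]
    exact h1

/-! ### Quantities attached to a solution -/

variable {K m₀ Λ C₁ M N : ℝ} {Φ : ℝ → ℝ} {u : Eu n → ℝ}

/-- The regularized logarithm of `1 + Δu`. -/
def bF (Φ : ℝ → ℝ) (u : Eu n → ℝ) (x : Eu n) : ℝ := Φ (mS (hess u x))

/-- The energy density of `bF`. -/
def qF (Φ : ℝ → ℝ) (u : Eu n → ℝ) (x : Eu n) : ℝ :=
  gradV (bF Φ u) x ⬝ᵥ (mF (hess u x) *ᵥ gradV (bF Φ u) x)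

theorem continuous_quad {A : Eu n → Matrix (Fin n) (Fin n) ℝ} {v w : Eu n → Fin n → ℝ}
    (hA : ∀ i j, Continuous fun x => A x i j) (hv : ∀ i, Continuous fun x => v x i)
    (hw : ∀ i, Continuous fun x => w x i) : Continuous fun x => v x ⬝ᵥ (A x *ᵥ w x) := by
  simp only [dotProduct, mulVec]
  fun_prop

namespace Sol

theorem contDiff_bF (hu : Sol K m₀ Λ C₁ M u) (hΦ : LogLike N Φ) : ContDiff ℝ 2 (bF Φ u) :=
  hΦ.contDiff.comp (contDiff_mS_hess hu.smooth)

theorem continuous_pd_bF (hu : Sol K m₀ Λ C₁ M u) (hΦ : LogLike N Φ) (k : Fin n) :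
    Continuous (pd k (bF Φ u)) :=
  (contDiff_pd (m := 1) (hu.contDiff_bF hΦ) (by norm_num) k).continuous

theorem continuous_qF (hu : Sol K m₀ Λ C₁ M u) (hΦ : LogLike N Φ) : Continuous (qF Φ u) :=
  continuous_quad (fun i j => (contDiff_mF_hess hu.smooth i j).continuous)
    (hu.continuous_pd_bF hΦ) (hu.continuous_pd_bF hΦ)

theorem gradV_bF_eq_zero (hu : Sol K m₀ Λ C₁ M u) (hΦ : LogLike N Φ) {x : Eu n}
    (hx : mS (hess u x) ≤ N) : gradV (bF Φ u) x = 0 := by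
  funext k
  have h := pd_comp k (hΦ.contDiff.differentiable (by norm_num) (mS (hess u x)))
    ((contDiff_mS_hess hu.smooth).differentiable (by norm_num) x)
  rw [hΦ.deriv_eq_zero _ hx, zero_mul] at h
  exact h

theorem qF_nonneg (hu : Sol K m₀ Λ C₁ M u) {x : Eu n} (hx : ‖x‖ < 9 / 2) : 0 ≤ qF Φ u x :=
  (hu.adm x hx).F_nonneg _

theorem bF_le (hu : Sol K m₀ Λ C₁ M u) (hΦ : LogLike N Φ) {x : Eu n} (hx : ‖x‖ < 9 / 2) :
    bF Φ u x ≤ mS (hess u x) := hΦ.le_self _ (by linarith [(hu.adm x hx).one_lt])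

end Sol

theorem exists_abs_pd_bF_le (n : ℕ) (hm : 0 < m₀) : ∃ C > 0, ∀ (K Λ C₁ M N : ℝ) (Φ : ℝ → ℝ)
    (u : Eu n → ℝ), Sol K m₀ Λ C₁ M u → 2 ≤ N → LogLike N Φ → ∀ x, ‖x‖ < 9 / 2 → ∀ k,
      |pd k (bF Φ u) x| ≤ mS (hess u x) + C * qF Φ u x := by
  obtain ⟨c, hc, key⟩ := MAdm.F_ge n hm
  refine ⟨c⁻¹, by positivity, fun K Λ C₁ M N Φ u hu hN hΦ x hx k => ?_⟩
  have hA := hu.adm x hx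
  have hs := hA.one_lt
  have hq := hu.qF_nonneg (Φ := Φ) hx
  rcases le_total (mS (hess u x)) N with h | h
  · have : pd k (bF Φ u) x = 0 := congrFun (hu.gradV_bF_eq_zero hΦ h) k
    rw [this, abs_zero]; positivity
  · have h1 := key K Λ _ hA (by linarith) (gradV (bF Φ u) x)
    have h2 : pd k (bF Φ u) x ^ 2 ≤ ∑ i, gradV (bF Φ u) x i ^ 2 :=
      single_le_sum (f := fun i => gradV (bF Φ u) x i ^ 2) (fun i _ => sq_nonneg _) (mem_univ k)
    have h3 : c * pd k (bF Φ u) x ^ 2 ≤ mS (hess u x) * qF Φ u x :=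
      (mul_le_mul_of_nonneg_left h2 hc.le).trans h1
    have h4 : pd k (bF Φ u) x ^ 2 ≤ mS (hess u x) * (c⁻¹ * qF Φ u x) := by
      rw [← mul_le_mul_iff_right₀ hc]
      calc _ ≤ _ := h3
        _ = _ := by field_simp
    have h5 : 0 ≤ c⁻¹ * qF Φ u x := by positivity
    refine abs_le_of_sq_le_sq ?_ (by positivity)
    nlinarith [mul_nonneg (by linarith : (0:ℝ) ≤ mS (hess u x)) h5]

/-! ### Integral estimates -/

theorem abs_sum_sum_le {a : Fin n → Fin n → ℝ} {B : ℝ} (h : ∀ i j, |a i j| ≤ B) :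
    |∑ i, ∑ j, a i j| ≤ n * (n * B) := by
  calc _ ≤ ∑ i, ∑ j, |a i j| :=
        (abs_sum_le_sum_abs _ _).trans (sum_le_sum fun i _ => abs_sum_le_sum_abs _ _)
    _ ≤ ∑ _i : Fin n, ∑ _j : Fin n, B := sum_le_sum fun i _ => sum_le_sum fun j _ => h i j
    _ = _ := by simp

/-- Integration by parts for `η(1 + Δu)`. -/
theorem Sol.integral_mS (hu : Sol K m₀ Λ C₁ M u) {η : Eu n → ℝ} (hη : ContDiff ℝ 1 η)
    (hc : HasCompactSupport η) :
    ∫ x, η x * mS (hess u x) = ∫ x, (η x - ∑ k, pd k η x * pd k u x) := by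
  have h1 := integral_divFree (M := fun _ => (1 : Matrix (Fin n) (Fin n) ℝ)) (η := η)
    (w := fun j => pd j u) (fun i j => contDiff_const) (fun x j => by simp [pd_const]) hη hc
    (fun j => contDiff_pd (m := 1) hu.smooth (by norm_num) j)
  have e1 : ∀ x, ∑ i, ∑ j, (1 : Matrix (Fin n) (Fin n) ℝ) i j * pd i (pd j u) x =
      mS (hess u x) - 1 := by
    intro x
    rw [mS, add_sub_cancel_left]
    refine sum_congr rfl fun i _ => ?_
    simp only [Matrix.one_apply, ite_mul, one_mul, zero_mul, sum_ite_eq, mem_univ, if_true]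
    rfl
  have e2 : ∀ x, ∑ i, ∑ j, (1 : Matrix (Fin n) (Fin n) ℝ) i j * pd i η x * pd j u x =
      ∑ k, pd k η x * pd k u x := by
    intro x
    refine sum_congr rfl fun i _ => ?_
    simp only [Matrix.one_apply, ite_mul, one_mul, zero_mul, sum_ite_eq, mem_univ, if_true]
  simp only [e1, e2] at h1
  have c1 := hη.continuous
  have c2 := (contDiff_mS_hess hu.smooth).continuous
  have c3 := fun k => (contDiff_pd (m := 0) hη (by norm_num) k).continuous
  have c4 := fun k => (contDiff_pd (m := 3) hu.smooth (by norm_num) k).continuous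
  have i1 : Integrable η := c1.integrable_of_hasCompactSupport hc
  have i2 : Integrable fun x => ∑ k, pd k η x * pd k u x :=
    integrable_finsetSum _ fun k _ => ((c3 k).mul (c4 k)).integrable_of_hasCompactSupport
      (hc.pd k).mul_right
  have i3 : Integrable fun x => η x * (mS (hess u x) - 1) :=
    (c1.mul (c2.sub continuous_const)).integrable_of_hasCompactSupport hc.mul_right
  rw [integral_sub i1 i2, sub_eq_add_neg, ← h1, ← integral_add i1 i3]
  congr 1
  ext x
  ring

/-- Integration by parts for `η σ`, `σ` the sum of the first two Hessian operators. -/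
theorem Sol.integral_mSig (hu : Sol K m₀ Λ C₁ M u) {η : Eu n → ℝ} (hη : ContDiff ℝ 1 η)
    (hc : HasCompactSupport η) :
    ∫ x, η x * mSig (hess u x) =
      ∫ x, -(1 / 2 * ∑ i, ∑ j, mP (hess u x) i j * pd i η x * pd j u x) := by
  have h1 := integral_divFree (M := fun x => mP (hess u x)) (η := η)
    (w := fun j => pd j u) (fun i j => (contDiff_mP_hess hu.smooth i j).of_le (by norm_num))
    (fun x j => sum_pd_mP_hess hu.smooth x j) hη hc
    (fun j => contDiff_pd (m := 1) hu.smooth (by norm_num) j)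
  have e1 : ∀ x, ∑ i, ∑ j, mP (hess u x) i j * pd i (pd j u) x = 2 * mSig (hess u x) := by
    intro x
    rw [← trace_mP_mul]
    refine sum_congr rfl fun i _ => ?_
    rw [diag_apply, Matrix.mul_apply]
    refine sum_congr rfl fun j _ => ?_
    rw [hess_symm (hu.smooth.of_le (by norm_num)) x j i]
    rfl
  simp only [e1] at h1
  rw [integral_neg, integral_const_mul]
  have e2 : ∀ x, η x * (2 * mSig (hess u x)) = 2 * (η x * mSig (hess u x)) := fun x => by ring
  simp only [e2] at h1
  rw [integral_const_mul] at h1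
  linarith

end Energy

section EnergyEstimates

open Finset Matrix MeasureTheory

variable {n : ℕ} {K m₀ Λ C₁ N : ℝ} {Φ : ℝ → ℝ} {u : Eu n → ℝ} {η : Eu n → ℝ} {r R : ℝ}

theorem Cut.pd_continuous (hη : Cut r R η) (k : Fin n) : Continuous (pd k η) :=
  (contDiff_pd (m := 3) hη.smooth (by norm_num) k).continuous

theorem Cut.hasCompactSupport (hη : Cut r R η) : HasCompactSupport η :=
  hasCompactSupport_of_zero hη.zero

theorem Cut.integrable_mul (hη : Cut r R η) {g : Eu n → ℝ} (hg : Continuous g) :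
    Integrable fun x => η x * g x :=
  integrable_of_zero (R := R) (hη.smooth.continuous.mul hg) fun x hx => by
    rw [hη.zero x hx, zero_mul]

/-- `∫ η (1 + Δu)` is bounded. -/
theorem Cut.exists_integral_mS_le (hη : Cut r R η) (hR0 : 0 < R) (hR : R < 9 / 2) (M : ℝ) :
    ∃ C > 0, ∀ (K m₀ Λ C₁ : ℝ) (u : Eu n → ℝ), Sol K m₀ Λ C₁ M u →
      ∫ x, η x * mS (hess u x) ≤ C := by
  obtain ⟨D, hD, hDb⟩ := hη.bound
  obtain ⟨θ, hθ⟩ := exists_cut (n := n) hR0 hR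
  have hI : 0 ≤ ∫ x, θ x := integral_nonneg hθ.nonneg
  refine ⟨(∫ x, θ x) * (1 + n * (D * |M|)) + 1, by positivity, fun K m₀ Λ C₁ u hu => ?_⟩
  rw [hu.integral_mS (hη.smooth.of_le (by norm_num)) hη.hasCompactSupport]
  have c4 := fun k => (contDiff_pd (m := 3) hu.smooth (by norm_num) k).continuous
  have c3 := fun k => hη.pd_continuous k
  have c1 := hη.smooth.continuous
  have h := hθ.integral_le (f := fun x => η x - ∑ k, pd k η x * pd k u x)
    (h := fun _ => 1 + n * (D * |M|)) (by fun_prop)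
    (fun x hx => by simp [hη.zero x hx, hη.pd_zero x hx]) le_rfl le_rfl continuous_const
    (fun x _ => by positivity) (fun x _ hx => by
      have h1 : |∑ k, pd k η x * pd k u x| ≤ ∑ _k : Fin n, D * |M| :=
        (abs_sum_le_sum_abs _ _).trans (sum_le_sum fun k _ => by
          rw [abs_mul]
          exact mul_le_mul (hDb x k) ((hu.grad_le x hx k).trans (le_abs_self M))
            (abs_nonneg _) hD.le)
      simp only [sum_const, card_univ, Fintype.card_fin, nsmul_eq_mul] at h1
      linarith [hη.le_one x, neg_abs_le (∑ k, pd k η x * pd k u x)])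
  rw [integral_mul_const] at h
  linarith

/-- `∫ η σ` is bounded. -/
theorem Cut.exists_integral_mSig_le (hη : Cut r R η) (hR0 : 0 < R) (hR : R < 9 / 2) (hK : 0 ≤ K)
    (M : ℝ) : ∃ C > 0, ∀ (m₀ Λ C₁ : ℝ) (u : Eu n → ℝ), Sol K m₀ Λ C₁ M u →
      ∫ x, η x * mSig (hess u x) ≤ C := by
  obtain ⟨D, hD, hDb⟩ := hη.bound
  obtain ⟨R', hR1, hR2⟩ := exists_between hR
  obtain ⟨θ, hθ⟩ := exists_cut (n := n) hR0 hR1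
  obtain ⟨C, hC, key⟩ := hθ.exists_integral_mS_le (by linarith) hR2 M
  obtain ⟨c, hc⟩ : ∃ c, c = 1 / 2 * (n * (n * ((K + 2) * D * |M|))) := ⟨_, rfl⟩
  have hc0 : 0 ≤ c := by rw [hc]; positivity
  refine ⟨c * C + 1, by positivity, fun m₀ Λ C₁ u hu => ?_⟩
  rw [hu.integral_mSig (hη.smooth.of_le (by norm_num)) hη.hasCompactSupport]
  have c4 := fun k => (contDiff_pd (m := 3) hu.smooth (by norm_num) k).continuous
  have c3 := fun k => hη.pd_continuous k
  have c2 := fun i j => (contDiff_mP_hess hu.smooth i j).continuous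
  have c1 := (contDiff_mS_hess hu.smooth).continuous
  have h := hθ.integral_le
    (f := fun x => -(1 / 2 * ∑ i, ∑ j, mP (hess u x) i j * pd i η x * pd j u x))
    (h := fun x => c * mS (hess u x)) (by fun_prop)
    (fun x hx => by simp [hη.pd_zero x hx]) le_rfl hR2.le (by fun_prop)
    (fun x hx => mul_nonneg hc0 (by linarith [(hu.adm x hx).one_lt])) (fun x _ hx => by
      have hA := hu.adm x hx
      have hs := hA.one_lt
      have h1 := abs_sum_sum_le (a := fun i j => mP (hess u x) i j * pd i η x * pd j u x)
        (B := (K + 2) * mS (hess u x) * D * |M|) fun i j => by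
          rw [abs_mul, abs_mul]
          have := hA.abs_P_entry_le i j
          have := hDb x i
          have := (hu.grad_le x hx j).trans (le_abs_self M)
          gcongr
      have e : c * mS (hess u x) = 1 / 2 * (n * (n * ((K + 2) * mS (hess u x) * D * |M|))) := by
        rw [hc]; ring
      rw [e]
      linarith [neg_abs_le (∑ i, ∑ j, mP (hess u x) i j * pd i η x * pd j u x)])
  have e : ∀ x, θ x * (c * mS (hess u x)) = c * (θ x * mS (hess u x)) := fun x => by ring
  simp only [e] at h
  rw [integral_const_mul] at h
  have := mul_le_mul_of_nonneg_left (key K m₀ Λ C₁ u hu) hc0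
  linarith

/-- The energy of `bF` is bounded. -/
theorem Cut.exists_integral_qF_le (hη : Cut r R η) (hR0 : 0 < R) (hR : R < 9 / 2) (hK : 0 ≤ K)
    (M : ℝ) {J : ℝ} (hJ : 0 < J) : ∃ C > 0, ∀ (m₀ Λ C₁ N : ℝ) (Φ : ℝ → ℝ) (u : Eu n → ℝ),
      Sol K m₀ Λ C₁ M u → 2 ≤ N → LogLike N Φ →
      (∀ x, ‖x‖ < 9 / 2 → 1 / 40 * qF Φ u x ≤
        (mF (hess u x) * hess (bF Φ u) x).trace + J * mSig (hess u x)) →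
      ∫ x, η x ^ 2 * qF Φ u x ≤ C := by
  obtain ⟨D, hD, hDb⟩ := hη.bound
  obtain ⟨R', hR1, hR2⟩ := exists_between hR
  obtain ⟨θ, hθ⟩ := exists_cut (n := n) hR0 hR1
  obtain ⟨C, hC, key⟩ := hθ.exists_integral_mSig_le (by linarith) hR2 hK M
  obtain ⟨c, hc⟩ : ∃ c, c = J + 80 * ((1 + K) ^ 2 * (n * D ^ 2)) := ⟨_, rfl⟩
  have hc0 : 0 < c := by rw [hc]; positivity
  refine ⟨80 * (c * C), by positivity, fun m₀ Λ C₁ N Φ u hu hN hΦ hJac => ?_⟩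
  have c1 := hη.smooth.continuous
  have c2 := (contDiff_mSig_hess hu.smooth).continuous
  have c3 := fun k => hη.pd_continuous k
  have c4 := hu.continuous_pd_bF hΦ
  have c5 := hu.continuous_qF hΦ
  have c6 := fun i j => (contDiff_mF_hess hu.smooth i j).continuous
  have c7 : ∀ i j, Continuous (pd i (pd j (bF Φ u))) := fun i j =>
    (contDiff_pd (m := 0) (contDiff_pd (m := 1) (hu.contDiff_bF hΦ) (by norm_num) j)
      (by norm_num) i).continuous
  have hη2 := hη.sq
  have hpd : ∀ x k, pd k (fun x => η x ^ 2) x = 2 * η x * pd k η x := by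
    intro x k
    have d := hη.smooth.differentiable (by norm_num) x
    simp only [pow_two]
    rw [pd_mul k d d]; ring
  have h1 := integral_divFree (M := fun x => mF (hess u x)) (η := fun x => η x ^ 2)
    (w := fun j => pd j (bF Φ u)) (fun i j => (contDiff_mF_hess hu.smooth i j).of_le (by norm_num))
    (fun x j => sum_pd_mF_hess hu.smooth x j) (hη2.smooth.of_le (by norm_num))
    hη2.hasCompactSupport (fun j => contDiff_pd (m := 1) (hu.contDiff_bF hΦ) (by norm_num) j)
  have e1 : ∀ x, (mF (hess u x) * hess (bF Φ u) x).trace =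
      ∑ i, ∑ j, mF (hess u x) i j * pd i (pd j (bF Φ u)) x := by
    intro x
    refine sum_congr rfl fun i _ => ?_
    rw [diag_apply, Matrix.mul_apply]
    refine sum_congr rfl fun j _ => ?_
    rw [hess_symm (hu.contDiff_bF hΦ) x j i]
    rfl
  obtain ⟨a, ha⟩ : ∃ a : Eu n → ℝ, a = fun x =>
    ∑ i, ∑ j, mF (hess u x) i j * pd i (fun x => η x ^ 2) x * pd j (bF Φ u) x := ⟨_, rfl⟩
  have hac : Continuous a := by
    rw [ha]; simp only [hpd]; fun_prop
  have ha0 : ∀ x, R ≤ ‖x‖ → a x = 0 := fun x hx => by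
    rw [ha]; simp [hpd, hη.pd_zero x hx]
  have ha1 : ∀ x, a x = 2 * (gradV η x ⬝ᵥ (mF (hess u x) *ᵥ (η x • gradV (bF Φ u) x))) := by
    intro x
    rw [ha]
    simp only [dotProduct, mulVec, gradV, Pi.smul_apply, smul_eq_mul, mul_sum, hpd]
    exact sum_congr rfl fun i _ => sum_congr rfl fun j _ => by ring
  have h1' : ∫ x, η x ^ 2 * (∑ i, ∑ j, mF (hess u x) i j * pd i (pd j (bF Φ u)) x) =
      -∫ x, a x := by rw [ha]; exact h1
  have i1 : Integrable a := integrable_of_zero hac ha0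
  have i2 : Integrable fun x => η x ^ 2 * mSig (hess u x) := hη2.integrable_mul c2
  have i3 : Integrable fun x => η x ^ 2 * qF Φ u x := hη2.integrable_mul c5
  have i4 : Integrable fun x =>
      η x ^ 2 * (∑ i, ∑ j, mF (hess u x) i j * pd i (pd j (bF Φ u)) x) :=
    hη2.integrable_mul (by fun_prop)
  have h2 : 1 / 40 * ∫ x, η x ^ 2 * qF Φ u x ≤
      -(∫ x, a x) + J * ∫ x, η x ^ 2 * mSig (hess u x) := by
    rw [← h1', ← integral_const_mul, ← integral_const_mul, ← integral_add i4 (i2.const_mul J)]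
    refine integral_mono (i3.const_mul _) (i4.add (i2.const_mul J)) fun x => ?_
    simp only []
    rcases lt_or_ge ‖x‖ R with hx | hx
    · have := mul_le_mul_of_nonneg_left (hJac x (by linarith)) (sq_nonneg (η x))
      rw [e1] at this
      linarith
    · rw [hη.zero x hx]; simp
  have h3 := hθ.integral_le
    (f := fun x => J * (η x ^ 2 * mSig (hess u x)) - (a x + 1 / 80 * (η x ^ 2 * qF Φ u x)))
    (h := fun x => c * mSig (hess u x)) (by fun_prop)
    (fun x hx => by simp [hη.zero x hx, ha0 x hx]) le_rfl hR2.le (by fun_prop)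
    (fun x hx => mul_nonneg hc0.le (hu.adm x hx).sig_pos.le) (fun x _ hx => by
      have hA := hu.adm x hx
      have hσ := hA.sig_pos
      have hq := hu.qF_nonneg (Φ := Φ) hx
      have g1 : J * (η x ^ 2 * mSig (hess u x)) ≤ J * (1 * mSig (hess u x)) := by
        have := pow_le_one₀ (n := 2) (hη.nonneg x) (hη.le_one x)
        gcongr
      have g2 : -a x ≤ 80 * ((1 + K) ^ 2 * (n * D ^ 2)) * mSig (hess u x) +
          1 / 80 * (η x ^ 2 * qF Φ u x) := by
        rcases le_total (mS (hess u x)) N with hs | hs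
        · have : a x = 0 := by
            rw [ha1, hu.gradV_bF_eq_zero hΦ hs]; simp
          rw [this, neg_zero]
          positivity
        · have g3 := hA.F_cross (ε := 80) (by norm_num) (gradV η x) (η x • gradV (bF Φ u) x)
          have g4 := hA.F_le (by linarith) (gradV η x)
          have g5 : ∑ i, gradV η x i ^ 2 ≤ n * D ^ 2 := by
            calc _ ≤ ∑ _i : Fin n, D ^ 2 := sum_le_sum fun i _ => by
                  rw [← sq_abs]; exact pow_le_pow_left₀ (abs_nonneg _) (hDb x i) 2
              _ = _ := by simp
          have g6 : (η x • gradV (bF Φ u) x) ⬝ᵥ (mF (hess u x) *ᵥ (η x • gradV (bF Φ u) x)) =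
              η x ^ 2 * qF Φ u x := by
            rw [mulVec_smul, dotProduct_smul, smul_dotProduct, smul_eq_mul, smul_eq_mul, qF]; ring
          rw [g6] at g3
          have g7 : (1 + K) ^ 2 * mSig (hess u x) * ∑ i, gradV η x i ^ 2 ≤
              (1 + K) ^ 2 * mSig (hess u x) * (n * D ^ 2) := by gcongr
          have g8 : -a x ≤ 2 * |gradV η x ⬝ᵥ (mF (hess u x) *ᵥ (η x • gradV (bF Φ u) x))| := by
            rw [ha1]
            linarith [neg_abs_le (gradV η x ⬝ᵥ (mF (hess u x) *ᵥ (η x • gradV (bF Φ u) x)))]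
          norm_num at g3
          linarith
      rw [hc]
      linarith)
  have i5 : Integrable fun x => 1 / 80 * (η x ^ 2 * qF Φ u x) := i3.const_mul _
  have i6 : Integrable fun x => a x + 1 / 80 * (η x ^ 2 * qF Φ u x) := i1.add i5
  rw [integral_sub (i2.const_mul J) i6, integral_add i1 i5, integral_const_mul,
    integral_const_mul] at h3
  have e : ∀ x, θ x * (c * mSig (hess u x)) = c * (θ x * mSig (hess u x)) := fun x => by ring
  simp only [e] at h3
  rw [integral_const_mul] at h3
  have := mul_le_mul_of_nonneg_left (key m₀ Λ C₁ u hu) hc0.le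
  linarith

theorem Sol.pd_mul_bF (hu : Sol K m₀ Λ C₁ M u) (hΦ : LogLike N Φ) (hη : Cut r R η) (x : Eu n)
    (k : Fin n) : pd k (fun x => η x * bF Φ u x) x =
      pd k η x * bF Φ u x + η x * pd k (bF Φ u) x :=
  pd_mul k (hη.smooth.differentiable (by norm_num) x)
    ((hu.contDiff_bF hΦ).differentiable (by norm_num) x)

/-- `∫ η b (1 + Δu)` is bounded. -/
theorem Cut.exists_integral_bF_mS_le (hη : Cut r R η) (hR0 : 0 < R) (hR : R < 9 / 2) (hK : 0 ≤ K)
    (M : ℝ) {J : ℝ} (hJ : 0 < J) (hm : 0 < m₀) :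
    ∃ C > 0, ∀ (Λ C₁ N : ℝ) (Φ : ℝ → ℝ) (u : Eu n → ℝ),
      Sol K m₀ Λ C₁ M u → 2 ≤ N → LogLike N Φ →
      (∀ x, ‖x‖ < 9 / 2 → 1 / 40 * qF Φ u x ≤
        (mF (hess u x) * hess (bF Φ u) x).trace + J * mSig (hess u x)) →
      ∫ x, η x * bF Φ u x * mS (hess u x) ≤ C := by
  obtain ⟨D, hD, hDb⟩ := hη.bound
  obtain ⟨R', hR1, hR2⟩ := exists_between hR
  obtain ⟨θ, hθ⟩ := exists_cut (n := n) hR0 hR1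
  obtain ⟨Ca, hCa, keya⟩ := hθ.sq.exists_integral_mS_le (by linarith) hR2 M
  obtain ⟨Cq, hCq, keyq⟩ := hθ.exists_integral_qF_le (by linarith) hR2 hK M hJ
  obtain ⟨Cb, hCb, keyb⟩ := exists_abs_pd_bF_le n hm
  obtain ⟨c, hc⟩ : ∃ c, c = 1 + n * ((D + 1 + Cb) * |M|) := ⟨_, rfl⟩
  have hc0 : 0 < c := by rw [hc]; positivity
  refine ⟨c * (Ca + Cq), by positivity, fun Λ C₁ N Φ u hu hN hΦ hJac => ?_⟩
  have hbC := hu.contDiff_bF hΦ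
  have c1 := hη.smooth.continuous
  have c2 := (contDiff_mS_hess hu.smooth).continuous
  have c3 := fun k => hη.pd_continuous k
  have c4 := hu.continuous_pd_bF hΦ
  have c5 := hu.continuous_qF hΦ
  have c6 := hbC.continuous
  have c7 := fun k => (contDiff_pd (m := 3) hu.smooth (by norm_num) k).continuous
  rw [hu.integral_mS (η := fun x => η x * bF Φ u x)
    ((hη.smooth.of_le (by norm_num)).mul (hbC.of_le (by norm_num))) hη.hasCompactSupport.mul_right]
  simp only [hu.pd_mul_bF hΦ hη]
  have h := hθ.sq.integral_le (f := fun x => η x * bF Φ u x -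
      ∑ k, (pd k η x * bF Φ u x + η x * pd k (bF Φ u) x) * pd k u x)
    (h := fun x => c * (mS (hess u x) + qF Φ u x)) (by fun_prop)
    (fun x hx => by simp [hη.zero x hx, hη.pd_zero x hx]) le_rfl hR2.le (by fun_prop)
    (fun x hx => mul_nonneg hc0.le
      (by linarith [(hu.adm x hx).one_lt, hu.qF_nonneg (Φ := Φ) hx])) (fun x _ hx => by
      have hs := (hu.adm x hx).one_lt
      have hq := hu.qF_nonneg (Φ := Φ) hx
      have hb := hu.bF_le hΦ hx
      have hb0 : 0 ≤ bF Φ u x := hΦ.nonneg _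
      have g0 := hη.nonneg x
      have g1 := hη.le_one x
      have h1 : ∀ k, |(pd k η x * bF Φ u x + η x * pd k (bF Φ u) x) * pd k u x| ≤
          ((D + 1 + Cb) * (mS (hess u x) + qF Φ u x)) * |M| := by
        intro k
        rw [abs_mul]
        have g2 := (hu.grad_le x hx k).trans (le_abs_self M)
        have g3 := keyb K Λ C₁ M N Φ u hu hN hΦ x hx k
        have g4 : |pd k η x * bF Φ u x + η x * pd k (bF Φ u) x| ≤
            (D + 1 + Cb) * (mS (hess u x) + qF Φ u x) := by
          have g5 : |pd k η x * bF Φ u x| ≤ D * mS (hess u x) := by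
            rw [abs_mul, abs_of_nonneg hb0]
            exact mul_le_mul (hDb x k) hb hb0 hD.le
          have g6 : |η x * pd k (bF Φ u) x| ≤ 1 * (mS (hess u x) + Cb * qF Φ u x) := by
            rw [abs_mul, abs_of_nonneg g0]
            exact mul_le_mul g1 g3 (abs_nonneg _) zero_le_one
          have g7 := abs_add_le (pd k η x * bF Φ u x) (η x * pd k (bF Φ u) x)
          have := mul_nonneg hD.le hq
          have := mul_pos hCb (by linarith : 0 < mS (hess u x))
          linarith
        exact mul_le_mul g4 g2 (abs_nonneg _) (by positivity)
      have h2 : |∑ k, (pd k η x * bF Φ u x + η x * pd k (bF Φ u) x) * pd k u x| ≤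
          n * (((D + 1 + Cb) * (mS (hess u x) + qF Φ u x)) * |M|) := by
        calc _ ≤ ∑ _k : Fin n, ((D + 1 + Cb) * (mS (hess u x) + qF Φ u x)) * |M| :=
              (abs_sum_le_sum_abs _ _).trans (sum_le_sum fun k _ => h1 k)
          _ = _ := by simp
      have h3 : η x * bF Φ u x ≤ 1 * mS (hess u x) := mul_le_mul g1 hb hb0 zero_le_one
      rw [hc]
      linarith [neg_abs_le (∑ k, (pd k η x * bF Φ u x + η x * pd k (bF Φ u) x) * pd k u x)])
  have e : ∀ x, θ x ^ 2 * (c * (mS (hess u x) + qF Φ u x)) =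
      c * (θ x ^ 2 * mS (hess u x) + θ x ^ 2 * qF Φ u x) := fun x => by ring
  simp only [e] at h
  rw [integral_const_mul, integral_add (hθ.sq.integrable_mul c2) (hθ.sq.integrable_mul c5)] at h
  have h1 := mul_le_mul_of_nonneg_left (keya K m₀ Λ C₁ u hu) hc0.le
  have h2 := mul_le_mul_of_nonneg_left (keyq m₀ Λ C₁ N Φ u hu hN hΦ hJac) hc0.le
  linarith

/-- `∫ η b σ` is bounded. -/
theorem Cut.exists_integral_bF_mSig_le (hη : Cut r R η) (hR0 : 0 < R) (hR : R < 9 / 2)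
    (hK : 0 ≤ K) (M : ℝ) {J : ℝ} (hJ : 0 < J) (hm : 0 < m₀) :
    ∃ C > 0, ∀ (Λ C₁ N : ℝ) (Φ : ℝ → ℝ) (u : Eu n → ℝ),
      Sol K m₀ Λ C₁ M u → 2 ≤ N → LogLike N Φ →
      (∀ x, ‖x‖ < 9 / 2 → 1 / 40 * qF Φ u x ≤
        (mF (hess u x) * hess (bF Φ u) x).trace + J * mSig (hess u x)) →
      ∫ x, η x * bF Φ u x * mSig (hess u x) ≤ C := by
  obtain ⟨D, hD, hDb⟩ := hη.bound
  obtain ⟨R', hR1, hR2⟩ := exists_between hR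
  obtain ⟨θ, hθ⟩ := exists_cut (n := n) hR0 hR1
  obtain ⟨Ca, hCa, keya⟩ := hθ.sq.exists_integral_bF_mS_le (by linarith) hR2 hK M hJ hm
  obtain ⟨Cq, hCq, keyq⟩ := hθ.exists_integral_qF_le (by linarith) hR2 hK M hJ
  obtain ⟨Cs, hCs, keys⟩ := hθ.sq.exists_integral_mSig_le (by linarith) hR2 hK M
  obtain ⟨Cp, hCp, keyp⟩ := MAdm.P_mulVec_le n hm
  obtain ⟨E, hE⟩ : ∃ E, E = Cp * (n * M ^ 2) := ⟨_, rfl⟩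
  have hE0 : 0 ≤ E := by rw [hE]; positivity
  obtain ⟨c, hc⟩ : ∃ c, c = 1 + E + 1 / 2 * (n * (n * ((K + 2) * D * |M|))) := ⟨_, rfl⟩
  have hc0 : 0 < c := by rw [hc]; positivity
  refine ⟨c * (Ca + Cs + Cq), by positivity, fun Λ C₁ N Φ u hu hN hΦ hJac => ?_⟩
  have hbC := hu.contDiff_bF hΦ
  have c1 := hη.smooth.continuous
  have c2 := (contDiff_mS_hess hu.smooth).continuous
  have c3 := fun k => hη.pd_continuous k
  have c4 := hu.continuous_pd_bF hΦ
  have c5 := hu.continuous_qF hΦ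
  have c6 := hbC.continuous
  have c7 := fun k => (contDiff_pd (m := 3) hu.smooth (by norm_num) k).continuous
  have c8 := (contDiff_mSig_hess hu.smooth).continuous
  have c9 := fun i j => (contDiff_mP_hess hu.smooth i j).continuous
  rw [hu.integral_mSig (η := fun x => η x * bF Φ u x)
    ((hη.smooth.of_le (by norm_num)).mul (hbC.of_le (by norm_num))) hη.hasCompactSupport.mul_right]
  simp only [hu.pd_mul_bF hΦ hη]
  have h := hθ.sq.integral_le (f := fun x => -(1 / 2 * ∑ i, ∑ j, mP (hess u x) i j *
      (pd i η x * bF Φ u x + η x * pd i (bF Φ u) x) * pd j u x))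
    (h := fun x => c * (bF Φ u x * mS (hess u x) + mSig (hess u x) + qF Φ u x)) (by fun_prop)
    (fun x hx => by simp [hη.zero x hx, hη.pd_zero x hx]) le_rfl hR2.le (by fun_prop)
    (fun x hx => by
      have hs := (hu.adm x hx).one_lt
      have hσ := (hu.adm x hx).sig_pos
      have hq := hu.qF_nonneg (Φ := Φ) hx
      have hb0 : 0 ≤ bF Φ u x := hΦ.nonneg _
      positivity) (fun x _ hx => by
      have hA := hu.adm x hx
      have hs := hA.one_lt
      have hσ := hA.sig_pos
      have hq := hu.qF_nonneg (Φ := Φ) hx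
      have hb0 : 0 ≤ bF Φ u x := hΦ.nonneg _
      have g0 := hη.nonneg x
      have g1 := hη.le_one x
      have e : ∑ i, ∑ j, mP (hess u x) i j *
          (pd i η x * bF Φ u x + η x * pd i (bF Φ u) x) * pd j u x =
          bF Φ u x * (∑ i, ∑ j, mP (hess u x) i j * pd i η x * pd j u x) +
          η x * (gradV u x ⬝ᵥ (mP (hess u x) *ᵥ gradV (bF Φ u) x)) := by
        have e1 : gradV u x ⬝ᵥ (mP (hess u x) *ᵥ gradV (bF Φ u) x) =
            ∑ i, ∑ j, mP (hess u x) i j * pd i (bF Φ u) x * pd j u x := by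
          simp only [dotProduct, mulVec, gradV, mul_sum]
          rw [sum_comm]
          refine sum_congr rfl fun i _ => sum_congr rfl fun j _ => ?_
          have : mP (hess u x) j i = mP (hess u x) i j := by
            simp only [mP, Matrix.sub_apply, Matrix.smul_apply, Matrix.one_apply, hA.isSymm j i,
              eq_comm]
          rw [this]; ring
        rw [e1, mul_sum, mul_sum, ← sum_add_distrib]
        refine sum_congr rfl fun i _ => ?_
        rw [mul_sum, mul_sum, ← sum_add_distrib]
        exact sum_congr rfl fun j _ => by ring
      have h1 := abs_sum_sum_le (a := fun i j => mP (hess u x) i j * pd i η x * pd j u x)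
        (B := (K + 2) * mS (hess u x) * D * |M|) fun i j => by
          rw [abs_mul, abs_mul]
          have := hA.abs_P_entry_le i j
          have := hDb x i
          have := (hu.grad_le x hx j).trans (le_abs_self M)
          gcongr
      have h2 : |gradV u x ⬝ᵥ (mP (hess u x) *ᵥ gradV (bF Φ u) x)| ≤
          mSig (hess u x) + E * qF Φ u x := by
        rcases le_total (mS (hess u x)) N with hs' | hs'
        · rw [hu.gradV_bF_eq_zero hΦ hs']
          simp only [mulVec_zero, dotProduct_zero, abs_zero]
          positivity
        · have g2 := keyp K Λ _ hA (by linarith) (gradV (bF Φ u) x) (gradV u x)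
          have g3 : ∑ i, gradV u x i ^ 2 ≤ n * M ^ 2 := by
            calc _ ≤ ∑ _i : Fin n, M ^ 2 := sum_le_sum fun i _ => by
                  rw [← sq_abs]; exact pow_le_pow_left₀ (abs_nonneg _) (hu.grad_le x hx i) 2
              _ = _ := by simp
          have g4 : Cp * (∑ i, gradV u x i ^ 2) * (mSig (hess u x) * qF Φ u x) ≤
              Cp * (n * M ^ 2) * (mSig (hess u x) * qF Φ u x) := by gcongr
          rw [← hE] at g4
          refine abs_le_of_sq_le_sq ?_ (by positivity)
          have g5 := mul_nonneg (mul_nonneg hE0 hσ.le) hq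
          have g6 : (gradV u x ⬝ᵥ (mP (hess u x) *ᵥ gradV (bF Φ u) x)) ^ 2 ≤
            Cp * (∑ i, gradV u x i ^ 2) * (mSig (hess u x) * qF Φ u x) := g2
          nlinarith [sq_nonneg (mSig (hess u x)), sq_nonneg (E * qF Φ u x)]
      have h3 : η x * |gradV u x ⬝ᵥ (mP (hess u x) *ᵥ gradV (bF Φ u) x)| ≤
          1 * (mSig (hess u x) + E * qF Φ u x) := mul_le_mul g1 h2 (abs_nonneg _) zero_le_one
      have h4 : bF Φ u x * |∑ i, ∑ j, mP (hess u x) i j * pd i η x * pd j u x| ≤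
          bF Φ u x * (n * (n * ((K + 2) * mS (hess u x) * D * |M|))) := by gcongr
      have h5 : -(bF Φ u x * (∑ i, ∑ j, mP (hess u x) i j * pd i η x * pd j u x)) ≤
          bF Φ u x * |∑ i, ∑ j, mP (hess u x) i j * pd i η x * pd j u x| := by
        rw [← mul_neg]; exact mul_le_mul_of_nonneg_left (neg_le_abs _) hb0
      have h6 : -(η x * (gradV u x ⬝ᵥ (mP (hess u x) *ᵥ gradV (bF Φ u) x))) ≤
          η x * |gradV u x ⬝ᵥ (mP (hess u x) *ᵥ gradV (bF Φ u) x)| := by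
        rw [← mul_neg]; exact mul_le_mul_of_nonneg_left (neg_le_abs _) g0
      obtain ⟨d, hd⟩ : ∃ d, d = 1 / 2 * (n * (n * ((K + 2) * D * |M|))) := ⟨_, rfl⟩
      have hd0 : 0 ≤ d := by rw [hd]; positivity
      have h7 : 1 / 2 * (bF Φ u x * (n * (n * ((K + 2) * mS (hess u x) * D * |M|)))) =
          d * (bF Φ u x * mS (hess u x)) := by rw [hd]; ring
      rw [e, hc, ← hd]
      have p1 : 0 ≤ bF Φ u x * mS (hess u x) := by positivity
      have p2 := mul_nonneg hE0 p1
      have p3 := mul_nonneg hE0 hσ.le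
      have p4 := mul_nonneg hE0 hq
      have p5 := mul_nonneg hd0 hσ.le
      have p6 := mul_nonneg hd0 hq
      linarith)
  have e : ∀ x, θ x ^ 2 * (c * (bF Φ u x * mS (hess u x) + mSig (hess u x) + qF Φ u x)) =
      c * (θ x ^ 2 * bF Φ u x * mS (hess u x) + θ x ^ 2 * mSig (hess u x) +
        θ x ^ 2 * qF Φ u x) := fun x => by ring
  simp only [e] at h
  have i1 : Integrable fun x => θ x ^ 2 * bF Φ u x * mS (hess u x) := by
    simp only [mul_assoc]
    exact hθ.sq.integrable_mul (c6.mul c2)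
  have i2 := hθ.sq.integrable_mul c8
  have i3 := hθ.sq.integrable_mul c5
  have i4 : Integrable fun x => θ x ^ 2 * bF Φ u x * mS (hess u x) + θ x ^ 2 * mSig (hess u x) :=
    i1.add i2
  rw [integral_const_mul, integral_add i4 i3, integral_add i1 i2] at h
  have h1 := mul_le_mul_of_nonneg_left (keya Λ C₁ N Φ u hu hN hΦ hJac) hc0.le
  have h2 := mul_le_mul_of_nonneg_left (keyq m₀ Λ C₁ N Φ u hu hN hΦ hJac) hc0.le
  have h3 := mul_le_mul_of_nonneg_left (keys m₀ Λ C₁ u hu) hc0.le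
  linarith

end EnergyEstimates

section ContactCalculus

open Finset Matrix MeasureTheory

variable {n : ℕ}

/-! ### Second-order conditions and the shifted gradient map -/

theorem hasDerivAt_line {g : Eu n → ℝ} (hg : Differentiable ℝ g) (x v : Eu n) (t : ℝ) :
    HasDerivAt (fun t : ℝ => g (x + t • v)) (∑ i, v i * pd i g (x + t • v)) t := by
  have h1 : HasDerivAt (fun t : ℝ => x + t • v) v t := by
    simpa using ((hasDerivAt_id t).smul_const v).const_add x
  have := (hg (x + t • v)).hasFDerivAt.comp_hasDerivAt t h1
  rwa [fderiv_eq_sum] at this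

theorem pd_eq_zero_of_isLocalMin {g : Eu n → ℝ} {x : Eu n} (h : IsLocalMin g x) (i : Fin n) :
    pd i g x = 0 := by
  rw [pd, h.fderiv_eq_zero]; rfl

theorem deriv_deriv_nonneg_of_isLocalMin {h : ℝ → ℝ} {t : ℝ} (hd : ContinuousAt h t)
    (hm : IsLocalMin h t) : 0 ≤ deriv (deriv h) t := by
  by_contra! hc
  have h1 := isLocalMax_of_deriv_deriv_neg hc hm.deriv_eq_zero hd
  have h2 : h =ᶠ[nhds t] fun _ => h t := by
    filter_upwards [hm, h1] with s h3 h4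
    exact le_antisymm h4 h3
  rw [h2.deriv.deriv_eq] at hc
  simp at hc

theorem hess_nonneg_of_isLocalMin {g : Eu n → ℝ} (hg : ContDiff ℝ 2 g) {x : Eu n}
    (h : IsLocalMin g x) (v : Fin n → ℝ) : 0 ≤ v ⬝ᵥ (hess g x *ᵥ v) := by
  obtain ⟨w, hw⟩ : ∃ w : Eu n, w = WithLp.toLp 2 v := ⟨_, rfl⟩
  have hwi : ∀ i, w i = v i := fun i => by rw [hw]
  have d0 := hg.differentiable (by norm_num)
  have d1 : ∀ i, Differentiable ℝ (pd i g) := fun i =>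
    (contDiff_pd (m := 1) hg (by norm_num) i).differentiable (by norm_num)
  have e1 : deriv (fun t : ℝ => g (x + t • w)) = fun t => ∑ i, w i * pd i g (x + t • w) :=
    funext fun t => (hasDerivAt_line d0 x w t).deriv
  have e2 : deriv (deriv fun t : ℝ => g (x + t • w)) 0 = v ⬝ᵥ (hess g x *ᵥ v) := by
    rw [e1]
    have := HasDerivAt.fun_sum (u := univ) fun i _ => (hasDerivAt_line (d1 i) x w 0).const_mul (w i)
    rw [this.deriv]
    simp only [zero_smul, add_zero, dotProduct, mulVec, mul_sum, hwi]
    rw [sum_comm]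
    exact sum_congr rfl fun i _ => sum_congr rfl fun j _ => by
      rw [show hess g x i j = pd i (pd j g) x from rfl]; ring
  have hc : ContinuousAt (fun t : ℝ => x + t • w) 0 := by fun_prop
  rw [← e2]
  refine deriv_deriv_nonneg_of_isLocalMin (hasDerivAt_line d0 x w 0).continuousAt ?_
  have h0 : x + (0 : ℝ) • w = x := by simp
  have h' : ∀ᶠ y in nhds (x + (0 : ℝ) • w), g x ≤ g y := by rw [h0]; exact h
  filter_upwards [hc.eventually h'] with t ht
  simpa using ht

/-- The gradient of `u + (K + 1)|x|² / 2`. -/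
def sG (K : ℝ) (u : Eu n → ℝ) (x : Eu n) : Eu n :=
  WithLp.toLp 2 fun k => pd k u x + (K + 1) * x k

/-- The Hessian of `u + (K + 1)|x|² / 2`. -/
def sV (K : ℝ) (u : Eu n → ℝ) (x : Eu n) : Matrix (Fin n) (Fin n) ℝ :=
  hess u x + (K + 1) • (1 : Matrix (Fin n) (Fin n) ℝ)

variable {u : Eu n → ℝ} (K : ℝ)

theorem sG_apply (x : Eu n) (k : Fin n) : sG K u x k = pd k u x + (K + 1) * x k := rfl

theorem contDiff_coord (k : Fin n) : ContDiff ℝ 3 fun x : Eu n => x k :=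
  (EuclideanSpace.proj k : Eu n →L[ℝ] ℝ).contDiff

theorem pd_coord (i k : Fin n) (x : Eu n) :
    pd i (fun y : Eu n => y k) x = (1 : Matrix (Fin n) (Fin n) ℝ) i k := by
  have h : HasFDerivAt (fun y : Eu n => y k) (EuclideanSpace.proj k : Eu n →L[ℝ] ℝ) x :=
    (EuclideanSpace.proj k : Eu n →L[ℝ] ℝ).hasFDerivAt
  rw [pd, h.fderiv, Matrix.one_apply]
  simp [eq_comm]

theorem contDiff_sG (hu : ContDiff ℝ 4 u) (k : Fin n) : ContDiff ℝ 3 fun x => sG K u x k := by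
  simp only [sG_apply]
  exact (contDiff_pd (m := 3) hu (by norm_num) k).add (contDiff_const.mul (contDiff_coord k))

theorem contDiff_sV (hu : ContDiff ℝ 4 u) (i j : Fin n) : ContDiff ℝ 2 fun x => sV K u x i j :=
  (contDiff_hess hu i j).add contDiff_const

theorem sV_symm (hu : ContDiff ℝ 4 u) (x : Eu n) (i j : Fin n) : sV K u x i j = sV K u x j i := by
  simp only [sV, Matrix.add_apply, Matrix.smul_apply, hess_symm (hu.of_le (by norm_num)) x i j]
  rw [Matrix.one_apply, Matrix.one_apply]
  simp only [eq_comm]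

theorem pd_sG (hu : ContDiff ℝ 4 u) (x : Eu n) (i k : Fin n) :
    pd i (fun y => sG K u y k) x = sV K u x i k := by
  simp only [sG_apply]
  have d1 := (contDiff_pd (m := 3) hu (by norm_num) k).differentiable (by norm_num) x
  have d2 := (contDiff_coord k).differentiable (by norm_num) x
  rw [pd_add i d1 (d2.const_mul _), pd_const_mul i _ d2, pd_coord]
  rfl

theorem pd_sV (hu : ContDiff ℝ 4 u) (x : Eu n) (k i j : Fin n) :
    pd k (fun y => sV K u y i j) x = pdM k (hess u) x i j := by
  have d1 := (contDiff_hess hu i j).differentiable (by norm_num) x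
  have := pd_add k d1 (differentiableAt_const (((K + 1) • (1 : Matrix (Fin n) (Fin n) ℝ)) i j))
  rw [pd_const, add_zero] at this
  exact this

variable {K}

/-- The shifted gradient map is strongly monotone. -/
theorem Sol.norm_sq_le_inner_sG {m₀ Λ C₁ M : ℝ} (hu : Sol K m₀ Λ C₁ M u) {x : Eu n}
    (hx : ‖x‖ < 9 / 2) : ‖x‖ ^ 2 ≤ ∑ k, x k * (sG K u x k - sG K u 0 k) := by
  have d : ∀ k, Differentiable ℝ fun y => sG K u y k := fun k =>
    (contDiff_sG K hu.smooth k).differentiable (by norm_num)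
  have hd : ∀ t : ℝ, HasDerivAt (fun t : ℝ => ∑ k, x k * sG K u (0 + t • x) k)
      (∑ k, x k * ∑ i, x i * pd i (fun y => sG K u y k) (0 + t • x)) t := fun t =>
    HasDerivAt.fun_sum fun k _ => (hasDerivAt_line (d k) 0 x t).const_mul (x k)
  obtain ⟨c, hc, he⟩ := exists_hasDerivAt_eq_slope _ _ zero_lt_one
    (fun t _ => (hd t).continuousAt.continuousWithinAt) fun t _ => hd t
  have hcx : ‖c • x‖ < 9 / 2 := by
    rw [norm_smul, Real.norm_of_nonneg hc.1.le]
    exact (mul_le_of_le_one_left (norm_nonneg x) hc.2.le).trans_lt hx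
  have h1 := (hu.adm _ hcx).shift_ge fun i => x i
  have h2 : ∑ k, x k * ∑ i, x i * pd i (fun y => sG K u y k) (0 + c • x) =
      (fun i => x i) ⬝ᵥ (sV K u (c • x) *ᵥ fun i => x i) := by
    simp only [dotProduct, mulVec, pd_sG K hu.smooth, zero_add]
    exact sum_congr rfl fun k _ => congrArg _ <| sum_congr rfl fun i _ => by
      rw [sV_symm K hu.smooth, mul_comm]
  rw [EuclideanSpace.real_norm_sq_eq]
  have h3 : ∑ k, x k * (sG K u x k - sG K u 0 k) =
      ∑ k, x k * ∑ i, x i * pd i (fun y => sG K u y k) (0 + c • x) := by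
    rw [he]
    simp [mul_sub, sum_sub_distrib]
  rw [h3, h2]
  exact h1

end ContactCalculus

section Contact

open Finset Matrix MeasureTheory

variable {n : ℕ}

/-! ### The contact map -/

theorem MDiff.det {A : Eu n → Matrix (Fin n) (Fin n) ℝ} {x : Eu n} (hA : MDiff A x) :
    DifferentiableAt ℝ (fun y => (A y).det) x := by
  simp only [det_apply]
  refine DifferentiableAt.fun_sum fun p _ => DifferentiableAt.const_smul ?_ _
  exact (HasFDerivAt.finsetProd (g := fun i y => A y (p i) i)
    fun i _ => (hA _ _).hasFDerivAt).differentiableAt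

theorem MDiff.inv {A : Eu n → Matrix (Fin n) (Fin n) ℝ} {x : Eu n} (hA : MDiff A x)
    (hd : (A x).det ≠ 0) : MDiff (fun y => (A y)⁻¹) x := by
  intro i j
  simp only [Matrix.inv_def, Matrix.smul_apply, Ring.inverse_eq_inv', adjugate_apply, smul_eq_mul]
  refine (hA.det.fun_inv hd).mul (MDiff.det fun k l => ?_)
  simp only [updateRow_apply]
  split_ifs
  · exact differentiableAt_const _
  · exact hA k l

theorem det_fderiv_eq {T : Eu n → Eu n} {x : Eu n} (hT : DifferentiableAt ℝ T x) :
    (fderiv ℝ T x).det = (Matrix.of fun k i => pd i (fun y => T y k) x).det := by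
  have h : ∀ k i, pd i (fun y => T y k) x = (fderiv ℝ T x (EuclideanSpace.single i 1)) k := by
    intro k i
    have h1 : HasFDerivAt (fun y => T y k) _ x :=
      (EuclideanSpace.proj k : Eu n →L[ℝ] ℝ).hasFDerivAt.comp x hT.hasFDerivAt
    rw [pd, h1.fderiv]
    rfl
  rw [ContinuousLinearMap.det, ← LinearMap.det_toMatrix (EuclideanSpace.basisFun (Fin n) ℝ).toBasis]
  congr 1
  ext k i
  rw [LinearMap.toMatrix_apply, Matrix.of_apply, h]
  simp

/-- The reciprocal of `1 + bF`. -/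
def rF (Φ : ℝ → ℝ) (u : Eu n → ℝ) (x : Eu n) : ℝ := (bF Φ u x + 1)⁻¹

/-- The contact map of `B / (1 + bF)` with respect to the shifted gradient. -/
def cT (K B : ℝ) (Φ : ℝ → ℝ) (u : Eu n → ℝ) (x : Eu n) : Eu n :=
  WithLp.toLp 2 fun k => sG K u x k + B / 8 * ∑ j, (sV K u x)⁻¹ k j * pd j (rF Φ u) x

theorem cT_apply (K B : ℝ) (Φ : ℝ → ℝ) (u : Eu n → ℝ) (x : Eu n) (k : Fin n) :
    cT K B Φ u x k = sG K u x k + B / 8 * ∑ j, (sV K u x)⁻¹ k j * pd j (rF Φ u) x := rfl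

/-- The function minimized at contact points. -/
def cG (K B : ℝ) (Φ : ℝ → ℝ) (u : Eu n → ℝ) (y x : Eu n) : ℝ :=
  B * rF Φ u x + 4 * ∑ k, (sG K u x k - y k) ^ 2

variable {K m₀ Λ C₁ M N B : ℝ} {Φ : ℝ → ℝ} {u : Eu n → ℝ}

theorem rF_pos (hΦ : LogLike N Φ) (x : Eu n) : 0 < rF Φ u x :=
  inv_pos.2 (by linarith [hΦ.nonneg (mS (hess u x)), show bF Φ u x = Φ (mS (hess u x)) from rfl])

namespace Sol

theorem contDiff_rF (hu : Sol K m₀ Λ C₁ M u) (hΦ : LogLike N Φ) : ContDiff ℝ 2 (rF Φ u) :=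
  ((hu.contDiff_bF hΦ).add contDiff_const).inv fun x => (inv_pos.1 (rF_pos hΦ x)).ne'

theorem pd_rF (hu : Sol K m₀ Λ C₁ M u) (hΦ : LogLike N Φ) (x : Eu n) (j : Fin n) :
    pd j (rF Φ u) x = -(rF Φ u x ^ 2 * pd j (bF Φ u) x) := by
  have hne := (inv_pos.1 (rF_pos (u := u) hΦ x)).ne'
  have h1 : HasDerivAt (fun t : ℝ => (t + 1)⁻¹) (-1 / (bF Φ u x + 1) ^ 2) (bF Φ u x) :=
    ((hasDerivAt_id _).add_const 1).inv hne
  have h2 := pd_comp (Φ := fun t : ℝ => (t + 1)⁻¹) j h1.differentiableAt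
    ((hu.contDiff_bF hΦ).differentiable (by norm_num) x)
  rw [h1.deriv] at h2
  refine h2.trans ?_
  rw [rF]
  field_simp

theorem hess_rF (hu : Sol K m₀ Λ C₁ M u) (hΦ : LogLike N Φ) (x : Eu n) :
    hess (rF Φ u) x = (2 * rF Φ u x ^ 3) • vecMulVec (gradV (bF Φ u) x) (gradV (bF Φ u) x) -
      rF Φ u x ^ 2 • hess (bF Φ u) x := by
  ext i j
  have e : pd j (rF Φ u) = fun y => (-1) * (rF Φ u y * rF Φ u y * pd j (bF Φ u) y) := by
    funext y; rw [hu.pd_rF hΦ]; ring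
  have d1 := (hu.contDiff_rF hΦ).differentiable (by norm_num) x
  have d2 := (contDiff_pd (m := 1) (hu.contDiff_bF hΦ) (by norm_num) j).differentiable
    (by norm_num) x
  show pd i (pd j (rF Φ u)) x = 2 * rF Φ u x ^ 3 * (pd i (bF Φ u) x * pd j (bF Φ u) x) -
    rF Φ u x ^ 2 * pd i (pd j (bF Φ u)) x
  have d3 : DifferentiableAt ℝ (fun y => rF Φ u y * rF Φ u y) x := d1.mul d1
  have d4 : DifferentiableAt ℝ (fun y => rF Φ u y * rF Φ u y * pd j (bF Φ u) y) x := d3.mul d2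
  rw [e, pd_const_mul i _ d4, pd_mul i d3 d2, pd_mul i d1 d1, hu.pd_rF hΦ]
  ring

theorem trace_mul_hess_rF (hu : Sol K m₀ Λ C₁ M u) (hΦ : LogLike N Φ) (x : Eu n) :
    (mF (hess u x) * hess (rF Φ u) x).trace = 2 * rF Φ u x ^ 3 * qF Φ u x -
      rF Φ u x ^ 2 * (mF (hess u x) * hess (bF Φ u) x).trace := by
  rw [hu.hess_rF hΦ, Matrix.mul_sub, trace_sub, Matrix.mul_smul, Matrix.mul_smul, trace_smul,
    trace_smul, mul_vecMulVec, trace_vecMulVec, smul_eq_mul, smul_eq_mul, qF, dotProduct_comm]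

theorem contDiff_cG (hu : Sol K m₀ Λ C₁ M u) (hΦ : LogLike N Φ) (y : Eu n) :
    ContDiff ℝ 2 (cG K B Φ u y) :=
  (contDiff_const.mul (hu.contDiff_rF hΦ)).add <| contDiff_const.mul <| ContDiff.sum fun k _ =>
    (((contDiff_sG K hu.smooth k).of_le (by norm_num)).sub contDiff_const).pow 2

theorem pd_cG (hu : Sol K m₀ Λ C₁ M u) (hΦ : LogLike N Φ) (y x : Eu n) (j : Fin n) :
    pd j (cG K B Φ u y) x =
      B * pd j (rF Φ u) x + 8 * ∑ k, (sG K u x k - y k) * sV K u x j k := by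
  have d1 := (hu.contDiff_rF hΦ).differentiable (by norm_num) x
  have d2 : ∀ k, DifferentiableAt ℝ (fun x => sG K u x k - y k) x := fun k =>
    ((contDiff_sG K hu.smooth k).differentiable (by norm_num) x).sub_const _
  have d3 : ∀ k, DifferentiableAt ℝ (fun x => (sG K u x k - y k) * (sG K u x k - y k)) x :=
    fun k => (d2 k).mul (d2 k)
  have d4 := DifferentiableAt.fun_sum (u := univ) fun k _ => d3 k
  have e : cG K B Φ u y = fun x => B * rF Φ u x +
      4 * ∑ k, (sG K u x k - y k) * (sG K u x k - y k) := by
    funext x; simp only [cG, pow_two]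
  have e2 : ∀ k, pd j (fun x => sG K u x k - y k) x = sV K u x j k := fun k => by
    rw [pd_sub j ((contDiff_sG K hu.smooth k).differentiable (by norm_num) x)
      (differentiableAt_const _), pd_const, sub_zero, pd_sG K hu.smooth]
  rw [e, pd_add j (d1.const_mul B) (d4.const_mul 4), pd_const_mul j _ d1, pd_const_mul j _ d4,
    pd_sum j fun k _ => d3 k]
  simp only [pd_mul j (d2 _) (d2 _), e2, mul_sum]
  congr 1
  exact sum_congr rfl fun k _ => by ring

theorem hess_cG (hu : Sol K m₀ Λ C₁ M u) (hΦ : LogLike N Φ) (y x : Eu n) :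
    hess (cG K B Φ u y) x = B • hess (rF Φ u) x + (8 : ℝ) • (sV K u x * sV K u x) +
      (8 : ℝ) • ∑ k, (sG K u x k - y k) • pdM k (hess u) x := by
  ext i j
  have e : pd j (cG K B Φ u y) = fun x =>
      B * pd j (rF Φ u) x + 8 * ∑ k, (sG K u x k - y k) * sV K u x j k :=
    funext fun x => hu.pd_cG hΦ y x j
  have d1 := (contDiff_pd (m := 1) (hu.contDiff_rF hΦ) (by norm_num) j).differentiable
    (by norm_num) x
  have d2 : ∀ k, DifferentiableAt ℝ (fun x => sG K u x k - y k) x := fun k =>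
    ((contDiff_sG K hu.smooth k).differentiable (by norm_num) x).sub_const _
  have d3 : ∀ k, DifferentiableAt ℝ (fun x => sV K u x j k) x := fun k =>
    (contDiff_sV K hu.smooth j k).differentiable (by norm_num) x
  have d4 : ∀ k, DifferentiableAt ℝ (fun x => (sG K u x k - y k) * sV K u x j k) x :=
    fun k => (d2 k).mul (d3 k)
  have d5 := DifferentiableAt.fun_sum (u := univ) fun k _ => d4 k
  have e2 : ∀ k, pd i (fun x => sG K u x k - y k) x = sV K u x i k := fun k => by
    rw [pd_sub i ((contDiff_sG K hu.smooth k).differentiable (by norm_num) x)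
      (differentiableAt_const _), pd_const, sub_zero, pd_sG K hu.smooth]
  show pd i (pd j (cG K B Φ u y)) x = _
  rw [e, pd_add i (d1.const_mul B) (d5.const_mul 8), pd_const_mul i _ d1, pd_const_mul i _ d5,
    pd_sum i fun k _ => d4 k]
  simp only [pd_mul i (d2 _) (d3 _), e2, pd_sV K hu.smooth, Matrix.add_apply, Matrix.smul_apply,
    Matrix.sum_apply, Matrix.mul_apply, sum_add_distrib, smul_eq_mul, mul_add]
  rw [add_assoc]
  congr 1
  congr 1
  · exact congrArg _ <| sum_congr rfl fun k _ => by rw [sV_symm K hu.smooth x j k]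
  · exact congrArg _ <| sum_congr rfl fun k _ => by
      rw [pdM_hess_symm hu.smooth x i j k, pdM_hess_swap hu.smooth x i k j]

theorem differentiableAt_cT (hu : Sol K m₀ Λ C₁ M u) (hΦ : LogLike N Φ) {x : Eu n}
    (hx : ‖x‖ < 9 / 2) : DifferentiableAt ℝ (cT K B Φ u) x := by
  have h1 : MDiff (fun y => (sV K u y)⁻¹) x :=
    MDiff.inv (fun i j => (contDiff_sV K hu.smooth i j).differentiable (by norm_num) x)
      (hu.adm x hx).det_shift_pos.ne'
  refine differentiableAt_euclidean.2 fun k => ?_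
  simp only [cT_apply]
  refine ((contDiff_sG K hu.smooth k).differentiable (by norm_num) x).add
    (DifferentiableAt.const_mul (DifferentiableAt.fun_sum fun j _ => (h1 k j).mul ?_) _)
  exact (contDiff_pd (m := 1) (hu.contDiff_rF hΦ) (by norm_num) j).differentiable (by norm_num) x

theorem sV_mulVec_cT (hu : Sol K m₀ Λ C₁ M u) {x : Eu n} (hx : ‖x‖ < 9 / 2) (j : Fin n) :
    ∑ k, sV K u x j k * (cT K B Φ u x k - sG K u x k) = B / 8 * pd j (rF Φ u) x := by
  have h1 : sV K u x * (sV K u x)⁻¹ = 1 :=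
    Matrix.mul_nonsing_inv _ (isUnit_iff_ne_zero.2 (hu.adm x hx).det_shift_pos.ne')
  have h2 : sV K u x *ᵥ ((sV K u x)⁻¹ *ᵥ gradV (rF Φ u) x) = gradV (rF Φ u) x := by
    rw [mulVec_mulVec, h1, one_mulVec]
  have h3 := congrFun h2 j
  simp only [cT_apply, add_sub_cancel_left]
  rw [show pd j (rF Φ u) x = gradV (rF Φ u) x j from rfl, ← h3]
  simp only [mulVec, dotProduct, gradV, mul_sum]
  exact sum_congr rfl fun k _ => sum_congr rfl fun l _ => by ring

theorem cT_eq_of_isLocalMin (hu : Sol K m₀ Λ C₁ M u) (hΦ : LogLike N Φ) {x y : Eu n}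
    (hx : ‖x‖ < 9 / 2) (h : IsLocalMin (cG K B Φ u y) x) : cT K B Φ u x = y := by
  have h1 : ∀ j, (sV K u x *ᵥ fun k => cT K B Φ u x k - y k) j = 0 := by
    intro j
    have h2 := pd_eq_zero_of_isLocalMin h j
    rw [hu.pd_cG hΦ] at h2
    have h3 := hu.sV_mulVec_cT (B := B) (Φ := Φ) hx j
    have h4 : (sV K u x *ᵥ fun k => cT K B Φ u x k - y k) j =
        ∑ k, sV K u x j k * (cT K B Φ u x k - sG K u x k) +
          ∑ k, (sG K u x k - y k) * sV K u x j k := by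
      rw [← sum_add_distrib]
      simp only [mulVec, dotProduct]
      exact sum_congr rfl fun k _ => by ring
    rw [h4, h3]
    linarith
  have h2 := Matrix.eq_zero_of_mulVec_eq_zero (hu.adm x hx).det_shift_pos.ne' (funext h1)
  ext k
  exact sub_eq_zero.1 (congrFun h2 k)

theorem sV_mul_jacobian (hu : Sol K m₀ Λ C₁ M u) (hΦ : LogLike N Φ) {x y : Eu n}
    (hx : ‖x‖ < 9 / 2) (h : IsLocalMin (cG K B Φ u y) x) :
    sV K u x * (Matrix.of fun k i => pd i (fun y => cT K B Φ u y k) x) =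
      (1 / 8 : ℝ) • hess (cG K B Φ u y) x := by
  have hT := hu.cT_eq_of_isLocalMin hΦ hx h
  have dT : ∀ k, DifferentiableAt ℝ (fun y => cT K B Φ u y k) x :=
    differentiableAt_euclidean.1 (hu.differentiableAt_cT hΦ hx)
  have dG : ∀ k, DifferentiableAt ℝ (fun y => sG K u y k) x := fun k =>
    (contDiff_sG K hu.smooth k).differentiable (by norm_num) x
  ext j i
  have dV : ∀ k, DifferentiableAt ℝ (fun x => sV K u x j k) x := fun k =>
    (contDiff_sV K hu.smooth j k).differentiable (by norm_num) x
  have d1 : ∀ k, DifferentiableAt ℝ (fun y => cT K B Φ u y k - sG K u y k) x :=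
    fun k => (dT k).sub (dG k)
  have d2 : ∀ k, DifferentiableAt ℝ
      (fun y => sV K u y j k * (cT K B Φ u y k - sG K u y k)) x := fun k => (dV k).mul (d1 k)
  have d3 := (contDiff_pd (m := 1) (hu.contDiff_rF hΦ) (by norm_num) j).differentiable
    (by norm_num) x
  have e1 : (fun y => ∑ k, sV K u y j k * (cT K B Φ u y k - sG K u y k)) =ᶠ[nhds x]
      fun y => B / 8 * pd j (rF Φ u) y := by
    have : {y : Eu n | ‖y‖ < 9 / 2} ∈ nhds x :=
      (isOpen_lt continuous_norm continuous_const).mem_nhds hx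
    filter_upwards [this] with y hy
    exact hu.sV_mulVec_cT hy j
  have e2 : pd i (fun y => ∑ k, sV K u y j k * (cT K B Φ u y k - sG K u y k)) x =
      B / 8 * pd i (pd j (rF Φ u)) x := by
    rw [← pd_const_mul i _ d3, pd, e1.fderiv_eq]
    rfl
  rw [pd_sum i fun k _ => d2 k] at e2
  simp only [pd_mul i (dV _) (d1 _), pd_sub i (dT _) (dG _), pd_sG K hu.smooth,
    pd_sV K hu.smooth, hT] at e2
  have e3 := congrFun (congrFun (hess_symm (hu.contDiff_cG (B := B) hΦ y) x |> fun h =>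
    (Matrix.ext h : hess (cG K B Φ u y) x = (hess (cG K B Φ u y) x)ᵀ)) j) i
  rw [Matrix.smul_apply, e3, Matrix.transpose_apply, hu.hess_cG hΦ, Matrix.mul_apply]
  simp only [Matrix.add_apply, Matrix.smul_apply, Matrix.sum_apply, Matrix.mul_apply, smul_eq_mul,
    Matrix.of_apply]
  have e4 : ∑ k, sV K u x i k * sV K u x k j = ∑ k, sV K u x j k * sV K u x i k :=
    sum_congr rfl fun k _ => by rw [sV_symm K hu.smooth x k j, mul_comm]
  have e5 : ∑ k, (sG K u x k - y k) * pdM k (hess u) x i j =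
      -∑ k, pdM i (hess u) x j k * (y k - sG K u x k) := by
    rw [← sum_neg_distrib]
    exact sum_congr rfl fun k _ => by
      rw [pdM_hess_symm hu.smooth x i j k, pdM_hess_swap hu.smooth x i k j]; ring
  have e6 : ∑ k, (pdM i (hess u) x j k * (y k - sG K u x k) +
      sV K u x j k * (pd i (fun y => cT K B Φ u y k) x - sV K u x i k)) =
      ∑ k, pdM i (hess u) x j k * (y k - sG K u x k) +
      (∑ k, sV K u x j k * pd i (fun y => cT K B Φ u y k) x -
        ∑ k, sV K u x j k * sV K u x i k) := by
    rw [← sum_sub_distrib, ← sum_add_distrib]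
    exact sum_congr rfl fun k _ => by ring
  rw [e6] at e2
  rw [e4, e5, show hess (rF Φ u) x i j = pd i (pd j (rF Φ u)) x from rfl]
  linarith

end Sol

end Contact

section ContactEstimate

open Finset Matrix MeasureTheory

variable {n : ℕ} {K m₀ Λ C₁ M N B J : ℝ} {Φ : ℝ → ℝ} {u : Eu n → ℝ}

/-! ### The contact argument -/

theorem rF_le_of_cG_le (hB : 0 < B) {x y : Eu n} (h : cG K B Φ u y x ≤ 5 / 4) :
    rF Φ u x ≤ 5 / 4 / B := by
  rw [le_div_iff₀ hB]
  have : 0 ≤ ∑ k, (sG K u x k - y k) ^ 2 := sum_nonneg fun k _ => sq_nonneg _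
  rw [cG] at h
  linarith

namespace Sol

theorem trace_mul_hess_cG_le (n : ℕ) {K m₀ Λ C₁ J : ℝ} (hK : 0 ≤ K) (hΛ : 0 < Λ) (hC₁ : 0 < C₁)
    (hJ : 0 < J) :
    ∃ C > 0, ∀ (N : ℝ) (Φ : ℝ → ℝ) (M : ℝ) (u : Eu n → ℝ) (B : ℝ) (x y : Eu n),
      Sol K m₀ Λ C₁ M u → LogLike N Φ → ‖x‖ < 9 / 2 →
      1 / 40 * qF Φ u x ≤ (mF (hess u x) * hess (bF Φ u) x).trace + J * mSig (hess u x) →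
      100 ≤ B → cG K B Φ u y x ≤ 5 / 4 →
      2 ≤ mS (hess u x) ∧ (mF (hess u x) * hess (cG K B Φ u y) x).trace ≤ C * mSig (hess u x) := by
  obtain ⟨C₂, hC₂, key⟩ := MAdm.trace_F_shift_sq_le (m₀ := m₀) n hK hΛ
  refine ⟨J + 8 * C₂ + 8 * (n * (C₁ * 2)), by positivity, ?_⟩
  intro N Φ M u B x y hu hΦ hx hJac hB hc
  have hB0 : 0 < B := by linarith
  have hA := hu.adm x hx
  have hσ := hA.sig_pos
  have hq := hu.qF_nonneg (Φ := Φ) hx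
  have hr := rF_pos (u := u) hΦ x
  have hr1 : rF Φ u x ≤ 5 / 4 / B := rF_le_of_cG_le hB0 hc
  have hr2 : rF Φ u x ≤ 1 / 80 := hr1.trans (by rw [div_le_iff₀ hB0]; linarith)
  have hBr : B * rF Φ u x ≤ 5 / 4 := by rwa [le_div_iff₀ hB0, mul_comm] at hr1
  have hs : 2 ≤ mS (hess u x) := by
    have h1 := hu.bF_le hΦ hx
    have h2 : (bF Φ u x + 1) * rF Φ u x = 1 :=
      mul_inv_cancel₀ (inv_pos.1 (rF_pos hΦ x)).ne'
    by_contra! h3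
    have h4 : (bF Φ u x + 1) * rF Φ u x ≤ 3 * (1 / 80) :=
      mul_le_mul (by linarith) hr2 hr.le (by norm_num)
    linarith
  have hsσ : mS (hess u x) ≤ 2 * mSig (hess u x) := by linarith [hA.lt_sig]
  refine ⟨hs, ?_⟩
  have t1 : B * (mF (hess u x) * hess (rF Φ u) x).trace ≤ J * mSig (hess u x) := by
    rw [hu.trace_mul_hess_rF hΦ]
    have a1 := mul_le_mul_of_nonneg_left hJac (mul_nonneg hB0.le (sq_nonneg (rF Φ u x)))
    have a2 : B * rF Φ u x ^ 2 * qF Φ u x * rF Φ u x ≤ B * rF Φ u x ^ 2 * qF Φ u x * (1 / 80) := by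
      gcongr
    have a3 : (B * rF Φ u x) * rF Φ u x * (J * mSig (hess u x)) ≤
        5 / 4 * (1 / 80) * (J * mSig (hess u x)) := by gcongr
    have a4 : 0 ≤ J * mSig (hess u x) := by positivity
    linarith
  have t2 := key (hess u x) hA hs
  have t3 : ∑ k, (sG K u x k - y k) * (mF (hess u x) * pdM k (hess u) x).trace ≤
      n * (C₁ * 2) * mSig (hess u x) := by
    have b1 : ∀ k, (sG K u x k - y k) * (mF (hess u x) * pdM k (hess u) x).trace ≤
        C₁ * 2 * mSig (hess u x) := by
      intro k
      have b2 := hu.pd_le x hx k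
      rw [pd_mf_hess hu.smooth] at b2
      have b3 : |sG K u x k - y k| ≤ 1 := by
        rw [← sq_le_one_iff_abs_le_one]
        have := single_le_sum (f := fun k => (sG K u x k - y k) ^ 2) (fun k _ => sq_nonneg _)
          (mem_univ k)
        rw [cG] at hc
        have := mul_pos hB0 hr
        linarith
      calc _ ≤ |sG K u x k - y k| * |(mF (hess u x) * pdM k (hess u) x).trace| := by
            rw [← abs_mul]; exact le_abs_self _
        _ ≤ 1 * (C₁ * mS (hess u x)) := mul_le_mul b3 b2 (abs_nonneg _) zero_le_one
        _ ≤ 1 * (C₁ * (2 * mSig (hess u x))) := by gcongr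
        _ = _ := by ring
    refine (sum_le_sum fun k _ => b1 k).trans (le_of_eq ?_)
    simp only [sum_const, card_univ, Fintype.card_fin, nsmul_eq_mul]
    ring
  rw [hu.hess_cG hΦ, Matrix.mul_add, Matrix.mul_add, trace_add, trace_add, Matrix.mul_smul,
    Matrix.mul_smul, Matrix.mul_smul, trace_smul, trace_smul, trace_smul, Matrix.mul_sum, trace_sum]
  simp only [Matrix.mul_smul, trace_smul, smul_eq_mul]
  have t4 : (mF (hess u x) * (sV K u x * sV K u x)).trace ≤ C₂ * mSig (hess u x) := t2
  linarith

theorem abs_det_fderiv_cT_le (hn : 3 ≤ n) (hK : 0 ≤ K) (hm : 0 < m₀) (hΛ : 0 < Λ) (hC₁ : 0 < C₁)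
    (hJ : 0 < J) :
    ∃ C > 0, ∀ (N : ℝ) (Φ : ℝ → ℝ) (M : ℝ) (u : Eu n → ℝ) (B : ℝ) (x y : Eu n),
      Sol K m₀ Λ C₁ M u → LogLike N Φ → ‖x‖ < 9 / 2 →
      1 / 40 * qF Φ u x ≤ (mF (hess u x) * hess (bF Φ u) x).trace + J * mSig (hess u x) →
      100 ≤ B → IsLocalMin (cG K B Φ u y) x → cG K B Φ u y x ≤ 5 / 4 →
      |(fderiv ℝ (cT K B Φ u) x).det| ≤ C * mSig (hess u x) := by
  obtain ⟨C₂, hC₂, key⟩ := trace_mul_hess_cG_le (m₀ := m₀) n hK hΛ hC₁ hJ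
  obtain ⟨C₃, hC₃, key₃⟩ := MAdm.det_le_of_trace_le (Λ := Λ) n hm hK hC₂
  obtain ⟨C₄, hC₄, key₄⟩ := MAdm.det_shift_le (m₀ := m₀) hn hK hΛ
  refine ⟨C₃ * C₄, by positivity, ?_⟩
  intro N Φ M u B x y hu hΦ hx hJac hB hmin hc
  have hA := hu.adm x hx
  obtain ⟨hs, htr⟩ := key N Φ M u B x y hu hΦ hx hJac hB hc
  have hg := hu.contDiff_cG (B := B) hΦ y
  have h1 := key₃ (hess u x) hA (hess (cG K B Φ u y) x) (hess_symm hg x)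
    (hess_nonneg_of_isLocalMin hg hmin) htr
  have h2 := key₄ (hess u x) hA hs
  have h3 := hA.det_shift_pos
  have h4 := congrArg Matrix.det (hu.sV_mul_jacobian hΦ hx hmin)
  rw [det_mul, ← det_fderiv_eq (hu.differentiableAt_cT hΦ hx), det_smul, Fintype.card_fin] at h4
  obtain ⟨d, hd⟩ : ∃ d, d = (sV K u x).det := ⟨_, rfl⟩
  have hd0 : 0 < d := by rw [hd]; exact h3
  have h1' : |(hess (cG K B Φ u y) x).det| ≤ C₃ * d ^ 2 := by rw [hd]; exact h1
  have h2' : d ≤ C₄ * mSig (hess u x) := by rw [hd]; exact h2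
  rw [← hd] at h4
  have h5 : d * |(fderiv ℝ (cT K B Φ u) x).det| ≤ C₃ * d ^ 2 := by
    have h6 : d * |(fderiv ℝ (cT K B Φ u) x).det| =
        (1 / 8) ^ n * |(hess (cG K B Φ u y) x).det| := by
      rw [← abs_of_pos hd0, ← abs_mul, h4, abs_mul, abs_of_nonneg (by positivity)]
    rw [h6]
    have h7 : ((1 : ℝ) / 8) ^ n ≤ 1 := pow_le_one₀ (by norm_num) (by norm_num)
    exact (mul_le_of_le_one_left (abs_nonneg _) h7).trans h1'
  have h6 : |(fderiv ℝ (cT K B Φ u) x).det| ≤ C₃ * d := by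
    refine le_of_mul_le_mul_left ?_ hd0
    calc _ ≤ _ := h5
      _ = _ := by ring
  calc _ ≤ _ := h6
    _ ≤ C₃ * (C₄ * mSig (hess u x)) := by gcongr
    _ = _ := by ring

/-- Every point near the shifted gradient at the origin is attained by an interior minimum. -/
theorem exists_isLocalMin_cG (hu : Sol K m₀ Λ C₁ M u) (hΦ : LogLike N Φ) {y : Eu n}
    (hy : ‖y - sG K u 0‖ ≤ 1 / 4) :
    ∃ x, ‖x‖ < 1 ∧ IsLocalMin (cG K (bF Φ u 0 + 1) Φ u y) x ∧
      cG K (bF Φ u 0 + 1) Φ u y x ≤ 5 / 4 := by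
  have hB0 : 0 < bF Φ u 0 + 1 := inv_pos.1 (rF_pos hΦ 0)
  obtain ⟨g, hg⟩ : ∃ g, g = cG K (bF Φ u 0 + 1) Φ u y := ⟨_, rfl⟩
  have hgc : Continuous g := by rw [hg]; exact (hu.contDiff_cG hΦ y).continuous
  obtain ⟨x, hx, hxmin⟩ := (isCompact_closedBall (0 : Eu n) 1).exists_isMinOn
    (Metric.nonempty_closedBall.2 zero_le_one) hgc.continuousOn
  rw [mem_closedBall_zero_iff] at hx
  have hsum : ∀ z : Eu n, ∑ k, (sG K u z k - y k) ^ 2 = ‖sG K u z - y‖ ^ 2 := fun z => by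
    rw [EuclideanSpace.real_norm_sq_eq]; rfl
  have h0 : g 0 ≤ 5 / 4 := by
    rw [hg, cG, hsum, rF, mul_inv_cancel₀ hB0.ne', norm_sub_rev]
    have := pow_le_pow_left₀ (norm_nonneg _) hy 2
    linarith
  have hle : g x ≤ 5 / 4 := (hxmin (Metric.mem_closedBall_self zero_le_one)).trans h0
  have hx1 : ‖x‖ < 1 := by
    refine lt_of_le_of_ne hx fun hx1 => ?_
    have h1 := hu.norm_sq_le_inner_sG (x := x) (by rw [hx1]; norm_num)
    have h2 : ∑ k, x k * (sG K u x k - sG K u 0 k) = inner ℝ x (sG K u x - sG K u 0) := by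
      simp [PiLp.inner_apply, mul_comm]
    have h3 := real_inner_le_norm x (sG K u x - sG K u 0)
    rw [h2, hx1] at h1
    rw [hx1] at h3
    have h4 : ‖sG K u x - sG K u 0‖ ≤ ‖sG K u x - y‖ + ‖y - sG K u 0‖ :=
      norm_sub_le_norm_sub_add_norm_sub _ _ _
    have h5 : 3 / 4 ≤ ‖sG K u x - y‖ := by linarith
    have h6 := pow_le_pow_left₀ (by norm_num) h5 2
    rw [hg, cG, hsum] at hle
    have := mul_pos hB0 (rF_pos (u := u) hΦ x)
    linarith
  refine ⟨x, hx1, ?_, by rw [← hg]; exact hle⟩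
  rw [← hg]
  have hn : Metric.closedBall (0 : Eu n) 1 ∈ nhds x :=
    Filter.mem_of_superset (Metric.isOpen_ball.mem_nhds (mem_ball_zero_iff.2 hx1))
      Metric.ball_subset_closedBall
  exact hxmin.isLocalMin hn

/-- The pointwise bound on the Laplacian at the origin. -/
theorem exists_mS_hess_zero_le (hn : 3 ≤ n) (hK : 0 ≤ K) (hm : 0 < m₀) (hΛ : 0 < Λ)
    (hC₁ : 0 < C₁) (M : ℝ) : ∃ C > 0, ∀ u : Eu n → ℝ, Sol K m₀ Λ C₁ M u → mS (hess u 0) ≤ C := by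
  obtain ⟨N, hN, J, hJ, hJac⟩ := jacobi_log n hK hm hΛ hC₁
  obtain ⟨Φ, hΦ⟩ := exists_logLike (show (1 : ℝ) ≤ N by linarith)
  obtain ⟨η, hη⟩ := exists_cut (n := n) (r := 1) (R := 2) one_pos one_lt_two
  obtain ⟨E₁, hE₁, key₁⟩ := hη.exists_integral_mSig_le two_pos (by norm_num) hK M
  obtain ⟨E₂, hE₂, key₂⟩ := hη.exists_integral_bF_mSig_le two_pos (by norm_num) hK M hJ hm
  obtain ⟨C, hC, key⟩ := abs_det_fderiv_cT_le hn hK hm hΛ hC₁ hJ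
  obtain ⟨ω, hω⟩ : ∃ ω, ω = (volume (Metric.ball (0 : Eu n) (1 / 4))).toReal := ⟨_, rfl⟩
  have hvt : volume (Metric.ball (0 : Eu n) (1 / 4)) ≠ ⊤ := measure_ball_lt_top.ne
  have hω0 : 0 < ω := by
    rw [hω]
    exact ENNReal.toReal_pos (Metric.measure_ball_pos volume _ (by norm_num)).ne' hvt
  obtain ⟨T, hT, hprop⟩ := hΦ.proper (100 + 2 * C * (E₁ + E₂) / ω)
  refine ⟨T, hT, fun u hu => hprop _ ?_⟩
  have hJ' : ∀ x : Eu n, ‖x‖ < 9 / 2 → 1 / 40 * qF Φ u x ≤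
      (mF (hess u x) * hess (bF Φ u) x).trace + J * mSig (hess u x) := fun x hx =>
    hJac Φ hΦ M u hu x hx
  have k₁ := key₁ m₀ Λ C₁ u hu
  have k₂ := key₂ Λ C₁ N Φ u hu hN hΦ hJ'
  obtain ⟨B, hB⟩ : ∃ B, B = bF Φ u 0 + 1 := ⟨_, rfl⟩
  change bF Φ u 0 ≤ _
  by_contra! hlarge
  have hE0 : 0 ≤ 2 * C * (E₁ + E₂) / ω := by positivity
  have hB100 : 100 ≤ B := by rw [hB]; linarith
  have hB0 : 0 < B := by linarith
  have cσ : Continuous fun x => mSig (hess u x) := (contDiff_mSig_hess hu.smooth).continuous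
  have cb : Continuous (bF Φ u) := (hu.contDiff_bF hΦ).continuous
  have cr : Continuous (rF Φ u) := (hu.contDiff_rF hΦ).continuous
  obtain ⟨S, hS⟩ : ∃ S : Set (Eu n), S = {x | ‖x‖ < 1 ∧ rF Φ u x ≤ 5 / 4 / B ∧
    |(fderiv ℝ (cT K B Φ u) x).det| ≤ C * mSig (hess u x)} := ⟨_, rfl⟩
  have hSm : MeasurableSet S := by
    rw [hS]
    have m1 : Measurable fun x => (fderiv ℝ (cT K B Φ u) x).det :=
      ContinuousLinearMap.continuous_det.measurable.comp (measurable_fderiv ℝ _)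
    exact (measurableSet_lt continuous_norm.measurable measurable_const).inter
      ((measurableSet_le cr.measurable measurable_const).inter
        (measurableSet_le m1.abs (cσ.measurable.const_mul C)))
  have hcov : Metric.ball (sG K u 0) (1 / 4) ⊆ cT K B Φ u '' S := by
    intro y hy
    rw [mem_ball_iff_norm] at hy
    obtain ⟨x, hx1, hmin, hle⟩ := hu.exists_isLocalMin_cG hΦ hy.le
    rw [← hB] at hmin hle
    have hx : ‖x‖ < 9 / 2 := by linarith
    refine ⟨x, ?_, hu.cT_eq_of_isLocalMin hΦ hx hmin⟩
    rw [hS]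
    exact ⟨hx1, rF_le_of_cG_le hB0 hle, key N Φ M u B x y hu hΦ hx (hJ' x hx) hB100 hmin hle⟩
  obtain ⟨G, hG⟩ : ∃ G : Eu n → ℝ,
    G = fun x => 5 / 4 / B * C * (η x * bF Φ u x * mSig (hess u x) + η x * mSig (hess u x)) :=
    ⟨_, rfl⟩
  have i1 : Integrable fun x => η x * bF Φ u x * mSig (hess u x) := by
    simp only [mul_assoc]
    exact hη.integrable_mul (cb.mul cσ)
  have i2 : Integrable fun x => η x * mSig (hess u x) := hη.integrable_mul cσ
  have i3 : Integrable G := by rw [hG]; exact (i1.add i2).const_mul _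
  have hG0 : ∀ x, 0 ≤ G x := by
    intro x
    rw [hG]
    rcases lt_or_ge ‖x‖ 2 with hx | hx
    · have h1 := (hu.adm x (by linarith)).sig_pos
      have h2 := hη.nonneg x
      have h3 : 0 ≤ bF Φ u x := hΦ.nonneg _
      simp only
      positivity
    · simp [hη.zero x hx]
  have hGi : ∫ x, G x ≤ 5 / 4 / B * C * (E₂ + E₁) := by
    rw [hG, integral_const_mul, integral_add i1 i2]
    gcongr
  have hdet : ∀ x ∈ S, |(fderiv ℝ (cT K B Φ u) x).det| ≤ G x := by
    intro x hx
    rw [hS] at hx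
    obtain ⟨hx1, hx2, hx3⟩ := hx
    have hσ := (hu.adm x (by linarith)).sig_pos
    have hr : rF Φ u x * (bF Φ u x + 1) = 1 := inv_mul_cancel₀ (inv_pos.1 (rF_pos hΦ x)).ne'
    have hb : 0 < bF Φ u x + 1 := inv_pos.1 (rF_pos hΦ x)
    rw [hG]
    simp only [hη.one x hx1.le, one_mul]
    calc _ ≤ C * mSig (hess u x) := hx3
      _ = rF Φ u x * (bF Φ u x + 1) * (C * mSig (hess u x)) := by rw [hr, one_mul]
      _ ≤ 5 / 4 / B * (bF Φ u x + 1) * (C * mSig (hess u x)) := by gcongr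
      _ = _ := by ring
  have harea := addHaar_image_le_lintegral_abs_det_fderiv volume hSm
    (f := cT K B Φ u) (f' := fderiv ℝ (cT K B Φ u)) fun x hx =>
      (hu.differentiableAt_cT hΦ (by rw [hS] at hx; linarith [hx.1])).hasFDerivAt.hasFDerivWithinAt
  have hfin : volume (Metric.ball (0 : Eu n) (1 / 4)) ≤ ENNReal.ofReal (∫ x, G x) := by
    rw [← Measure.addHaar_ball_center volume (sG K u 0)]
    calc _ ≤ _ := measure_mono hcov
      _ ≤ _ := harea
      _ ≤ ∫⁻ x in S, ENNReal.ofReal (G x) :=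
        setLIntegral_mono' hSm fun x hx => ENNReal.ofReal_le_ofReal (hdet x hx)
      _ ≤ ∫⁻ x, ENNReal.ofReal (G x) := setLIntegral_le_lintegral _ _
      _ = _ := (ofReal_integral_eq_lintegral_ofReal i3 (Filter.Eventually.of_forall hG0)).symm
  have hωle : ω ≤ 5 / 4 / B * C * (E₂ + E₁) := by
    rw [hω]
    exact (ENNReal.toReal_le_of_le_ofReal (integral_nonneg hG0) hfin).trans hGi
  have h1 : ω * B ≤ 5 / 4 * C * (E₂ + E₁) := by
    calc ω * B ≤ 5 / 4 / B * C * (E₂ + E₁) * B := by gcongr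
      _ = _ := by field_simp
  have h2 : 2 * C * (E₁ + E₂) / ω ≤ B := by rw [hB]; linarith
  rw [div_le_iff₀ hω0] at h2
  have h3 : 0 < C * (E₁ + E₂) := by positivity
  linarith

end Sol

end ContactEstimate

section Reduction

open Finset Matrix MeasureTheory

/-! ### The right-hand side along a solution -/

theorem abs_deriv_sub_le {E : Type*} [NormedAddCommGroup E] [NormedSpace ℝ E] {z z' : ℝ → E}
    {z'' : E} {F : E → E →L[ℝ] ℝ} {L a'' : ℝ} {a' : ℝ → ℝ} (hz : HasDerivAt z (z' 0) 0)
    (hz' : HasDerivAt z' z'' 0) (ha : HasDerivAt a' a'' 0)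
    (he : ∀ᶠ t in nhds (0 : ℝ), a' t = F (z t) (z' t))
    (hF : ∀ᶠ t in nhds (0 : ℝ), ‖F (z t) - F (z 0)‖ ≤ L * ‖z t - z 0‖) :
    |a'' - F (z 0) z''| ≤ L * ‖z' 0‖ ^ 2 := by
  have h1 : HasDerivAt (fun t => a' t - F (z 0) (z' t)) (a'' - F (z 0) z'') 0 :=
    ha.sub ((F (z 0)).hasFDerivAt.comp_hasDerivAt (0 : ℝ) hz')
  have h2 := (hasDerivAt_iff_tendsto_slope_zero.1 h1).norm
  have h3 := (((hasDerivAt_iff_tendsto_slope_zero.1 hz).norm.const_mul L).mul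
    (hz'.continuousAt.norm.tendsto.mono_left nhdsWithin_le_nhds))
  have h4 : L * ‖z' 0‖ ^ 2 = L * ‖z' 0‖ * ‖z' 0‖ := by ring
  rw [h4, ← Real.norm_eq_abs]
  refine le_of_tendsto_of_tendsto h2 h3 ?_
  filter_upwards [nhdsWithin_le_nhds he, nhdsWithin_le_nhds hF] with t ht hFt
  have h5 : a' t - F (z 0) (z' t) - (a' 0 - F (z 0) (z' 0)) = (F (z t) - F (z 0)) (z' t) := by
    rw [ht, he.self_of_nhds, _root_.sub_apply]; ring
  rw [zero_add, h5, norm_smul, norm_smul]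
  calc ‖t⁻¹‖ * ‖(F (z t) - F (z 0)) (z' t)‖ ≤ ‖t⁻¹‖ * ((L * ‖z t - z 0‖) * ‖z' t‖) := by
        gcongr
        exact ((F (z t) - F (z 0)).le_opNorm _).trans (by gcongr)
    _ = _ := by ring

variable {n : ℕ}

/-- The argument `(x, u, Du)` of the right-hand side. -/
def jet (u : Eu n → ℝ) (x : Eu n) : Eu n × ℝ × Eu n :=
  (x, u x, WithLp.toLp 2 fun j => pd j u x)

/-- The `k`-th derivative of `jet`. -/
def jet₁ (u : Eu n → ℝ) (k : Fin n) (x : Eu n) : Eu n × ℝ × Eu n :=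
  (EuclideanSpace.single k 1, pd k u x, WithLp.toLp 2 fun j => hess u x k j)

/-- The second derivative of `jet` in the `k`-th direction. -/
def jet₂ (u : Eu n → ℝ) (k : Fin n) (x : Eu n) : Eu n × ℝ × Eu n :=
  (0, hess u x k k, WithLp.toLp 2 fun j => pdM k (hess u) x k j)

theorem hasDerivAt_pd {g : Eu n → ℝ} (hg : Differentiable ℝ g) (x : Eu n) (k : Fin n) (t : ℝ) :
    HasDerivAt (fun t : ℝ => g (x + t • EuclideanSpace.single k 1))
      (pd k g (x + t • EuclideanSpace.single k 1)) t := by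
  have h := hasDerivAt_line hg x (EuclideanSpace.single k 1) t
  rw [← fderiv_eq_sum] at h
  exact h

theorem hasDerivAt_toLp {g : ℝ → Fin n → ℝ} {g' : Fin n → ℝ} {t : ℝ}
    (h : ∀ j, HasDerivAt (fun t => g t j) (g' j) t) :
    HasDerivAt (fun t => (WithLp.toLp 2 (g t) : Eu n)) (WithLp.toLp 2 g') t :=
  (PiLp.continuousLinearEquiv 2 ℝ fun _ : Fin n => ℝ).symm.hasFDerivAt.comp_hasDerivAt t
    (hasDerivAt_pi.2 h)

theorem norm_toLp_le (v : Fin n → ℝ) : ‖(WithLp.toLp 2 v : Eu n)‖ ≤ ∑ j, |v j| := by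
  have h : (WithLp.toLp 2 v : Eu n) = ∑ j, v j • (EuclideanSpace.single j (1 : ℝ) : Eu n) := by
    ext i; simp [Finset.sum_apply, Pi.single_apply]
  rw [h]
  refine (norm_sum_le _ _).trans (le_of_eq (sum_congr rfl fun j _ => ?_))
  rw [norm_smul, PiLp.norm_single]; simp

section

variable {u : Eu n → ℝ}

theorem hasDerivAt_jet (hu : ContDiff ℝ 4 u) (k : Fin n) (x : Eu n) (t : ℝ) :
    HasDerivAt (fun t : ℝ => jet u (x + t • EuclideanSpace.single k 1))
      (jet₁ u k (x + t • EuclideanSpace.single k 1)) t := by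
  have h1 : HasDerivAt (fun t : ℝ => x + t • (EuclideanSpace.single k 1 : Eu n))
      (EuclideanSpace.single k 1) t := by
    simpa using ((hasDerivAt_id t).smul_const (EuclideanSpace.single k 1 : Eu n)).const_add x
  refine h1.prodMk ((hasDerivAt_pd (hu.differentiable (by norm_num)) x k t).prodMk
    (hasDerivAt_toLp fun j => ?_))
  exact hasDerivAt_pd ((contDiff_pd (m := 3) hu (by norm_num) j).differentiable (by norm_num)) x k t

theorem hasDerivAt_jet₁ (hu : ContDiff ℝ 4 u) (k : Fin n) (x : Eu n) (t : ℝ) :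
    HasDerivAt (fun t : ℝ => jet₁ u k (x + t • EuclideanSpace.single k 1))
      (jet₂ u k (x + t • EuclideanSpace.single k 1)) t := by
  refine (hasDerivAt_const t _).prodMk ((hasDerivAt_pd
    ((contDiff_pd (m := 3) hu (by norm_num) k).differentiable (by norm_num)) x k t).prodMk
    (hasDerivAt_toLp fun j => ?_))
  exact hasDerivAt_pd ((contDiff_hess hu k j).differentiable (by norm_num)) x k t

theorem sum_jet₂ (hu : ContDiff ℝ 4 u) (x : Eu n) : ∑ k, jet₂ u k x =
    (0, mS (hess u x) - 1, WithLp.toLp 2 fun j => pd j (fun y => mS (hess u y)) x) := by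
  refine Prod.ext ?_ (Prod.ext ?_ ?_)
  · simp [Prod.fst_sum, jet₂]
  · simp [Prod.snd_sum, Prod.fst_sum, jet₂, mS, trace]
  · simp only [Prod.snd_sum, jet₂]
    ext j
    simp [sum_pdM_hess hu, trace_pdM_hess hu]

end

theorem norm_jet₁_le {u : Eu n → ℝ} {K m₀ Λ M : ℝ} (hK : 0 ≤ K) (hM : 0 ≤ M) {x : Eu n} {k : Fin n}
    (hA : MAdm K m₀ Λ (hess u x)) (hg : |pd k u x| ≤ M) :
    ‖jet₁ u k x‖ ≤ (1 + M + n * (K + 1)) * mS (hess u x) := by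
  have hs := hA.one_lt
  have h1 : ‖(WithLp.toLp 2 fun j => hess u x k j : Eu n)‖ ≤ n * (K + 1) * mS (hess u x) := by
    refine (norm_toLp_le _).trans ((sum_le_sum fun j _ => hA.abs_entry_le k j).trans (le_of_eq ?_))
    simp only [sum_const, card_univ, Fintype.card_fin, nsmul_eq_mul]
    ring
  have p1 : 0 ≤ M * mS (hess u x) := by positivity
  have p2 : 0 ≤ n * (K + 1) * mS (hess u x) := by positivity
  have p3 : M ≤ M * mS (hess u x) := le_mul_of_one_le_right hM hs.le
  refine norm_prod_le_iff.2 ⟨?_, norm_prod_le_iff.2 ⟨?_, ?_⟩⟩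
  · simp only [jet₁, PiLp.norm_single, norm_one]
    linarith
  · rw [jet₁, Real.norm_eq_abs]
    linarith
  · exact h1.trans (by linarith)

/-- A smooth function whose Hessian is admissible and solves the equation with a `C^{1,1}`
right-hand side is a solution in the structural sense. -/
theorem sol_of_equation {K m₀ Λ M : ℝ} (hK : 0 ≤ K) (hM : 0 ≤ M) (hΛ : 0 ≤ Λ) {u : Eu n → ℝ}
    (hu : ContDiff ℝ 4 u) {D : Set (Eu n × ℝ × Eu n)} (hD : IsOpen D) {f : Eu n × ℝ × Eu n → ℝ}
    {ρ : ℝ} (hρ : 9 / 2 < ρ)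
    (hjet : ∀ x, ‖x‖ < ρ → jet u x ∈ D) (hf : DifferentiableOn ℝ f D)
    (hf1 : ∀ z ∈ D, ‖fderiv ℝ f z‖ ≤ Λ)
    (hf2 : ∀ z ∈ D, ∀ w ∈ D, ‖fderiv ℝ f z - fderiv ℝ f w‖ ≤ Λ * ‖z - w‖)
    (hadm : ∀ x, ‖x‖ < 9 / 2 → MAdm K m₀ Λ (hess u x))
    (hg : ∀ x, ‖x‖ < 9 / 2 → ∀ k, |pd k u x| ≤ M)
    (heq : ∀ x, ‖x‖ < ρ → mf (hess u x) = f (jet u x)) :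
    Sol K m₀ Λ (Λ * (1 + M + n * (K + 1)) + Λ + Λ * n * (1 + M + n * (K + 1)) ^ 2) M u := by
  obtain ⟨c, hc⟩ : ∃ c, c = 1 + M + n * (K + 1) := ⟨_, rfl⟩
  have hc0 : 0 ≤ c := by rw [hc]; positivity
  rw [← hc]
  have hφ := contDiff_mf_hess hu
  have hnhds : ∀ x : Eu n, ‖x‖ < ρ → {y : Eu n | ‖y‖ < ρ} ∈ nhds x := fun x hx =>
    (isOpen_lt continuous_norm continuous_const).mem_nhds hx
  have hline : ∀ (x : Eu n) (k : Fin n), ‖x‖ < ρ →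
      ∀ᶠ t in nhds (0 : ℝ), ‖x + t • (EuclideanSpace.single k 1 : Eu n)‖ < ρ := by
    intro x k hx
    have hcont : ContinuousAt (fun t : ℝ => ‖x + t • (EuclideanSpace.single k 1 : Eu n)‖) 0 := by
      fun_prop
    exact hcont.eventually_lt continuousAt_const (by simpa using hx)
  have hpd : ∀ x, ‖x‖ < ρ → ∀ k,
      pd k (fun y => mf (hess u y)) x = fderiv ℝ f (jet u x) (jet₁ u k x) := by
    intro x hx k
    have h0 : x + (0 : ℝ) • (EuclideanSpace.single k 1 : Eu n) = x := by simp
    have h1 := hasDerivAt_pd (hφ.differentiable (by norm_num)) x k 0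
    have h2 := hasDerivAt_jet hu k x 0
    have h3 : HasFDerivAt f (fderiv ℝ f (jet u x))
        (jet u (x + (0 : ℝ) • EuclideanSpace.single k 1)) := by
      rw [h0]
      exact (hf.differentiableAt (hD.mem_nhds (hjet x hx))).hasFDerivAt
    have h4 := h3.comp_hasDerivAt (0 : ℝ) h2
    rw [h0] at h1 h4
    refine h1.unique (h4.congr_of_eventuallyEq ?_)
    filter_upwards [hline x k hx] with t ht
    exact heq _ ht
  have hnorm : ∀ x, ‖x‖ < 9 / 2 → ∀ k, ‖jet₁ u k x‖ ≤ c * mS (hess u x) := fun x hx k => by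
    rw [hc]; exact norm_jet₁_le hK hM (hadm x hx) (hg x hx k)
  refine ⟨hu, hadm, hg, fun x hx k => ?_, fun x hx => ?_⟩
  · have hs := (hadm x hx).one_lt
    rw [hpd x (hx.trans hρ)]
    calc _ ≤ ‖fderiv ℝ f (jet u x)‖ * ‖jet₁ u k x‖ := (fderiv ℝ f (jet u x)).le_opNorm _
      _ ≤ Λ * (c * mS (hess u x)) := by
        gcongr
        · exact hf1 _ (hjet x (hx.trans hρ))
        · exact hnorm x hx k
      _ ≤ (Λ * c + Λ + Λ * n * c ^ 2) * mS (hess u x) := by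
        have : 0 ≤ (Λ + Λ * n * c ^ 2) * mS (hess u x) := by positivity
        linarith
  · have hs := (hadm x hx).one_lt
    have hxρ := hx.trans hρ
    have h0 : ∀ k, x + (0 : ℝ) • (EuclideanSpace.single k 1 : Eu n) = x := fun k => by simp
    have key : ∀ k, fderiv ℝ f (jet u x) (jet₂ u k x) - Λ * (c * mS (hess u x)) ^ 2 ≤
        pd k (pd k fun y => mf (hess u y)) x := by
      intro k
      have e1 := hasDerivAt_pd ((contDiff_pd (m := 1) hφ (by norm_num) k).differentiable
        (by norm_num)) x k 0
      have e2 := abs_deriv_sub_le (F := fderiv ℝ f) (L := Λ) (hasDerivAt_jet hu k x 0)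
        (hasDerivAt_jet₁ hu k x 0) e1 (by
          filter_upwards [hline x k hxρ] with t ht
          exact hpd _ ht k) (by
          filter_upwards [hline x k hxρ] with t ht
          exact hf2 _ (hjet _ ht) _ (hjet _ (by rwa [h0])))
      rw [h0] at e2
      have e3 := pow_le_pow_left₀ (norm_nonneg _) (hnorm x hx k) 2
      have e4 : Λ * ‖jet₁ u k x‖ ^ 2 ≤ Λ * (c * mS (hess u x)) ^ 2 := by gcongr
      linarith [neg_abs_le (pd k (pd k fun y => mf (hess u y)) x - fderiv ℝ f (jet u x)
        (jet₂ u k x))]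
    have h1 := sum_le_sum fun k (_ : k ∈ univ) => key k
    rw [sum_sub_distrib, ← map_sum, sum_jet₂ hu, sum_const, card_univ, Fintype.card_fin,
      nsmul_eq_mul] at h1
    obtain ⟨P, hP⟩ : ∃ P, P = ∑ k, |pd k (fun y => mS (hess u y)) x| := ⟨_, rfl⟩
    have hP0 : 0 ≤ P := by rw [hP]; positivity
    have h2 : ‖((0, mS (hess u x) - 1, WithLp.toLp 2 fun j => pd j (fun y => mS (hess u y)) x) :
        Eu n × ℝ × Eu n)‖ ≤ mS (hess u x) ^ 2 + P := by
      have q1 : 0 ≤ mS (hess u x) ^ 2 := sq_nonneg _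
      refine norm_prod_le_iff.2 ⟨?_, norm_prod_le_iff.2 ⟨?_, ?_⟩⟩
      · rw [norm_zero]; linarith
      · rw [Real.norm_eq_abs, abs_of_nonneg (by linarith)]
        nlinarith
      · refine (norm_toLp_le _).trans ?_
        rw [← hP]; linarith
    have h3 := (fderiv ℝ f (jet u x)).le_opNorm
      ((0, mS (hess u x) - 1, WithLp.toLp 2 fun j => pd j (fun y => mS (hess u y)) x) :
        Eu n × ℝ × Eu n)
    have h4 : ‖fderiv ℝ f (jet u x)‖ * ‖((0, mS (hess u x) - 1,
        WithLp.toLp 2 fun j => pd j (fun y => mS (hess u y)) x) : Eu n × ℝ × Eu n)‖ ≤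
        Λ * (mS (hess u x) ^ 2 + P) :=
      mul_le_mul (hf1 _ (hjet x hxρ)) h2 (norm_nonneg _) hΛ
    rw [Real.norm_eq_abs] at h3
    have h5 := neg_le_of_abs_le (h3.trans h4)
    rw [← hP]
    have q2 : 0 ≤ (Λ * c + Λ * n * c ^ 2) * P := by positivity
    have q3 : 0 ≤ Λ * c * mS (hess u x) ^ 2 := by positivity
    linarith

end Reduction

section Localization

open Finset Matrix

variable {n : ℕ}

theorem exists_contDiff_eventuallyEq {u : Eu n → ℝ} (hu : ContDiffOn ℝ 4 u (Metric.ball 0 5)) :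
    ∃ v : Eu n → ℝ, ContDiff ℝ 4 v ∧ ∀ x, ‖x‖ < 23 / 5 → v =ᶠ[nhds x] u := by
  let b : ContDiffBump (0 : Eu n) := ⟨23 / 5, 24 / 5, by norm_num, by norm_num⟩
  refine ⟨fun x => b x * u x, contDiff_iff_contDiffAt.2 fun x => ?_, fun x hx => ?_⟩
  · by_cases hx : x ∈ Metric.ball (0 : Eu n) 5
    · exact b.contDiff.contDiffAt.mul (hu.contDiffAt (Metric.isOpen_ball.mem_nhds hx))
    · refine (contDiffAt_const (c := (0 : ℝ))).congr_of_eventuallyEq ?_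
      have hx' : 24 / 5 < ‖x‖ := by
        rw [mem_ball_zero_iff, not_lt] at hx
        linarith
      filter_upwards [(isOpen_lt continuous_const continuous_norm).mem_nhds hx'] with y hy
      rw [b.zero_of_le_dist (by rw [dist_zero_right]; exact le_of_lt hy), zero_mul]
  · filter_upwards [b.eventuallyEq_one_of_mem_ball (mem_ball_zero_iff.2 hx)] with y hy
    rw [hy, Pi.one_apply, one_mul]

theorem eventuallyEq_hess {u v : Eu n → ℝ} {x : Eu n} (h : v =ᶠ[nhds x] u) :
    hess v x = hess u x := by
  ext i j
  have h1 : (fun y => pd j v y) =ᶠ[nhds x] fun y => pd j u y := by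
    filter_upwards [h.fderiv (𝕜 := ℝ)] with y hy
    simp only [pd, hy]
  exact DFunLike.congr_fun (h1.fderiv_eq (𝕜 := ℝ)) (EuclideanSpace.single i 1)

theorem gradient_apply (u : Eu n → ℝ) (x : Eu n) (k : Fin n) : gradient u x k = pd k u x := by
  have h : inner ℝ (gradient u x) (EuclideanSpace.single k 1) = pd k u x :=
    InnerProductSpace.toDual_symm_apply
  rw [← h, EuclideanSpace.inner_single_right]
  simp

theorem MAdm.opNorm_le {K m₀ Λ : ℝ} (hK : 0 ≤ K) {A : Matrix (Fin n) (Fin n) ℝ}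
    (h : MAdm K m₀ Λ A) : opNorm A ≤ (K + 1) * mS A := by
  have hs := h.one_lt
  refine ContinuousLinearMap.opNorm_le_bound _ (by positivity) fun v => ?_
  refine le_of_sq_le_sq ?_ (by positivity)
  rw [mul_pow, EuclideanSpace.real_norm_sq_eq, EuclideanSpace.real_norm_sq_eq]
  exact h.sum_sq_mulVec_le v.ofLp

end Localization

theorem interior_C2_estimate_sum_hessian
    (n : ℕ) (hn : 3 ≤ n) (K M m₀ Λ : ℝ)
    (hK : 0 < K) (hM : 0 < M) (hm₀ : 0 < m₀) (hΛ : 0 < Λ) :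
    ∃ C : ℝ, 0 < C ∧
      ∀ (f : EuclideanSpace ℝ (Fin n) × ℝ × EuclideanSpace ℝ (Fin n) → ℝ)
        (u : EuclideanSpace ℝ (Fin n) → ℝ),
        -- f ≥ m₀ on B₅ × ℝ × ℝⁿ
        (∀ z ∈ (Metric.ball (0 : EuclideanSpace ℝ (Fin n)) 5 ×ˢ
            (Set.univ : Set (ℝ × EuclideanSpace ℝ (Fin n)))), m₀ ≤ f z) →
        -- f is C¹ on B₅ × ℝ × ℝⁿ
        ContDiffOn ℝ 1 f (Metric.ball (0 : EuclideanSpace ℝ (Fin n)) 5 ×ˢ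
            (Set.univ : Set (ℝ × EuclideanSpace ℝ (Fin n)))) →
        -- |f| + |Df| ≤ Λ on B₅ × ℝ × ℝⁿ
        (∀ z ∈ (Metric.ball (0 : EuclideanSpace ℝ (Fin n)) 5 ×ˢ
            (Set.univ : Set (ℝ × EuclideanSpace ℝ (Fin n)))),
          |f z| + ‖fderivWithin ℝ f (Metric.ball (0 : EuclideanSpace ℝ (Fin n)) 5 ×ˢ
            (Set.univ : Set (ℝ × EuclideanSpace ℝ (Fin n)))) z‖ ≤ Λ) →
        -- Df is Lipschitz with constant ≤ Λ on B₅ × ℝ × ℝⁿ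
        (∀ z ∈ (Metric.ball (0 : EuclideanSpace ℝ (Fin n)) 5 ×ˢ
            (Set.univ : Set (ℝ × EuclideanSpace ℝ (Fin n)))),
          ∀ w ∈ (Metric.ball (0 : EuclideanSpace ℝ (Fin n)) 5 ×ˢ
            (Set.univ : Set (ℝ × EuclideanSpace ℝ (Fin n)))),
          ‖fderivWithin ℝ f (Metric.ball (0 : EuclideanSpace ℝ (Fin n)) 5 ×ˢ
              (Set.univ : Set (ℝ × EuclideanSpace ℝ (Fin n)))) z -
            fderivWithin ℝ f (Metric.ball (0 : EuclideanSpace ℝ (Fin n)) 5 ×ˢ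
              (Set.univ : Set (ℝ × EuclideanSpace ℝ (Fin n)))) w‖ ≤ Λ * ‖z - w‖) →
        -- u is C⁴ on B₅
        ContDiffOn ℝ 4 u (Metric.ball (0 : EuclideanSpace ℝ (Fin n)) 5) →
        -- admissibility: λ(D²u(x)) ∈ Γ̃₃ on B₅
        (∀ x ∈ Metric.ball (0 : EuclideanSpace ℝ (Fin n)) 5,
          (∀ i : ℕ, 1 ≤ i → i ≤ 2 → 0 < sigmaMat i (hess u x)) ∧
          0 < sigmaMat 3 (hess u x) + sigmaMat 2 (hess u x)) →
        -- the equation σ₃(D²u) + σ₂(D²u) = f(x, u, Du) on B₅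
        (∀ x ∈ Metric.ball (0 : EuclideanSpace ℝ (Fin n)) 5,
          sigmaMat 3 (hess u x) + sigmaMat 2 (hess u x) = f (x, u x, gradient u x)) →
        -- K-semi-convexity on B₅
        (∀ x ∈ Metric.ball (0 : EuclideanSpace ℝ (Fin n)) 5,
          (hess u x + K • (1 : Matrix (Fin n) (Fin n) ℝ)).PosSemidef) →
        -- |u| + |Du| ≤ M on B₅
        (∀ x ∈ Metric.ball (0 : EuclideanSpace ℝ (Fin n)) 5,
          |u x| + ‖gradient u x‖ ≤ M) →
        opNorm (hess u 0) ≤ C := by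
  obtain ⟨c, hc⟩ : ∃ c, c = Λ * (1 + M + n * (K + 1)) + Λ + Λ * n * (1 + M + n * (K + 1)) ^ 2 :=
    ⟨_, rfl⟩
  have hc0 : 0 < c := by rw [hc]; positivity
  obtain ⟨C, hC, hest⟩ := Sol.exists_mS_hess_zero_le hn hK.le hm₀ hΛ hc0 M
  refine ⟨(K + 1) * C, by positivity, fun f u hf0 hf1 hf2 hf3 hu hadm heq hsc hM' => ?_⟩
  obtain ⟨v, hv, hvu⟩ := exists_contDiff_eventuallyEq hu
  have hD : IsOpen (Metric.ball (0 : EuclideanSpace ℝ (Fin n)) 5 ×ˢ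
      (Set.univ : Set (ℝ × EuclideanSpace ℝ (Fin n)))) := Metric.isOpen_ball.prod isOpen_univ
  have hball : ∀ x : Eu n, ‖x‖ < 23 / 5 → x ∈ Metric.ball (0 : Eu n) 5 := fun x hx =>
    mem_ball_zero_iff.2 (by linarith)
  have hpd : ∀ x, ‖x‖ < 23 / 5 → ∀ k, pd k v x = gradient u x k := fun x hx k => by
    rw [gradient_apply, pd, pd, (hvu x hx).fderiv_eq]
  have hjet : ∀ x, ‖x‖ < 23 / 5 → jet v x = (x, u x, gradient u x) := fun x hx =>
    Prod.ext rfl (Prod.ext (hvu x hx).self_of_nhds (by ext k; exact hpd x hx k))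
  have hmadm : ∀ x, ‖x‖ < 23 / 5 → MAdm K m₀ Λ (hess v x) ∧
      mf (hess v x) = f (x, u x, gradient u x) := by
    intro x hx
    have hxb := hball x hx
    have hz : (x, u x, gradient u x) ∈ Metric.ball (0 : EuclideanSpace ℝ (Fin n)) 5 ×ˢ
        (Set.univ : Set (ℝ × EuclideanSpace ℝ (Fin n))) := ⟨hxb, trivial⟩
    have he := heq x hxb
    have hherm : (hess u x).IsHermitian := by
      rw [← eventuallyEq_hess (hvu x hx)]
      ext i j
      exact hess_symm (hv.of_le (by norm_num)) x j i
    rw [eventuallyEq_hess (hvu x hx), ← he]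
    refine mAdm_of_sigmaMat hn hK.le hm₀ hherm (hadm x hxb).1 ?_ ?_ (hsc x hxb)
    · rw [he]; exact hf0 _ hz
    · rw [he]
      exact (le_abs_self _).trans ((le_add_of_nonneg_right (norm_nonneg _)).trans (hf2 _ hz))
  have hsol : Sol K m₀ Λ c M v := by
    rw [hc]
    refine sol_of_equation hK.le hM.le hΛ.le hv hD (ρ := 23 / 5) (by norm_num) (fun x hx => ?_)
      (hf1.differentiableOn one_ne_zero) (fun z hz => ?_) (fun z hz w hw => ?_)
      (fun x hx => (hmadm x (by linarith)).1) (fun x hx k => ?_) (fun x hx => ?_)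
    · exact ⟨hball x hx, trivial⟩
    · rw [← fderivWithin_of_isOpen hD hz]
      exact (le_add_of_nonneg_left (abs_nonneg _)).trans (hf2 z hz)
    · rw [← fderivWithin_of_isOpen hD hz, ← fderivWithin_of_isOpen hD hw]
      exact hf3 z hz w hw
    · have hx' : ‖x‖ < 23 / 5 := by linarith
      rw [hpd x hx' k, ← Real.norm_eq_abs]
      exact (PiLp.norm_apply_le _ k).trans
        ((le_add_of_nonneg_left (abs_nonneg _)).trans (hM' x (hball x hx')))
    · rw [hjet x hx]
      exact (hmadm x hx).2
  have h0 : ‖(0 : Eu n)‖ < 23 / 5 := by rw [norm_zero]; norm_num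
  rw [← eventuallyEq_hess (hvu 0 h0)]
  exact ((hmadm 0 h0).1.opNorm_le hK.le).trans
    (mul_le_mul_of_nonneg_left (hest v hsol) (by positivity))
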